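/- Let C be a smooth projective curve of genus ≥ 2 over ℚ embedded in ℙ³, and suppose the secant map σ : (C×C∖Δ)×ℙ¹ → ℙ³ is dominant (image of dimension 3). Then the induced rational map from Sec(C) to the plane H, factoring through Sym²(C), is generically finite of degree > 1, and hence by Hilbert irreducibility there is a rational point of H with finite fiber not lying in the image of any rational point of Sec(C). -/

import Mathlib

noncomputable section

open MvPolynomial

/-- A fixed algebraic closure of `ℚ`. -/
abbrev QBar := AlgebraicClosure ℚ

/-- Projective 3-space over `ℚ̄`. -/
abbrev P3Bar := Projectivization QBar (Fin 4 → QBar)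

/-- The action of `Gal(ℚ̄/ℚ)` on points of `ℙ³(ℚ̄)`. -/
def galMap (σ : QBar ≃ₐ[ℚ] QBar) (x : P3Bar) : P3Bar :=
  Projectivization.mk QBar (fun i => σ (x.rep i)) (by
    intro h
    apply x.rep_nonzero
    funext i
    exact σ.injective (by simpa using congrFun h i))

/-- A point of `ℙ³(ℚ̄)` is rational if it has rational homogeneous coordinates. -/
def IsRatPoint (x : P3Bar) : Prop :=
  ∃ v : Fin 4 → ℚ, ∃ hv : (fun i => ((v i : ℚ) : QBar)) ≠ 0,
    x = Projectivization.mk QBar (fun i => ((v i : ℚ) : QBar)) hv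

/-- The line in `ℙ³` through two (distinct) points. -/
def projLineBar (a b : P3Bar) : Set P3Bar :=
  {x | x.rep ∈ Submodule.span QBar {a.rep, b.rep}}

/-- The Zariski topology on `ℙ³(ℚ̄)`. -/
def zariskiP3 : TopologicalSpace P3Bar :=
  TopologicalSpace.generateFrom
    {U | ∃ f : MvPolynomial (Fin 4) QBar, (∃ d, f.IsHomogeneous d) ∧
      U = {x : P3Bar | eval x.rep f ≠ 0}}

/-- A curve in `ℙ³`: an irreducible Zariski-closed subset of Krull dimension one. -/
def IsCurveP3 (C : Set P3Bar) : Prop :=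
  @IsClosed _ zariskiP3 C ∧ @IsIrreducible _ zariskiP3 C ∧
    @topologicalKrullDim C (TopologicalSpace.induced Subtype.val zariskiP3) = 1

/-- The union of all secant lines of `C` (image of the secant map). -/
def secantImage (C : Set P3Bar) : Set P3Bar :=
  {x | ∃ a ∈ C, ∃ b ∈ C, a ≠ b ∧ x ∈ projLineBar a b}

/-- The fiber over `u ∈ H` of the rational map `Sec(C) ⇢ H` (equivalently, of
`Sym²(C) ⇢ H`): (ordered) pairs of distinct points of `C` whose secant line
passes through `u`. -/
def secantFiber (C : Set P3Bar) (u : P3Bar) : Set (P3Bar × P3Bar) :=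
  {p | p.1 ∈ C ∧ p.2 ∈ C ∧ p.1 ≠ p.2 ∧ u ∈ projLineBar p.1 p.2}

namespace S19

/-- Expansion at `a`: `ℚ[X] → ℂ[X]`, `X ↦ X + a`. -/
def shiftC (a : ℚ) : Polynomial ℚ →+* Polynomial ℂ :=
  (Polynomial.compRingHom (Polynomial.X + Polynomial.C (a : ℂ))).comp
    (Polynomial.mapRingHom (algebraMap ℚ ℂ))

lemma shiftC_eval (a : ℚ) (p : Polynomial ℚ) (x : ℂ) :
    (shiftC a p).eval x = Polynomial.aeval (x + a) p := by
  simp [shiftC, Polynomial.eval_comp, Polynomial.eval_map_algebraMap]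

/-- Expansion at `a` as a power series. -/
def shiftPS (a : ℚ) : Polynomial ℚ →+* PowerSeries ℂ :=
  (Polynomial.coeToPowerSeries.ringHom).comp (shiftC a)

def SplitsAt (P : Polynomial (Polynomial ℚ)) (a : ℚ) : Prop :=
  ∃ s : Multiset (PowerSeries ℂ),
    P.map (shiftPS a) = (s.map (fun r => Polynomial.X - Polynomial.C r)).prod

lemma SplitsAt.mul {P Q : Polynomial (Polynomial ℚ)} {a : ℚ} (hP : SplitsAt P a)
    (hQ : SplitsAt Q a) : SplitsAt (P * Q) a := by
  obtain ⟨s, hs⟩ := hP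
  obtain ⟨t, ht⟩ := hQ
  exact ⟨s + t, by simp [hs, ht]⟩

lemma constCoeff_shiftPS (a : ℚ) (p : Polynomial ℚ) :
    PowerSeries.constantCoeff (shiftPS a p) = ((p.eval a : ℚ) : ℂ) := by
  have h : PowerSeries.constantCoeff (shiftPS a p) = (shiftC a p).eval 0 := by
    simp [shiftPS, Polynomial.coeff_zero_eq_eval_zero]
  rw [h, shiftC_eval]
  simpa using (Polynomial.aeval_algebraMap_apply ℂ a p)

lemma splitsAt_of_bezout {P : Polynomial (Polynomial ℚ)} (hP : P.Monic)
    {A B : Polynomial (Polynomial ℚ)} {D : Polynomial ℚ}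
    (h : P * A + Polynomial.derivative P * B = Polynomial.C D) {a : ℚ} (ha : D.eval a ≠ 0) :
    SplitsAt P a := by
  classical
  set F := P.map (shiftPS a) with hF
  have hFm : F.Monic := hP.map _
  let cc : PowerSeries ℂ →+* ℂ := PowerSeries.constantCoeff
  set f : Polynomial ℂ := F.map cc with hf
  have hfm : f.Monic := hFm.map _
  have hsplit : f.Splits := IsAlgClosed.splits f
  have hroots : (f.roots.map (fun r => Polynomial.X - Polynomial.C r)).prod = f := by
    conv_rhs => rw [hsplit.eq_prod_roots]
    simp [hfm.leadingCoeff]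
  have hbez : f * (A.map (cc.comp (shiftPS a))) +
      Polynomial.derivative f * (B.map (cc.comp (shiftPS a))) = Polynomial.C ((D.eval a : ℚ) : ℂ) := by
    have := congrArg (Polynomial.map (cc.comp (shiftPS a))) h
    simp only [Polynomial.map_add, Polynomial.map_mul, Polynomial.map_C] at this
    rw [hf, hF, Polynomial.map_map, Polynomial.derivative_map, this]
    congr 1
    exact constCoeff_shiftPS a D
  have hcop : f.Separable := by
    have hu : IsUnit (Polynomial.C ((D.eval a : ℚ) : ℂ)) := by
      rw [Polynomial.isUnit_C]; exact IsUnit.mk0 _ (by exact_mod_cast ha)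
    rw [← hbez] at hu
    obtain ⟨u, hu⟩ := hu
    refine ⟨A.map (cc.comp (shiftPS a)) * ↑u⁻¹, B.map (cc.comp (shiftPS a)) * ↑u⁻¹, ?_⟩
    have h1 : (u : Polynomial ℂ) * ↑u⁻¹ = 1 := u.mul_inv
    rw [hu] at h1
    linear_combination h1
  have hnodup : f.roots.Nodup := Polynomial.nodup_roots hcop
  have hlift : ∀ r ∈ f.roots, ∃ q : PowerSeries ℂ, F.IsRoot q ∧ cc q = r := by
    intro r hr
    have hr0 : f.eval r = 0 := (Polynomial.mem_roots'.1 hr).2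
    have hd : (Polynomial.derivative f).eval r ≠ 0 := hcop.eval₂_derivative_ne_zero (RingHom.id ℂ) (by simpa [Polynomial.eval₂_id] using hr0)
    have hcon : ∀ G : Polynomial (PowerSeries ℂ), cc (G.eval (PowerSeries.C r)) = (G.map cc).eval r := by
      intro G
      rw [Polynomial.eval_map]
      have := Polynomial.hom_eval₂ G (RingHom.id _) cc (PowerSeries.C r)
      simpa [cc] using this
    obtain ⟨q, hq, hq2⟩ := HenselianRing.is_henselian (R := PowerSeries ℂ) (I := Ideal.span {PowerSeries.X})
      F hFm (PowerSeries.C r)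
      (by rw [Ideal.mem_span_singleton, PowerSeries.X_dvd_iff]; exact (hcon F).trans hr0)
      (by
        apply IsUnit.map
        rw [PowerSeries.isUnit_iff_constantCoeff]
        refine IsUnit.mk0 _ ?_
        have := hcon (Polynomial.derivative F)
        rw [← Polynomial.derivative_map] at this
        exact fun h => hd (this.symm.trans h))
    refine ⟨q, hq, ?_⟩
    rw [Ideal.mem_span_singleton, PowerSeries.X_dvd_iff, map_sub, sub_eq_zero] at hq2
    simpa using hq2
  choose! q hq1 hq2 using hlift
  refine ⟨f.roots.map q, ?_⟩
  have hle : f.roots.map q ≤ F.roots := by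
    rw [Multiset.le_iff_subset]
    · intro x hx
      obtain ⟨r, hr, rfl⟩ := Multiset.mem_map.1 hx
      exact (Polynomial.mem_roots hFm.ne_zero).2 (hq1 r hr)
    · refine hnodup.map_on ?_
      intro x hx y hy hxy
      rw [← hq2 x hx, hxy, hq2 y hy]
  have hdvd := (Multiset.prod_X_sub_C_dvd_iff_le_roots hFm.ne_zero _).2 hle
  symm
  refine Polynomial.eq_of_dvd_of_natDegree_le_of_leadingCoeff hdvd ?_ ?_
  · rw [Polynomial.natDegree_multiset_prod_X_sub_C_eq_card, Multiset.card_map]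
    rw [← hFm.natDegree_map cc, ← hf]
    conv_lhs => rw [← hroots]
    rw [Polynomial.natDegree_multiset_prod_X_sub_C_eq_card]
  · rw [hFm.leadingCoeff]
    exact Polynomial.monic_multiset_prod_of_monic _ _ (fun i _ => Polynomial.monic_X_sub_C i)

lemma splitsAt_eventually (P : Polynomial (Polynomial ℚ)) (hP : P.Monic) :
    ∀ᶠ a : ℚ in Filter.cofinite, SplitsAt P a := by
  induction hn : P.natDegree using Nat.strong_induction_on generalizing P with
  | _ n ih =>
  by_cases hP1 : P = 1
  · subst hP1
    exact Filter.Eventually.of_forall fun a => ⟨0, by simp⟩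
  by_cases hirr : Irreducible P
  · let K := RatFunc ℚ
    have hirr' := (hP.irreducible_iff_irreducible_map_fraction_map (K := K)).1 hirr
    have hsep := hirr'.separable
    have hdeg : P.natDegree ≠ 0 := fun h => hP1 (Polynomial.eq_one_of_monic_natDegree_zero hP h)
    obtain ⟨A, B, -, -, hAB⟩ := Polynomial.exists_mul_add_mul_eq_C_resultant P (Polynomial.derivative P) le_rfl le_rfl (Or.inl hdeg)
    have hD : P.resultant (Polynomial.derivative P) ≠ 0 := by
      intro h0
      have h1 := congrArg (algebraMap (Polynomial ℚ) K) h0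
      rw [← Polynomial.resultant_map_map, map_zero] at h1
      rw [← Polynomial.natDegree_map_eq_of_injective (f := algebraMap (Polynomial ℚ) K) (IsFractionRing.injective _ _) P, ← Polynomial.natDegree_map_eq_of_injective (f := algebraMap (Polynomial ℚ) K) (IsFractionRing.injective _ _) (Polynomial.derivative P), Polynomial.resultant_eq_zero_iff] at h1
      apply h1.2
      rw [← Polynomial.derivative_map]
      exact hsep
    have hfin : ((P.resultant (Polynomial.derivative P)).roots.toFinset : Set ℚ).Finite := Finset.finite_toSet _
    refine Filter.mem_of_superset hfin.compl_mem_cofinite ?_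
    intro a ha
    refine splitsAt_of_bezout hP hAB ?_
    intro h0
    apply ha
    have h1 : a ∈ (P.resultant (Polynomial.derivative P)).roots := (Polynomial.mem_roots hD).2 h0
    simpa only [Finset.mem_coe, Multiset.mem_toFinset] using h1
  · rw [hP.irreducible_iff_natDegree] at hirr
    push Not at hirr
    obtain ⟨f, g, hf, hg, hfg, hf0, hg0⟩ := hirr hP1
    have hd : f.natDegree + g.natDegree = n := by rw [← hn, ← hfg, hf.natDegree_mul hg]
    filter_upwards [ih f.natDegree (by omega) f hf rfl, ih g.natDegree (by omega) g hg rfl] with a h1 h2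
    rw [← hfg]
    exact h1.mul h2

end S19

namespace S19

lemma continuous_evalEval (R : Polynomial (Polynomial ℂ)) :
    Continuous (fun p : ℂ × ℂ => R.evalEval p.1 p.2) := by
  induction R using Polynomial.induction_on' with
  | add p q hp hq => simp only [Polynomial.evalEval_add]; exact hp.add hq
  | monomial n c =>
    have : (fun p : ℂ × ℂ => (Polynomial.monomial n c).evalEval p.1 p.2) = fun p => c.eval p.1 * p.2 ^ n := by
      funext p
      simp [Polynomial.evalEval]
    rw [this]
    exact ((Polynomial.continuous c).comp continuous_fst).mul (continuous_snd.pow n)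

lemma prod_gt_pow (s : Multiset ℝ) (t : ℝ) (ht : 0 ≤ t) (h : ∀ x ∈ s, t < x) :
    t ^ s.card ≤ s.prod ∧ (s ≠ 0 → t ^ s.card < s.prod) := by
  induction s using Multiset.induction_on with
  | empty => simp
  | cons a s ih =>
    have ha := h a (Multiset.mem_cons_self a s)
    have ih1 := (ih (fun x hx => h x (Multiset.mem_cons_of_mem hx))).1
    have hpos : 0 < s.prod := by
      apply Multiset.prod_pos
      intro x hx
      exact lt_of_le_of_lt ht (h x (Multiset.mem_cons_of_mem hx))
    have key : t ^ (a ::ₘ s).card < (a ::ₘ s).prod := by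
      rw [Multiset.card_cons, Multiset.prod_cons, pow_succ']
      calc t * t ^ s.card ≤ t * s.prod := by gcongr
        _ < a * s.prod := by gcongr
    exact ⟨key.le, fun _ => key⟩

lemma poly_bound (p : Polynomial ℂ) : ∃ b : ℝ, 0 ≤ b ∧ ∀ x : ℂ, ‖x‖ ≤ 1 → ‖p.eval x‖ ≤ b := by
  obtain ⟨b, hb⟩ := (isCompact_closedBall (0 : ℂ) 1).exists_bound_of_continuousOn (f := fun x => p.eval x)
    p.continuous.continuousOn
  exact ⟨max b 0, le_max_right _ _, fun x hx => (hb x (by simpa using hx)).trans (le_max_left _ _)⟩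

lemma roots_bound (P : Polynomial (Polynomial ℂ)) (hP : P.Monic) :
    ∃ B : ℝ, ∀ x φ : ℂ, ‖x‖ ≤ 1 → P.evalEval x φ = 0 → ‖φ‖ ≤ B := by
  choose b hb0 hb using fun i => poly_bound (P.coeff i)
  refine ⟨∑ i ∈ Finset.range P.natDegree, b i + 1, ?_⟩
  intro x φ hx h0
  set p := P.map (Polynomial.evalRingHom x) with hp
  have hpm : p.Monic := hP.map _
  have hr : p.IsRoot φ := by
    rw [Polynomial.IsRoot, hp, Polynomial.eval_map]
    rw [← h0, Polynomial.evalEval]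
    have := Polynomial.hom_eval₂ P (RingHom.id _) (Polynomial.evalRingHom x) (Polynomial.C φ)
    simp only [Polynomial.coe_evalRingHom, RingHomCompTriple.comp_eq, Polynomial.eval_C] at this
    rw [← this]; rfl
  have := hr.norm_lt_cauchyBound hpm.ne_zero
  refine le_trans (le_of_lt (by exact_mod_cast this)) ?_
  rw [Polynomial.cauchyBound, hpm.leadingCoeff]
  simp only [nnnorm_one, div_one]
  refine add_le_add ?_ le_rfl
  have hdeg : p.natDegree = P.natDegree := hP.natDegree_map _
  have : (Finset.range p.natDegree).sup (fun i => ‖p.coeff i‖₊) ≤ ∑ i ∈ Finset.range P.natDegree, (b i).toNNReal := by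
    apply Finset.sup_le
    intro i hi
    rw [hdeg] at hi
    refine le_trans ?_ (Finset.single_le_sum (f := fun i => (b i).toNNReal) (fun _ _ => zero_le) hi)
    rw [← NNReal.coe_le_coe, Real.coe_toNNReal _ (hb0 i)]
    simpa [hp] using hb i x hx
  have h2 := NNReal.coe_le_coe.2 this
  rw [NNReal.coe_sum] at h2
  simp only [Real.coe_toNNReal _ (hb0 _)] at h2
  exact h2

lemma trunc_sub_dvd (r : PowerSeries ℂ) (m M : ℕ) (h : m ≤ M) :
    (Polynomial.X : Polynomial ℂ) ^ m ∣ PowerSeries.trunc M r - PowerSeries.trunc m r := by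
  rw [Polynomial.X_pow_dvd_iff]
  intro d hd
  simp [PowerSeries.coeff_trunc, hd, lt_of_lt_of_le hd h]

lemma branch (P : Polynomial (Polynomial ℚ)) (hP : P.Monic) (m : ℕ) (a : ℚ) (hs : SplitsAt P a) :
    ∃ Q : Finset (Polynomial ℂ), (∀ q ∈ Q, q.natDegree ≤ m) ∧ ∃ C : ℝ, 0 ≤ C ∧
      ∀ x φ : ℂ, ‖x‖ ≤ 1 → (P.map (shiftC a)).evalEval x φ = 0 →
        ∃ q ∈ Q, ‖φ - q.eval x‖ ≤ C * ‖x‖ ^ (m + 1) := by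
  classical
  obtain ⟨s, hs⟩ := hs
  set P' := P.map (shiftC a) with hP'
  have hP'm : P'.Monic := hP.map _
  set n := s.card with hn
  set M := n * (m + 1) with hM
  set Pp : Polynomial (Polynomial ℂ) :=
    (s.map (fun r => Polynomial.X - Polynomial.C (PowerSeries.trunc M r))).prod with hPp
  have hdvd : Polynomial.C ((Polynomial.X : Polynomial ℂ) ^ M) ∣ P' - Pp := by
    rw [Polynomial.C_dvd_iff_dvd_coeff]
    intro i
    let I : Ideal (PowerSeries ℂ) := Ideal.span {PowerSeries.X ^ M}
    let co : Polynomial ℂ →+* PowerSeries ℂ := Polynomial.coeToPowerSeries.ringHom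
    let mk := Ideal.Quotient.mk I
    have hmk : ∀ r : PowerSeries ℂ, mk (co (PowerSeries.trunc M r)) = mk r := by
      intro r
      rw [Ideal.Quotient.eq, Ideal.mem_span_singleton, PowerSeries.X_pow_dvd_iff]
      intro d hd
      simp [co, PowerSeries.coeff_trunc, hd]
    have h1 : P'.map (mk.comp co) = Pp.map (mk.comp co) := by
      have e1 : P'.map (mk.comp co) = (P.map (shiftPS a)).map mk := by
        rw [hP', Polynomial.map_map, Polynomial.map_map]; rfl
      rw [e1, hs, hPp, Polynomial.map_multiset_prod, Polynomial.map_multiset_prod, Multiset.map_map, Multiset.map_map]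
      congr 1
      apply Multiset.map_congr rfl
      intro r _
      simp only [Function.comp, Polynomial.map_sub, Polynomial.map_X, Polynomial.map_C, RingHom.comp_apply, hmk]
    have h2 := congrArg (fun p => Polynomial.coeff p i) h1
    simp only [Polynomial.coeff_map, RingHom.comp_apply] at h2
    rw [Ideal.Quotient.eq, ← map_sub, Ideal.mem_span_singleton, PowerSeries.X_pow_dvd_iff] at h2
    rw [Polynomial.X_pow_dvd_iff]
    intro d hd
    have := h2 d hd
    simpa [co] using this
  obtain ⟨Rr, hRr⟩ := hdvd
  obtain ⟨B, hB⟩ := roots_bound P' hP'm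
  obtain ⟨b, hb⟩ := ((isCompact_closedBall (0 : ℂ) 1).prod (isCompact_closedBall (0 : ℂ) B)).exists_bound_of_continuousOn
    (continuous_evalEval Rr).continuousOn
  have htr : ∀ r : PowerSeries ℂ, ∃ c : ℝ, 0 ≤ c ∧ (n ≠ 0 → ∀ x : ℂ, ‖x‖ ≤ 1 →
      ‖(PowerSeries.trunc M r).eval x - (PowerSeries.trunc (m+1) r).eval x‖ ≤ c * ‖x‖ ^ (m+1)) := by
    intro r
    by_cases hn0 : n = 0
    · exact ⟨0, le_rfl, fun h => (h hn0).elim⟩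
    obtain ⟨w, hw⟩ := trunc_sub_dvd r (m+1) M (by rw [hM]; exact Nat.le_mul_of_pos_left _ (Nat.pos_of_ne_zero hn0))
    obtain ⟨c, hc0, hc⟩ := poly_bound w
    refine ⟨c, hc0, fun _ x hx => ?_⟩
    rw [← Polynomial.eval_sub, hw]
    simp only [Polynomial.eval_mul, Polynomial.eval_pow, Polynomial.eval_X, norm_mul, norm_pow]
    rw [mul_comm]
    gcongr
    exact hc x hx
  choose c hc0 hc using htr
  refine ⟨s.toFinset.image (fun r => PowerSeries.trunc (m+1) r), ?_, (|b| + 1) + ∑ r ∈ s.toFinset, c r, ?_, ?_⟩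
  · intro q hq
    obtain ⟨r, -, rfl⟩ := Finset.mem_image.1 hq
    exact Nat.lt_succ_iff.1 (PowerSeries.natDegree_trunc_lt r m)
  · have := Finset.sum_nonneg (s := s.toFinset) (f := c) (fun i _ => hc0 i)
    positivity
  intro x φ hx h0
  have hval : Pp.evalEval x φ = (s.map (fun r => φ - (PowerSeries.trunc M r).eval x)).prod := by
    have : Pp.evalEval x φ = Polynomial.evalEvalRingHom x φ Pp := rfl
    rw [this, hPp, map_multiset_prod, Multiset.map_map]
    congr 1
    apply Multiset.map_congr rfl
    intro r _
    simp
  have hsmall : ‖Pp.evalEval x φ‖ ≤ |b| * ‖x‖ ^ M := by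
    have h3 := congrArg (Polynomial.evalEval x φ) hRr
    rw [Polynomial.evalEval_sub, h0, Polynomial.evalEval_mul, Polynomial.evalEval_C] at h3
    have h4 : ‖Pp.evalEval x φ‖ = ‖x‖ ^ M * ‖Rr.evalEval x φ‖ := by
      rw [← norm_neg, ← zero_sub, h3]; simp
    rw [h4, mul_comm]
    gcongr
    refine (hb (x, φ) ⟨by simpa using hx, by simpa using hB x φ hx h0⟩).trans (le_abs_self b)
  have hn0 : n ≠ 0 := by
    intro hn0
    have hs0 : s = 0 := Multiset.card_eq_zero.1 hn0
    have hP1 : P'.natDegree = 0 := by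
      rw [hP', hP.natDegree_map, ← hP.natDegree_map (shiftPS a), hs, hs0]; simp
    have := Polynomial.eq_one_of_monic_natDegree_zero hP'm hP1
    rw [this] at h0
    simp at h0
  have hex : ∃ r ∈ s, ‖φ - (PowerSeries.trunc M r).eval x‖ ≤ (|b| + 1) * ‖x‖ ^ (m + 1) := by
    by_contra hcon
    push Not at hcon
    have hs0 : s ≠ 0 := fun h => hn0 (by rw [hn, h]; simp)
    have h5 := (prod_gt_pow (s.map (fun r => ‖φ - (PowerSeries.trunc M r).eval x‖)) ((|b| + 1) * ‖x‖ ^ (m + 1)) (by positivity)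
      (by
        intro y hy
        obtain ⟨r, hr, rfl⟩ := Multiset.mem_map.1 hy
        exact hcon r hr)).2 (by simpa using hs0)
    rw [Multiset.card_map, ← hn, mul_pow, ← pow_mul, mul_comm (m+1) n, ← hM] at h5
    have h6 : (s.map (fun r => ‖φ - (PowerSeries.trunc M r).eval x‖)).prod = ‖Pp.evalEval x φ‖ := by
      rw [hval]
      have := map_multiset_prod (normHom : ℂ →*₀ ℝ) (s.map (fun r => φ - (PowerSeries.trunc M r).eval x))
      rw [Multiset.map_map] at this
      exact this.symm
    rw [h6] at h5
    have h7 : |b| * ‖x‖ ^ M ≤ (|b| + 1) ^ n * ‖x‖ ^ M := by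
      gcongr
      calc |b| ≤ |b| + 1 := by linarith
        _ ≤ (|b| + 1) ^ n := le_self_pow₀ (by linarith [abs_nonneg b]) hn0
    linarith
  obtain ⟨r, hr, hr2⟩ := hex
  refine ⟨_, Finset.mem_image_of_mem _ (Multiset.mem_toFinset.2 hr), ?_⟩
  have hc1 : c r ≤ ∑ r ∈ s.toFinset, c r :=
    Finset.single_le_sum (f := c) (fun i _ => hc0 i) (Multiset.mem_toFinset.2 hr)
  calc ‖φ - (PowerSeries.trunc (m+1) r).eval x‖ = ‖(φ - (PowerSeries.trunc M r).eval x) + ((PowerSeries.trunc M r).eval x - (PowerSeries.trunc (m+1) r).eval x)‖ := by ring_nf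
    _ ≤ _ := norm_add_le _ _
    _ ≤ (|b| + 1) * ‖x‖ ^ (m + 1) + c r * ‖x‖ ^ (m + 1) := add_le_add hr2 (hc r hn0 x hx)
    _ ≤ _ := by rw [← add_mul]; gcongr

end S19

namespace S19

/-- integrality of the root after clearing denominators -/
lemma integral_root (p : Polynomial ℚ) (hp : p.Monic) (d : ℤ) (hd : ∀ i, ∃ z : ℤ, (d : ℚ) * p.coeff i = z)
    (y : ℚ) (hy : p.eval y = 0) : ∃ z : ℤ, (d : ℚ) * y = z := by
  have hintg : IsIntegral ℤ ((d : ℚ) * y) := by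
    have hroot : (p.scaleRoots (d : ℚ)).eval ((d : ℚ) * y) = 0 := by
      have := Polynomial.scaleRoots_eval₂_mul (p := p) (RingHom.id ℚ) y (d : ℚ)
      rw [Polynomial.eval₂_id, Polynomial.eval₂_id, hy, mul_zero] at this
      exact this
    have hlift : p.scaleRoots (d : ℚ) ∈ Polynomial.lifts (Int.castRingHom ℚ) := by
      rw [Polynomial.lifts_iff_coeff_lifts]
      intro i
      rw [Polynomial.coeff_scaleRoots]
      rcases lt_trichotomy i p.natDegree with h | h | h
      · obtain ⟨z, hz⟩ := hd i
        refine ⟨z * d ^ (p.natDegree - i - 1), ?_⟩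
        have : p.natDegree - i = (p.natDegree - i - 1) + 1 := by omega
        rw [this, pow_succ]
        simp [← hz]; ring
      · subst h
        exact ⟨1, by simp [hp.coeff_natDegree]⟩
      · exact ⟨0, by simp [Polynomial.coeff_eq_zero_of_natDegree_lt h]⟩
    obtain ⟨q, hq1, hq2, hq3⟩ := Polynomial.lifts_and_natDegree_eq_and_monic hlift ((Polynomial.monic_scaleRoots_iff _).2 hp)
    refine ⟨q, hq3, ?_⟩
    rw [Polynomial.eval₂_eq_eval_map]
    have : algebraMap ℤ ℚ = Int.castRingHom ℚ := rfl
    rw [this, hq1, hroot]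
  obtain ⟨z, hz⟩ := IsIntegrallyClosed.isIntegral_iff.1 hintg
  exact ⟨z, by simpa using hz.symm⟩

lemma exists_common_den (p : Polynomial (Polynomial ℚ)) : ∃ e : ℕ, 0 < e ∧ ∀ i j, ∃ z : ℤ, (e : ℚ) * (p.coeff i).coeff j = z := by
  have key : ∀ s : Finset ℚ, ∃ e : ℕ, 0 < e ∧ ∀ x ∈ s, ∃ z : ℤ, (e : ℚ) * x = z := by
    intro s
    refine ⟨∏ x ∈ s, x.den, Finset.prod_pos fun x _ => x.den_pos, ?_⟩
    intro x hx
    obtain ⟨k, hk⟩ := Finset.dvd_prod_of_mem (fun x : ℚ => x.den) hx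
    refine ⟨k * x.num, ?_⟩
    rw [hk]; push_cast
    have := Rat.den_mul_eq_num x
    rw [← this]; ring
  obtain ⟨e, he, h⟩ := key (p.support.biUnion fun i => (p.coeff i).coeffs)
  refine ⟨e, he, fun i j => ?_⟩
  by_cases h0 : (p.coeff i).coeff j = 0
  · exact ⟨0, by simp [h0]⟩
  apply h
  rw [Finset.mem_biUnion]
  refine ⟨i, ?_, Polynomial.coeff_mem_coeffs h0⟩
  rw [Polynomial.mem_support_iff]
  intro h1; rw [h1] at h0; simp at h0

/-- `T^m * p(1/T)` is a polynomial in `T` with the reversed coefficients. -/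
lemma eval_inv_eq {F : Type*} [Field F] (p : Polynomial F) (m : ℕ) (hm : p.natDegree ≤ m) (T : F) (hT : T ≠ 0) :
    T ^ m * p.eval T⁻¹ = (Polynomial.reflect m p).eval T := by
  have : Invertible T := invertibleOfNonzero hT
  have h := Polynomial.eval₂_reflect_mul_pow (RingHom.id F) T m (Polynomial.reflect m p)
    (Polynomial.natDegree_reflect_le.trans (max_le le_rfl hm))
  simp only [Polynomial.reflect_reflect, invOf_eq_inv, Polynomial.eval₂_id] at h
  rw [← h, mul_comm]

lemma divdiff_zero (m e : ℕ) (he : 0 < e) (B : ℕ) (C : ℝ) (hC : 0 ≤ C) :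
    ∃ T0 : ℕ, ∀ T ≥ T0, ∀ q : Polynomial ℂ, q.natDegree ≤ m → ∀ S : Finset ℕ,
      S ⊆ Finset.Icc T (T + B) → S.card = m + 2 → ∀ z : ℕ → ℚ,
      (∀ i ∈ S, ∃ w : ℤ, (e : ℚ) * z i = w) →
      (∀ i ∈ S, ‖((z i : ℚ) : ℂ) - q.eval (i : ℂ)‖ ≤ C / i) →
      ∑ i ∈ S, z i / ∏ j ∈ S.erase i, ((i : ℚ) - j) = 0 := by
  classical
  obtain ⟨T0, hT0⟩ := exists_nat_gt ((m + 2 : ℝ) * C * (e * ((B : ℝ) ^ (m + 1)) ^ (m + 2)))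
  refine ⟨T0 + 1, fun T hT q hq S hS hcard z hz hzq => ?_⟩
  set den : ℕ → ℚ := fun i => ∏ j ∈ S.erase i, ((i : ℚ) - j) with hden
  have hdenint : ∀ i, ∃ w : ℤ, den i = w := fun i => ⟨∏ j ∈ S.erase i, ((i : ℤ) - j), by simp [hden]⟩
  have hden0 : ∀ i, den i ≠ 0 := by
    intro i
    rw [hden]
    refine Finset.prod_ne_zero_iff.2 fun j hj => ?_
    rw [sub_ne_zero]
    exact_mod_cast (Finset.ne_of_mem_erase hj).symm
  have hden1 : ∀ i, (1 : ℝ) ≤ |(den i : ℝ)| := by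
    intro i
    obtain ⟨w, hw⟩ := hdenint i
    have hw0 : w ≠ 0 := by rintro rfl; exact hden0 i (by simp [hw])
    rw [hw]
    have := Int.one_le_abs hw0
    simpa using (by exact_mod_cast this : (1 : ℝ) ≤ |(w : ℝ)|)
  have hdenB : ∀ i ∈ S, |(den i : ℝ)| ≤ (B : ℝ) ^ (m + 1) := by
    intro i hi
    rw [hden]
    push_cast
    rw [Finset.abs_prod]
    have hc : (S.erase i).card = m + 1 := by rw [Finset.card_erase_of_mem hi, hcard]; rfl
    rw [← hc, ← Finset.prod_const]
    refine Finset.prod_le_prod (fun _ _ => abs_nonneg _) fun j hj => ?_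
    have h1 := Finset.mem_Icc.1 (hS hi)
    have h2 := Finset.mem_Icc.1 (hS (Finset.mem_of_mem_erase hj))
    rw [abs_le]
    have a1 : (T : ℝ) ≤ i := by exact_mod_cast h1.1
    have a2 : (i : ℝ) ≤ T + B := by exact_mod_cast h1.2
    have a3 : (T : ℝ) ≤ j := by exact_mod_cast h2.1
    have a4 : (j : ℝ) ≤ T + B := by exact_mod_cast h2.2
    constructor <;> linarith
  set L := ∑ i ∈ S, z i / den i with hL
  set D : ℚ := e * ∏ i ∈ S, den i with hD
  have hTpos : (0 : ℝ) < T := by exact_mod_cast (by omega : 0 < T)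
  -- smallness
  have hLsmall : |(L : ℝ)| ≤ (m + 2) * (C / T) := by
    have hpoly : ∑ i ∈ S, q.eval (i : ℂ) / (den i : ℂ) = 0 := by
      have := Lagrange.coeff_eq_sum (F := ℂ) (s := S) (v := fun i : ℕ => (i : ℂ))
        (fun a _ b _ h => Nat.cast_injective h) (P := q)
        (lt_of_le_of_lt Polynomial.degree_le_natDegree (by rw [hcard]; exact_mod_cast (by omega : q.natDegree < m + 2)))
      rw [Polynomial.coeff_eq_zero_of_natDegree_lt (by rw [hcard]; omega)] at this
      rw [this]
      apply Finset.sum_congr rfl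
      intro i _
      rw [hden]; push_cast; rfl
    have hLC : ((L : ℚ) : ℂ) = ∑ i ∈ S, (((z i : ℚ) : ℂ) - q.eval (i : ℂ)) / (den i : ℂ) := by
      simp only [sub_div, Finset.sum_sub_distrib, hpoly, sub_zero]
      rw [hL]; push_cast; rfl
    have : |(L : ℝ)| = ‖((L : ℚ) : ℂ)‖ := by
      rw [← Complex.ofReal_ratCast, Complex.norm_real, Real.norm_eq_abs]
    rw [this, hLC]
    refine (norm_sum_le _ _).trans ?_
    have hb : ∀ i ∈ S, ‖(((z i : ℚ) : ℂ) - q.eval (i : ℂ)) / (den i : ℂ)‖ ≤ C / T := by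
      intro i hi
      rw [norm_div]
      have hn : ‖((den i : ℚ) : ℂ)‖ = |(den i : ℝ)| := by
        rw [← Complex.ofReal_ratCast, Complex.norm_real, Real.norm_eq_abs]
      rw [hn]
      have a1 : (T : ℝ) ≤ i := by exact_mod_cast (Finset.mem_Icc.1 (hS hi)).1
      calc _ ≤ ‖((z i : ℚ) : ℂ) - q.eval (i : ℂ)‖ := div_le_self (norm_nonneg _) (hden1 i)
        _ ≤ C / i := hzq i hi
        _ ≤ C / T := by gcongr
    refine (Finset.sum_le_sum hb).trans ?_
    rw [Finset.sum_const, hcard]; simp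
  have hDB : |(D : ℝ)| ≤ e * ((B : ℝ) ^ (m + 1)) ^ (m + 2) := by
    rw [hD]; push_cast
    rw [abs_mul, Finset.abs_prod, Nat.abs_cast]
    gcongr
    rw [← hcard, ← Finset.prod_const]
    exact Finset.prod_le_prod (fun _ _ => abs_nonneg _) hdenB
  have hDint : ∃ w : ℤ, D * L = w := by
    choose! w hw using hz
    choose d hd using hdenint
    refine ⟨∑ i ∈ S, w i * ∏ j ∈ S.erase i, d j, ?_⟩
    rw [hL, Finset.mul_sum]; push_cast
    apply Finset.sum_congr rfl
    intro i hi
    rw [← hw i hi, hD, ← Finset.mul_prod_erase S _ hi]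
    simp only [← hd]
    field_simp [hden0 i]
  obtain ⟨w, hw⟩ := hDint
  have hw1 : |(w : ℝ)| < 1 := by
    have : (w : ℝ) = D * L := by exact_mod_cast hw.symm
    rw [this, abs_mul]
    have h1 : |(D : ℝ)| * |(L : ℝ)| ≤ (e * ((B : ℝ) ^ (m + 1)) ^ (m + 2)) * ((m + 2) * (C / T)) := by gcongr
    refine lt_of_le_of_lt h1 ?_
    have h2 : (e * ((B : ℝ) ^ (m + 1)) ^ (m + 2)) * ((m + 2) * (C / T)) = ((m + 2 : ℝ) * C * (e * ((B : ℝ) ^ (m + 1)) ^ (m + 2))) / T := by ring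
    rw [h2, div_lt_one hTpos]
    refine hT0.trans ?_
    exact_mod_cast (by omega : T0 < T)
  have hw0 : w = 0 := by
    rw [← Int.abs_lt_one_iff]
    exact_mod_cast hw1
  rw [hw0] at hw
  have hD0 : D ≠ 0 := by
    rw [hD]
    refine mul_ne_zero (by exact_mod_cast he.ne') (Finset.prod_ne_zero_iff.2 fun i _ => hden0 i)
  simpa [hD0] using hw

lemma poly_on_block (m e : ℕ) (he : 0 < e) (B : ℕ) (C : ℝ) (hC : 0 ≤ C) :
    ∃ T0 : ℕ, ∀ T ≥ T0, ∀ q : Polynomial ℂ, q.natDegree ≤ m → ∀ S : Finset ℕ,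
      S ⊆ Finset.Icc T (T + B) → m + 2 ≤ S.card → ∀ z : ℕ → ℚ,
      (∀ i ∈ S, ∃ w : ℤ, (e : ℚ) * z i = w) →
      (∀ i ∈ S, ‖((z i : ℚ) : ℂ) - q.eval (i : ℂ)‖ ≤ C / i) →
      ∃ g : Polynomial ℚ, g.natDegree ≤ m ∧ ∀ i ∈ S, g.eval (i : ℚ) = z i := by
  classical
  obtain ⟨T0, hT0⟩ := divdiff_zero m e he B C hC
  refine ⟨T0, fun T hT q hq S hS hcard z hz hzq => ?_⟩
  obtain ⟨S0, hS0, hS0c⟩ := Finset.exists_subset_card_eq (show m + 1 ≤ S.card by omega)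
  have hinj : ∀ U : Finset ℕ, Set.InjOn (fun i : ℕ => (i : ℚ)) U := fun U a _ b _ h => Nat.cast_injective h
  set g := Lagrange.interpolate S0 (fun i : ℕ => (i : ℚ)) z with hg
  have hgdeg : g.degree < (m + 1 : ℕ) := by
    have := Lagrange.degree_interpolate_lt (s := S0) (r := z) (hinj S0)
    rwa [hS0c] at this
  have hgS0 : ∀ i ∈ S0, g.eval (i : ℚ) = z i := fun i hi => Lagrange.eval_interpolate_at_node z (hinj S0) hi
  refine ⟨g, Nat.lt_succ_iff.1 (by
    by_cases h0 : g = 0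
    · simp [h0]
    · exact (Polynomial.natDegree_lt_iff_degree_lt h0).2 hgdeg), ?_⟩
  intro i hi
  by_cases hi0 : i ∈ S0
  · exact hgS0 i hi0
  set U := insert i S0 with hU
  have hUS : U ⊆ S := Finset.insert_subset hi hS0
  have hUc : U.card = m + 2 := by rw [hU, Finset.card_insert_of_notMem hi0, hS0c]
  have h0 := hT0 T hT q hq U (hUS.trans hS) hUc z (fun j hj => hz j (hUS hj)) (fun j hj => hzq j (hUS hj))
  set f := Lagrange.interpolate U (fun i : ℕ => (i : ℚ)) z with hf
  have hfdeg : f.degree < (m + 2 : ℕ) := by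
    have := Lagrange.degree_interpolate_lt (s := U) (r := z) (hinj U)
    rwa [hUc] at this
  have hfU : ∀ i ∈ U, f.eval (i : ℚ) = z i := fun i hi => Lagrange.eval_interpolate_at_node z (hinj U) hi
  have hc := Lagrange.coeff_eq_sum (hinj U) (P := f) (by rw [hUc]; exact hfdeg)
  rw [hUc] at hc
  have hc0 : f.coeff (m + 1) = 0 := by
    rw [show m + 1 = m + 2 - 1 from rfl, hc, ← h0]
    apply Finset.sum_congr rfl
    intro j hj
    simp only [hfU j hj]
  have hfdeg2 : f.degree < (m + 1 : ℕ) := by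
    rw [Polynomial.degree_lt_iff_coeff_zero] at hfdeg ⊢
    intro k hk
    rcases Nat.eq_or_lt_of_le hk with h | h
    · rw [← h]; exact hc0
    · exact hfdeg k h
  have hfg : f = g := by
    rw [hg]
    exact Lagrange.eq_interpolate_of_eval_eq z (hinj S0) (by rw [hS0c]; exact hfdeg2)
      (fun j hj => hfU j (Finset.mem_insert_of_mem hj))
  rw [← hfg]
  exact hfU i (Finset.mem_insert_self _ _)

end S19

namespace S19

lemma natDegree_eval_le (P : Polynomial (Polynomial ℚ)) (m : ℕ) (hm : ∀ i, (P.coeff i).natDegree ≤ m)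
    (g : Polynomial ℚ) (hg : g.natDegree ≤ m) : (P.eval g).natDegree ≤ m + P.natDegree * m := by
  rw [Polynomial.eval_eq_sum_range]
  refine Polynomial.natDegree_sum_le_of_forall_le _ _ fun i hi => ?_
  refine Polynomial.natDegree_mul_le.trans (add_le_add (hm i) ?_)
  refine Polynomial.natDegree_pow_le.trans ?_
  have : i ≤ P.natDegree := Nat.lt_succ_iff.1 (Finset.mem_range.1 hi)
  gcongr

lemma evalEval_shift (P : Polynomial (Polynomial ℚ)) (a x y : ℚ) :
    (P.map (shiftC a)).evalEval (x : ℂ) (y : ℂ) = ((P.evalEval (a + x) y : ℚ) : ℂ) := by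
  induction P using Polynomial.induction_on' with
  | add p q hp hq => simp [Polynomial.evalEval_add, hp, hq]
  | monomial n c =>
    have h := shiftC_eval a c (x : ℂ)
    have h2 := Polynomial.aeval_algebraMap_apply ℂ (a + x) c
    simp [Polynomial.evalEval, h]
    left
    rw [add_comm]
    simpa using h2

theorem WH1 {ι : Type} [Fintype ι] (P : ι → Polynomial (Polynomial ℚ)) (hP : ∀ j, (P j).Monic)
    (m : ℕ) (hm : ∀ j i, ((P j).coeff i).natDegree ≤ m) (R : ℚ → (ι → ℚ) → Prop)
    (h : ∀ᶠ s in Filter.cofinite, ∃ y, R s y ∧ ∀ j, (P j).evalEval s (y j) = 0) :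
    ∃ g : ι → Polynomial ℚ, (∀ j, (g j).natDegree ≤ m) ∧
      ∃ᶠ s in Filter.cofinite, R s (fun j => (g j).eval s) := by
  classical
  obtain ⟨a, ha⟩ := (Filter.eventually_all.2 (fun j => splitsAt_eventually (P j) (hP j))).exists
  choose Q hQ C hC0 hC using fun j => branch (P j) (hP j) m a (ha j)
  -- translated polynomials and denominators
  let P1 : ι → Polynomial (Polynomial ℚ) := fun j => (P j).map (Polynomial.compRingHom (Polynomial.X + Polynomial.C a))
  choose e1 he1 hden using fun j => exists_common_den (P1 j)
  set e := ∏ j, e1 j with he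
  have hepos : 0 < e := Finset.prod_pos fun j _ => he1 j
  set Ct := ∑ j, C j with hCt
  have hCt0 : 0 ≤ Ct := Finset.sum_nonneg fun j _ => hC0 j
  have hCle : ∀ j, C j ≤ Ct := fun j => Finset.single_le_sum (f := C) (fun j _ => hC0 j) (Finset.mem_univ j)
  set K := m + 2 + ∑ j, (m + (P j).natDegree * m) with hK
  have hKj : ∀ j, m + (P j).natDegree * m < K := by
    intro j
    have := Finset.single_le_sum (f := fun j => m + (P j).natDegree * m) (fun j _ => Nat.zero_le _) (Finset.mem_univ j)
    omega
  set col := Fintype.piFinset Q with hcol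
  set B := col.card * K with hB
  obtain ⟨T0, hT0⟩ := poly_on_block m e hepos B Ct hCt0
  -- good values of T
  have hgood : ∃ T1 : ℕ, ∀ T : ℕ, T1 ≤ T → ∃ y, R (a + (T : ℚ)⁻¹) y ∧ ∀ j, (P j).evalEval (a + (T : ℚ)⁻¹) (y j) = 0 := by
    have hinj : Function.Injective (fun T : ℕ => a + (T : ℚ)⁻¹) := by
      intro x y hxy
      have : (x : ℚ)⁻¹ = (y : ℚ)⁻¹ := add_left_cancel hxy
      exact_mod_cast inv_injective this
    have := hinj.tendsto_cofinite.eventually h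
    rw [Nat.cofinite_eq_atTop] at this
    exact Filter.eventually_atTop.1 this
  obtain ⟨T1, hT1⟩ := hgood
  choose! y hyR hyP using hT1
  -- colouring
  have hcolor : ∀ T : ℕ, T1 + 1 ≤ T → ∀ j, ∃ q ∈ Q j, ‖((y T j : ℚ) : ℂ) - q.eval ((T : ℂ)⁻¹)‖ ≤ C j * ‖(T : ℂ)⁻¹‖ ^ (m + 1) := by
    intro T hT j
    apply hC j
    · rw [norm_inv, Complex.norm_natCast]
      apply inv_le_one_of_one_le₀
      exact_mod_cast (by omega : 1 ≤ T)
    · have := evalEval_shift (P j) a ((T : ℚ)⁻¹) (y T j)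
      rw [hyP T (by omega) j] at this
      simpa using this
  choose! q hqQ hq using hcolor
  -- the key step
  have hstep : ∀ T : ℕ, T0 + T1 + 1 ≤ T → ∃ G ∈ Fintype.piFinset (fun j => (P j).roots.toFinset),
      (∀ j, (G j).natDegree ≤ m) ∧ ∃ T' ≥ T, R (a + (T' : ℚ)⁻¹) (fun j => (G j).eval (a + (T' : ℚ)⁻¹)) := by
    intro T hT
    have hmaps : ∀ T' ∈ Finset.Icc T (T + B), q T' ∈ col := by
      intro T' hT'
      rw [hcol, Fintype.mem_piFinset]
      exact fun j => hqQ T' (by have := (Finset.mem_Icc.1 hT').1; omega) j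
    obtain ⟨q0, hq0, hq0c⟩ := Finset.exists_lt_card_fiber_of_mul_lt_card_of_maps_to hmaps
      (n := K) (by rw [Nat.card_Icc, ← hB]; omega)
    set S := (Finset.Icc T (T + B)).filter (fun T' => q T' = q0) with hS
    have hSI : S ⊆ Finset.Icc T (T + B) := Finset.filter_subset _ _
    have hST : ∀ i ∈ S, T ≤ i := fun i hi => (Finset.mem_Icc.1 (hSI hi)).1
    have hSq : ∀ i ∈ S, q i = q0 := fun i hi => (Finset.mem_filter.1 hi).2
    have hg : ∀ j, ∃ g : Polynomial ℚ, g.natDegree ≤ m ∧ ∀ i ∈ S, g.eval (i : ℚ) = (i : ℚ) ^ m * y i j := by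
      intro j
      refine hT0 T (by omega) (Polynomial.reflect m (q0 j)) (Polynomial.natDegree_reflect_le.trans
        (max_le le_rfl (hQ j _ (Fintype.mem_piFinset.1 hq0 j)))) S hSI (by omega) (fun i => (i : ℚ) ^ m * y i j) ?_ ?_
      · intro i hi
        have hi1 := hST i hi
        have hi0 : (i : ℚ) ≠ 0 := by exact_mod_cast (by omega : i ≠ 0)
        have hyi := hyP i (by omega) j
        obtain ⟨z, hz⟩ := integral_root ((P1 j).map (Polynomial.evalRingHom ((i : ℚ)⁻¹))) (((hP j).map _).map _)
          ((e1 j * i ^ m : ℕ) : ℤ) (by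
            intro k
            rw [Polynomial.coeff_map]
            have hkd : ((P1 j).coeff k).natDegree ≤ m := by
              simp only [P1, Polynomial.coeff_map, Polynomial.coe_compRingHom_apply]
              refine Polynomial.natDegree_comp_le.trans ?_
              rw [Polynomial.natDegree_X_add_C, mul_one]
              exact hm j k
            have hr := eval_inv_eq ((P1 j).coeff k) m hkd (i : ℚ) hi0
            choose z hz using hden j k
            refine ⟨∑ l ∈ Finset.range ((Polynomial.reflect m ((P1 j).coeff k)).natDegree + 1), z (Polynomial.revAt m l) * i ^ l, ?_⟩
            simp only [Polynomial.coe_evalRingHom]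
            push_cast
            rw [mul_assoc, hr, Polynomial.eval_eq_sum_range, Finset.mul_sum]
            apply Finset.sum_congr rfl
            intro l _
            rw [Polynomial.coeff_reflect, ← mul_assoc, hz]) (y i j) (by
            rw [← hyi]
            have h1 := Polynomial.hom_eval₂ (P1 j) (RingHom.id _) (Polynomial.evalRingHom ((i : ℚ)⁻¹)) (Polynomial.C (y i j))
            simp only [Polynomial.coe_evalRingHom, RingHomCompTriple.comp_eq, Polynomial.eval_C, Polynomial.eval₂_id] at h1
            rw [Polynomial.eval_map, ← h1]
            have h2 := Polynomial.hom_eval₂ (P j) (RingHom.id _) (Polynomial.compRingHom (Polynomial.X + Polynomial.C a)) (Polynomial.C (y i j))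
            simp only [P1, Polynomial.eval_map]
            simp only [RingHomCompTriple.comp_eq, Polynomial.eval₂_id, Polynomial.coe_compRingHom_apply, Polynomial.C_comp] at h2
            rw [← h2, Polynomial.eval_comp, Polynomial.evalEval]
            simp [add_comm])
        obtain ⟨k, hk⟩ := Finset.dvd_prod_of_mem e1 (Finset.mem_univ j)
        refine ⟨k * z, ?_⟩
        push_cast at hz ⊢
        rw [← hz, he, hk]; push_cast; ring
      · intro i hi
        have hi1 := hST i hi
        have hi0 : (i : ℂ) ≠ 0 := by exact_mod_cast (by omega : i ≠ 0)
        have hipos : (0 : ℝ) < i := by exact_mod_cast (by omega : 0 < i)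
        have hqi := hq i (by omega) j
        rw [hSq i hi] at hqi
        rw [← eval_inv_eq (q0 j) m (hQ j _ (Fintype.mem_piFinset.1 hq0 j)) (i : ℂ) hi0]
        push_cast
        rw [← mul_sub, norm_mul, norm_pow, Complex.norm_natCast]
        calc (i : ℝ) ^ m * ‖((y i j : ℚ) : ℂ) - (q0 j).eval ((i : ℂ)⁻¹)‖ ≤ (i : ℝ) ^ m * (C j * ‖(i : ℂ)⁻¹‖ ^ (m + 1)) := by gcongr
          _ = C j / i := by
            rw [norm_inv, Complex.norm_natCast, inv_pow]; field_simp; ring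
          _ ≤ Ct / i := by gcongr; exact hCle j
    choose g hgd hgS using hg
    let G : ι → Polynomial ℚ := fun j => (Polynomial.reflect m (g j)).comp (Polynomial.X - Polynomial.C a)
    have hGd : ∀ j, (G j).natDegree ≤ m := by
      intro j
      refine Polynomial.natDegree_comp_le.trans ?_
      rw [Polynomial.natDegree_X_sub_C, mul_one]
      exact Polynomial.natDegree_reflect_le.trans (max_le le_rfl (hgd j))
    have hGe : ∀ j, ∀ i ∈ S, (G j).eval (a + (i : ℚ)⁻¹) = y i j := by
      intro j i hi
      have hi1 := hST i hi
      have hi0 : (i : ℚ) ≠ 0 := by exact_mod_cast (by omega : i ≠ 0)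
      simp only [G, Polynomial.eval_comp, Polynomial.eval_sub, Polynomial.eval_X, Polynomial.eval_C, add_sub_cancel_left]
      have := eval_inv_eq (Polynomial.reflect m (g j)) m (Polynomial.natDegree_reflect_le.trans (max_le le_rfl (hgd j))) (i : ℚ) hi0
      rw [Polynomial.reflect_reflect, hgS j i hi] at this
      exact mul_left_cancel₀ (pow_ne_zero m hi0) this
    have hSne : S.Nonempty := Finset.card_pos.1 (by omega)
    refine ⟨G, ?_, hGd, ?_⟩
    · rw [Fintype.mem_piFinset]
      intro j
      rw [Multiset.mem_toFinset, Polynomial.mem_roots (hP j).ne_zero]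
      refine Polynomial.eq_zero_of_natDegree_lt_card_of_eval_eq_zero' _ (S.image (fun i : ℕ => a + (i : ℚ)⁻¹)) ?_ ?_
      · intro x hx
        obtain ⟨i, hi, rfl⟩ := Finset.mem_image.1 hx
        have h1 := hyP i (by have := hST i hi; omega) j
        rw [← hGe j i hi] at h1
        rw [← h1, Polynomial.evalEval]
        have e1 := Polynomial.hom_eval₂ (P j) (RingHom.id _) (Polynomial.evalRingHom (a + (i : ℚ)⁻¹)) (G j)
        have e2 := Polynomial.hom_eval₂ (P j) (RingHom.id _) (Polynomial.evalRingHom (a + (i : ℚ)⁻¹)) (Polynomial.C ((G j).eval (a + (i : ℚ)⁻¹)))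
        simp only [Polynomial.coe_evalRingHom, RingHomCompTriple.comp_eq, Polynomial.eval_C, Polynomial.eval₂_id] at e1 e2
        rw [e1, e2]
      · rw [Finset.card_image_of_injective]
        · exact lt_of_le_of_lt (natDegree_eval_le (P j) m (hm j) (G j) (hGd j)) ((hKj j).trans hq0c)
        · intro x y hxy
          have : (x : ℚ)⁻¹ = (y : ℚ)⁻¹ := add_left_cancel hxy
          exact_mod_cast inv_injective this
    · obtain ⟨i, hi⟩ := hSne
      refine ⟨i, hST i hi, ?_⟩
      have := hyR i (by have := hST i hi; omega)
      convert this using 1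
      funext j
      exact hGe j i hi
  -- pigeonhole over the finitely many root tuples
  by_contra hcon
  push Not at hcon
  have hfin : ∀ G : ι → Polynomial ℚ, (∀ j, (G j).natDegree ≤ m) → ∃ N : ℕ, ∀ T : ℕ, N ≤ T → ¬ R (a + (T : ℚ)⁻¹) (fun j => (G j).eval (a + (T : ℚ)⁻¹)) := by
    intro G hG
    have h1 := hcon G hG
    have hinj : Function.Injective (fun T : ℕ => a + (T : ℚ)⁻¹) := by
      intro x y hxy
      have : (x : ℚ)⁻¹ = (y : ℚ)⁻¹ := add_left_cancel hxy
      exact_mod_cast inv_injective this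
    have := hinj.tendsto_cofinite.eventually h1
    rw [Nat.cofinite_eq_atTop] at this
    exact Filter.eventually_atTop.1 this
  choose! N hN using hfin
  set T := T0 + T1 + 1 + ∑ G ∈ Fintype.piFinset (fun j => (P j).roots.toFinset), N G with hT
  obtain ⟨G, hG, hGd, T', hT', hR⟩ := hstep T (by omega)
  refine hN G hGd T' ?_ hR
  have := Finset.single_le_sum (f := N) (fun j _ => Nat.zero_le _) hG
  omega

lemma exists_degree_bound {ι : Type} [Fintype ι] {A : Type*} [CommRing A] (P : ι → Polynomial (Polynomial A)) :
    ∃ m, ∀ j i, ((P j).coeff i).natDegree ≤ m := by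
  classical
  refine ⟨∑ j, ∑ i ∈ (P j).support, ((P j).coeff i).natDegree, fun j i => ?_⟩
  by_cases hi : i ∈ (P j).support
  · refine le_trans ?_ (Finset.single_le_sum (f := fun j => ∑ i ∈ (P j).support, ((P j).coeff i).natDegree) (fun _ _ => Nat.zero_le _) (Finset.mem_univ j))
    exact Finset.single_le_sum (f := fun i => ((P j).coeff i).natDegree) (fun _ _ => Nat.zero_le _) hi
  · rw [Polynomial.notMem_support_iff.1 hi]; simp

lemma evalEval_eq_map_eval {A : Type*} [CommRing A] (P : Polynomial (Polynomial A)) (x y : A) :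
    P.evalEval x y = (P.map (Polynomial.evalRingHom x)).eval y := by
  rw [Polynomial.map_evalRingHom_eval]

lemma eval_evalEval {A : Type*} [CommRing A] (P : Polynomial (Polynomial A)) (x : A) (g : Polynomial A) :
    P.evalEval x (g.eval x) = (P.eval g).eval x := by
  rw [evalEval_eq_map_eval, Polynomial.eval_map]
  have := Polynomial.hom_eval₂ P (RingHom.id _) (Polynomial.evalRingHom x) g
  simp only [Polynomial.coe_evalRingHom, RingHomCompTriple.comp_eq, Polynomial.eval₂_id] at this
  exact this.symm

theorem WH2 {ι : Type} [Fintype ι] (P : ι → Polynomial (Polynomial (Polynomial ℚ))) (hP : ∀ j, (P j).Monic)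
    (R : ℚ → ℚ → (ι → ℚ) → Prop)
    (h : ∀ᶠ s in Filter.cofinite, ∀ᶠ t in Filter.cofinite, ∃ y, R s t y ∧
      ∀ j, ((P j).map (Polynomial.evalEvalRingHom s t)).eval (y j) = 0) :
    ∃ g : ι → Polynomial (Polynomial ℚ),
      ∃ᶠ s in Filter.cofinite, ∃ᶠ t in Filter.cofinite, R s t (fun j => (g j).evalEval s t) := by
  classical
  obtain ⟨m1, hm1⟩ := exists_degree_bound P
  let Ps : ℚ → ι → Polynomial (Polynomial ℚ) := fun s j => (P j).map (Polynomial.mapRingHom (Polynomial.evalRingHom s))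
  let P' : ι × Fin (m1 + 1) → Polynomial (Polynomial ℚ) := fun x => (P x.1).map (Polynomial.evalRingHom (Polynomial.C ((x.2 : ℕ) : ℚ)))
  have hPs : ∀ s j t y, (Ps s j).evalEval t y = ((P j).map (Polynomial.evalEvalRingHom s t)).eval y := by
    intro s j t y
    rw [evalEval_eq_map_eval, Polynomial.map_map]
    congr 2
    ext x <;> simp
  have hP' : ∀ s j i y, (P' (j, i)).evalEval s y = ((P j).map (Polynomial.evalEvalRingHom s ((i : ℕ) : ℚ))).eval y := by
    intro s j i y
    rw [evalEval_eq_map_eval, Polynomial.map_map]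
  obtain ⟨m2, hm2⟩ := exists_degree_bound P'
  let nd : Fin (m1 + 1) → ℚ := fun i => ((i : ℕ) : ℚ)
  have hnd : Set.InjOn nd (Finset.univ : Finset (Fin (m1 + 1))) := by
    intro x _ y _ hxy
    exact Fin.ext (Nat.cast_injective hxy)
  obtain ⟨γ, -, hγ⟩ := WH1 P' (fun x => (hP x.1).map _) m2 hm2
    (fun s v => ∃ᶠ t in Filter.cofinite, R s t (fun j => (Lagrange.interpolate Finset.univ nd (fun i => v (j, i))).eval t)) (by
      filter_upwards [h] with s hs
      obtain ⟨g, hgd, hg⟩ := WH1 (Ps s) (fun j => (hP j).map _) m1 (by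
          intro j i
          simp only [Ps, Polynomial.coeff_map, Polynomial.coe_mapRingHom]
          exact Polynomial.natDegree_map_le.trans (hm1 j i))
        (fun t y => R s t y ∧ ∀ j, (Ps s j).evalEval t (y j) = 0) (by
          filter_upwards [hs] with t ht
          obtain ⟨y, hy1, hy2⟩ := ht
          have : ∀ j, (Ps s j).evalEval t (y j) = 0 := fun j => by rw [hPs]; exact hy2 j
          exact ⟨y, ⟨hy1, this⟩, this⟩)
      have hzero : ∀ j, (Ps s j).eval (g j) = 0 := by
        intro j
        refine Polynomial.eq_zero_of_infinite_isRoot _ ?_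
        refine Set.Infinite.mono ?_ (Filter.frequently_cofinite_iff_infinite.1 hg)
        intro t ht
        have := ht.2 j
        rwa [eval_evalEval] at this
      refine ⟨fun x => (g x.1).eval (nd x.2), ?_, ?_⟩
      · refine hg.mono ?_
        intro t ht
        have : ∀ j, Lagrange.interpolate Finset.univ nd (fun i => (g j).eval (nd i)) = g j := by
          intro j
          symm
          refine Lagrange.eq_interpolate hnd ?_
          simp only [Finset.card_univ, Fintype.card_fin]
          refine lt_of_le_of_lt Polynomial.degree_le_natDegree ?_
          exact_mod_cast Nat.lt_succ_iff.2 (hgd j)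
        simp only [this]
        exact ht.1
      · rintro ⟨j, i⟩
        rw [hP', ← hPs]
        simp only [nd]
        rw [eval_evalEval, hzero]; simp)
  refine ⟨fun j => ∑ i, Polynomial.C (γ (j, i)) * (Lagrange.basis Finset.univ nd i).map Polynomial.C, ?_⟩
  refine hγ.mono fun s hs => hs.mono fun t ht => ?_
  convert ht using 1
  funext j
  rw [Lagrange.interpolate_apply, ← Polynomial.coe_evalEvalRingHom, map_sum, Polynomial.eval_finsetSum]
  apply Finset.sum_congr rfl
  intro i _
  simp

end S19

namespace S19

/-- a valuation ring containing the constants -/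
def Over (k : Type) {K : Type} [Field k] [Field K] [Algebra k K] (V : ValuationSubring K) : Prop :=
  ∀ c : k, algebraMap k K c ∈ V

/-- `r` is congruent to `c` modulo the maximal ideal of `V`. -/
def Cong {k K : Type} [Field k] [Field K] [Algebra k K] (V : ValuationSubring K) (r : K) (c : k) :
    Prop := V.valuation (r - algebraMap k K c) < 1

section
variable {k K : Type} [Field k] [Field K] [Algebra k K] {V : ValuationSubring K}

theorem vml {a b : V.ValueGroup} (ha : a ≤ 1) (hb : b < 1) : a * b < 1 :=
  (mul_le_mul' ha le_rfl).trans_lt (by rwa [one_mul])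

theorem Over.le_one (hV : Over k V) (c : k) : V.valuation (algebraMap k K c) ≤ 1 :=
  (V.valuation_le_one_iff _).2 (hV c)

theorem Over.eq_one (hV : Over k V) {c : k} (hc : c ≠ 0) : V.valuation (algebraMap k K c) = 1 := by
  have h1 := hV.le_one c
  have h2 := hV.le_one c⁻¹
  have h3 : V.valuation (algebraMap k K c) * V.valuation (algebraMap k K c⁻¹) = 1 := by
    rw [← map_mul, ← map_mul, mul_inv_cancel₀ hc]; simp
  refine le_antisymm h1 ?_
  by_contra h
  push Not at h
  have := vml h2 h
  rw [mul_comm, h3] at this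
  exact lt_irrefl _ this

theorem Cong.le_one (hV : Over k V) {r : K} {c : k} (h : Cong V r c) : V.valuation r ≤ 1 := by
  have : r = (r - algebraMap k K c) + algebraMap k K c := by ring
  rw [this]
  exact (V.valuation.map_add _ _).trans (max_le h.le (hV.le_one c))

theorem Cong.add {r r' : K} {c c' : k} (h : Cong V r c) (h' : Cong V r' c') :
    Cong V (r + r') (c + c') := by
  unfold Cong at *
  have : r + r' - algebraMap k K (c + c') = (r - algebraMap k K c) + (r' - algebraMap k K c') := by
    rw [map_add]; ring
  rw [this]
  exact V.valuation.map_add_lt h h'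

theorem Cong.mul (hV : Over k V) {r r' : K} {c c' : k} (h : Cong V r c) (h' : Cong V r' c') :
    Cong V (r * r') (c * c') := by
  have h2 := h.le_one hV
  unfold Cong at *
  have : r * r' - algebraMap k K (c * c') = r * (r' - algebraMap k K c') +
     algebraMap k K c' * (r - algebraMap k K c) := by
    rw [map_mul]; ring
  rw [this]
  apply V.valuation.map_add_lt
  · rw [map_mul]; exact vml h2 h'
  · rw [map_mul]; exact vml (hV.le_one c') h

theorem Cong.const (c : k) : Cong V (algebraMap k K c) c := by
  unfold Cong; simp

theorem cong_zero {r : K} : Cong V r (0 : k) ↔ V.valuation r < 1 := by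
  unfold Cong; simp

theorem Cong.neg {r : K} {c : k} (h : Cong V r c) : Cong V (-r) (-c) := by
  unfold Cong at *
  rw [map_neg, ← neg_sub', V.valuation.map_neg]
  exact h

theorem Cong.sub {r r' : K} {c c' : k} (h : Cong V r c) (h' : Cong V r' c') :
    Cong V (r - r') (c - c') := by
  rw [sub_eq_add_neg, sub_eq_add_neg]; exact h.add h'.neg

theorem Cong.val_eq_one (hV : Over k V) {r : K} {c : k} (h : Cong V r c) (hc : c ≠ 0) :
    V.valuation r = 1 := by
  have h1 := hV.eq_one hc
  have : r = (r - algebraMap k K c) + algebraMap k K c := by ring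
  rw [this, V.valuation.map_add_eq_of_lt_right, h1]
  rw [h1]; exact h

theorem Cong.unique (hV : Over k V) {r : K} {c c' : k} (h : Cong V r c) (h' : Cong V r c') :
    c = c' := by
  by_contra hne
  have h2 := h.sub h'
  have := h2.val_eq_one hV (sub_ne_zero.2 hne)
  simp at this

theorem Cong.aeval (hV : Over k V) {σ : Type} {w : σ → K} {c : σ → k} (h : ∀ i, Cong V (w i) (c i))
    (F : MvPolynomial σ k) : Cong V (aeval w F) (eval c F) := by
  induction F using MvPolynomial.induction_on with
  | C a => simpa using Cong.const a
  | add p q hp hq => simpa using hp.add hq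
  | mul_X p i hp => simpa using hp.mul hV (h i)

theorem Cong.paeval (hV : Over k V) {w : K} {c : k} (h : Cong V w c)
    (F : Polynomial k) : Cong V (Polynomial.aeval w F) (F.eval c) := by
  induction F using Polynomial.induction_on' with
  | add p q hp hq => simpa using hp.add hq
  | monomial n a =>
    rw [Polynomial.aeval_monomial, Polynomial.eval_monomial]
    refine (Cong.const a).mul hV ?_
    induction n with
    | zero => simpa using Cong.const (V := V) (1 : k)
    | succ n ih => rw [pow_succ, pow_succ]; exact ih.mul hV h

/-- centre: relations specialize -/
theorem Cong.rel (hV : Over k V) {σ : Type} {w : σ → K} {c : σ → k} (h : ∀ i, Cong V (w i) (c i))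
    {F : MvPolynomial σ k} (hF : MvPolynomial.aeval w F = 0) : eval c F = 0 := by
  have := Cong.aeval hV h F
  rw [hF] at this
  exact this.unique hV (by simpa using Cong.const (V := V) (0 : k))

theorem exists_V {σ : Type} (w : σ → K) (c : σ → k)
    (h : ∀ F : MvPolynomial σ k, MvPolynomial.aeval w F = 0 → eval c F = 0) :
    ∃ V : ValuationSubring K, Over k V ∧ ∀ i, Cong V (w i) (c i) := by
  let φ : MvPolynomial σ k →+* K := (MvPolynomial.aeval w : MvPolynomial σ k →ₐ[k] K).toRingHom
  let I : Ideal φ.range := (RingHom.ker (eval c)).map φ.rangeRestrict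
  have hI : I ≠ ⊤ := by
    rw [Ne, Ideal.eq_top_iff_one]
    intro h1
    rw [Ideal.mem_map_iff_of_surjective _ φ.rangeRestrict_surjective] at h1
    obtain ⟨F, hF, hF1⟩ := h1
    have h2 : φ F = 1 := congrArg Subtype.val hF1
    have := h (F - 1) (by rw [map_sub, map_one, sub_eq_zero]; exact h2)
    rw [map_sub, RingHom.mem_ker.1 hF] at this
    simp at this
  obtain ⟨V, hV, hV2⟩ := Ideal.image_subset_nonunits_valuationSubring I hI
  refine ⟨V, fun c => hV ⟨C c, by simp [φ]⟩, fun i => ?_⟩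
  have : (w i - algebraMap k K (c i)) ∈ V.nonunits := by
    apply hV2
    refine ⟨φ.rangeRestrict (X i - C (c i)), Ideal.mem_map_of_mem _ (by simp [RingHom.mem_ker]), ?_⟩
    change aeval w (X i - C (c i)) = _
    simp
  exact (ValuationSubring.mem_nonunits_iff V).1 this

end

section
variable {k K : Type} [Field k] [IsAlgClosed k] [Field K] [Algebra k K] {V : ValuationSubring K}

/-- elements outside `k` are transcendental -/
theorem transc {r : K} (h : ∀ c : k, r ≠ algebraMap k K c) : Transcendental k r := by
  intro ha
  obtain ⟨f, hf, hr⟩ := ha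
  have h1 := (IsAlgClosed.splits f).eq_prod_roots
  rw [h1, map_mul, Polynomial.aeval_C, map_multiset_prod, Multiset.map_map] at hr
  rcases mul_eq_zero.1 hr with h2 | h2
  · exact hf (by simpa using h2)
  · rw [Multiset.prod_eq_zero_iff, Multiset.mem_map] at h2
    obtain ⟨c, -, hc⟩ := h2
    exact h c (by simpa [sub_eq_zero] using hc)

theorem exists_pole {r : K} (h : ∀ c : k, r ≠ algebraMap k K c) :
    ∃ V : ValuationSubring K, Over k V ∧ V.valuation r⁻¹ < 1 := by
  have ht : Transcendental k r⁻¹ := by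
    intro ha; exact transc h (by simpa using ha.inv)
  obtain ⟨V, hV, h2⟩ := exists_V (k := k) (fun _ : Unit => r⁻¹) (fun _ => 0) (by
    intro F hF
    have : F = 0 := by
      have hai : AlgebraicIndependent k (fun _ : Unit => r⁻¹) := by
        rw [algebraicIndependent_unique_type_iff]; exact ht
      exact hai (by simpa using hF)
    simp [this])
  exact ⟨V, hV, cong_zero.1 (h2 ())⟩

theorem F1 {r : K} (h : ∀ V : ValuationSubring K, Over k V → V.valuation r ≤ 1) :
    ∃ c : k, r = algebraMap k K c := by
  by_contra hc
  push Not at hc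
  obtain ⟨V, hV, h2⟩ := exists_pole hc
  have h3 := h V hV
  have hr : r ≠ 0 := by intro h0; exact hc 0 (by simpa using h0)
  have : V.valuation r * V.valuation r⁻¹ = 1 := by rw [← map_mul, mul_inv_cancel₀ hr]; simp
  have h4 := vml h3 h2
  rw [this] at h4; exact lt_irrefl _ h4

/-- a root in the residue field is a constant -/
theorem root_cong (f : Polynomial k) (hf : f ≠ 0) (hV : Over k V) {r : K}
    (h : V.valuation (Polynomial.aeval r f) < 1) : ∃ c, f.IsRoot c ∧ Cong V r c := by
  have hs := IsAlgClosed.splits f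
  have h1 := hs.eq_prod_roots
  rw [h1, map_mul, map_mul, Polynomial.aeval_C, hV.eq_one (by simpa using hf), one_mul,
    map_multiset_prod, map_multiset_prod, Multiset.map_map, Multiset.map_map] at h
  by_contra hcon
  push Not at hcon
  have key : ∀ s : Multiset k, (∀ c ∈ s, c ∈ f.roots) → 1 ≤ (Multiset.map ((fun x => V.valuation x) ∘ (fun x => Polynomial.aeval r x) ∘ fun a => Polynomial.X - Polynomial.C a) s).prod := by
    intro s
    induction s using Multiset.induction_on with
    | empty => simp
    | cons a s ih =>
      intro hs
      rw [Multiset.map_cons, Multiset.prod_cons]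
      apply one_le_mul
      · have := hcon a ((Polynomial.mem_roots hf).1 (hs a (by simp)))
        unfold Cong at this
        simpa using this
      · exact ih fun c hc => hs c (by simp [hc])
  have := key f.roots (fun _ h => h)
  exact absurd h (not_lt.2 this)


/-- evaluation of a bivariate polynomial -/
def ev2 (w r : K) (F : Polynomial (Polynomial k)) : K :=
  Polynomial.eval₂ ((Polynomial.aeval w : Polynomial k →ₐ[k] K) : Polynomial k →+* K) r F

/-- any two elements are algebraically dependent -/
def TD1 (k K : Type) [Field k] [Field K] [Algebra k K] : Prop :=
  ∀ w r : K, ∃ F : Polynomial (Polynomial k), F ≠ 0 ∧ ev2 w r F = 0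

theorem ev2_strip {w r : K} (hw : w ≠ 0) {F : Polynomial (Polynomial k)} (hF : F ≠ 0)
    (h : ev2 w r F = 0) : ∃ F' : Polynomial (Polynomial k), ev2 w r F' = 0 ∧
      F'.map (Polynomial.evalRingHom 0) ≠ 0 := by
  have hfin : FiniteMultiplicity (Polynomial.C (Polynomial.X : Polynomial k)) F := by
    apply FiniteMultiplicity.of_not_isUnit _ hF
    rw [Polynomial.isUnit_C]
    exact Polynomial.not_isUnit_X
  obtain ⟨F', h1, h2⟩ := hfin.exists_eq_pow_mul_and_not_dvd
  refine ⟨F', ?_, ?_⟩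
  · unfold ev2 at *
    rw [h1, Polynomial.eval₂_mul, Polynomial.eval₂_pow, Polynomial.eval₂_C] at h
    simpa [hw] using h
  · intro h3
    apply h2
    rw [Polynomial.C_dvd_iff_dvd_coeff]
    intro i
    have := congrArg (fun p => p.coeff i) h3
    simp only [Polynomial.coeff_map, Polynomial.coe_evalRingHom, Polynomial.coeff_zero] at this
    rw [Polynomial.X_dvd_iff, Polynomial.coeff_zero_eq_eval_zero, this]

theorem ev2_red (hV : Over k V) {w r : K} {c : k} (hw : Cong V w c) (hr : V.valuation r ≤ 1)
    (F : Polynomial (Polynomial k)) :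
    V.valuation (ev2 w r F - Polynomial.aeval r (F.map (Polynomial.evalRingHom c))) < 1 := by
  induction F using Polynomial.induction_on' with
  | add p q hp hq =>
    have : ev2 w r (p + q) = ev2 w r p + ev2 w r q := by simp [ev2]
    rw [this, Polynomial.map_add, map_add, add_sub_add_comm]
    exact V.valuation.map_add_lt hp hq
  | monomial n a =>
    have h1 := Cong.paeval hV hw a
    unfold Cong at h1
    have : ev2 w r (Polynomial.monomial n a) - Polynomial.aeval r ((Polynomial.monomial n a).map (Polynomial.evalRingHom c)) = r ^ n * (Polynomial.aeval w a - algebraMap k K (Polynomial.eval c a)) := by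
      simp [ev2]; ring
    rw [this, map_mul, map_pow]
    exact vml (pow_le_one' hr n) h1

theorem resFin (hT : TD1 k K) {w : K} (hw : w ≠ 0) (r : K) : ∃ f : Polynomial k, f ≠ 0 ∧
    ∀ V : ValuationSubring K, Over k V → V.valuation w < 1 → V.valuation r ≤ 1 →
      ∃ c, f.IsRoot c ∧ Cong V r c := by
  obtain ⟨F, hF, h⟩ := hT w r
  obtain ⟨F', h1, h2⟩ := ev2_strip hw hF h
  refine ⟨_, h2, fun V hV hVw hVr => root_cong _ h2 hV ?_⟩
  have := ev2_red hV (cong_zero.2 hVw) hVr F'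
  rwa [h1, zero_sub, V.valuation.map_neg] at this

theorem inv_lt {w : K} (h : ¬ V.valuation w ≤ 1) : w ≠ 0 ∧ V.valuation w⁻¹ < 1 := by
  have hw : w ≠ 0 := by rintro rfl; simp at h
  refine ⟨hw, ?_⟩
  push Not at h
  rw [map_inv₀]
  exact inv_lt_one_of_one_lt₀ h

theorem res (hT : TD1 k K) (hV : Over k V) {w : K} (hw : ¬ V.valuation w ≤ 1) {r : K} (hr : V.valuation r ≤ 1) :
    ∃ c : k, Cong V r c := by
  obtain ⟨hw0, h1⟩ := inv_lt hw
  obtain ⟨f, -, hf⟩ := resFin (k := k) hT (inv_ne_zero hw0) r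
  obtain ⟨c, -, hc⟩ := hf V hV h1 hr
  exact ⟨c, hc⟩

theorem finRed (hT : TD1 k K) {w : K} (hw : w ≠ 0) {ι : Type} [Finite ι] (g : ι → K) (hg : g ≠ 0) :
    ∃ Φ : Set (ι → k), Φ.Finite ∧ (∀ φ ∈ Φ, φ ≠ 0) ∧ ∀ V : ValuationSubring K, Over k V →
      V.valuation w < 1 → ∃ φ ∈ Φ, ∃ a : K, a ≠ 0 ∧ ∀ i, Cong V (a * g i) (φ i) := by
  classical
  choose f hf hf2 using fun r => resFin hT hw r
  refine ⟨{φ | φ ≠ 0 ∧ ∃ j, ∀ i, (f ((g j)⁻¹ * g i)).IsRoot (φ i)}, ?_, fun φ h => h.1, ?_⟩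
  · refine Set.Finite.subset (s := ⋃ j, Set.pi Set.univ (fun i => {c | (f ((g j)⁻¹ * g i)).IsRoot c})) ?_ ?_
    · refine Set.finite_iUnion fun j => Set.Finite.pi fun i => ?_
      exact Polynomial.finite_setOf_isRoot (hf _)
    · rintro φ ⟨-, j, hj⟩
      simp only [Set.mem_iUnion]
      exact ⟨j, fun i _ => hj i⟩
  · intro V hV hVw
    have hne : Nonempty ι := by
      by_contra h
      rw [not_nonempty_iff] at h
      exact hg (Subsingleton.elim _ _)
    obtain ⟨j, hj⟩ := Finite.exists_max (fun i => V.valuation (g i))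
    have hgj : g j ≠ 0 := by
      intro h0
      apply hg
      funext i
      have := hj i
      simpa [h0] using this
    have hle : ∀ i, V.valuation ((g j)⁻¹ * g i) ≤ 1 := by
      intro i
      rw [map_mul, map_inv₀]
      exact (mul_le_mul' le_rfl (hj i)).trans_eq (inv_mul_cancel₀ (by simpa using hgj))
    choose φ h1 h2 using fun i => hf2 ((g j)⁻¹ * g i) V hV hVw (hle i)
    refine ⟨φ, ⟨?_, j, h1⟩, (g j)⁻¹, inv_ne_zero hgj, h2⟩
    intro h0
    have h3 := h2 j
    rw [inv_mul_cancel₀ hgj, h0] at h3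
    have := Cong.unique hV h3 (c' := (1 : k)) (by simpa using Cong.const (V := V) (1 : k))
    simp at this

/-- a function with a single simple pole generates the function field -/
theorem SP (hT : TD1 k K) {V0 : ValuationSubring K} (hV0 : Over k V0) {h : K}
    (h0 : ¬ V0.valuation h ≤ 1) (hV : ∀ V : ValuationSubring K, Over k V → V ≠ V0 → V.valuation h ≤ 1)
    (hm : ∀ r : K, V0.valuation r < 1 → V0.valuation (r * h) ≤ 1) (y : K) :
    ∃ p q : Polynomial k, Polynomial.aeval h q ≠ 0 ∧ y = Polynomial.aeval h p / Polynomial.aeval h q := by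
  obtain ⟨hne, hinv⟩ := inv_lt h0
  -- main induction
  have key : ∀ n : ℕ, ∀ r : K, (∀ V : ValuationSubring K, Over k V → V ≠ V0 → V.valuation r ≤ 1) →
      V0.valuation (r * (h⁻¹) ^ n) ≤ 1 → ∃ p : Polynomial k, r = Polynomial.aeval h p := by
    intro n
    induction n with
    | zero =>
      intro r hr hr0
      obtain ⟨c, hc⟩ := F1 (k := k) (r := r) (fun V hVV => by
        by_cases hq : V = V0
        · subst hq; simpa using hr0
        · exact hr V hVV hq)
      exact ⟨Polynomial.C c, by simpa using hc⟩
    | succ n ih =>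
      intro r hr hr0
      obtain ⟨c, hc⟩ := res hT hV0 h0 hr0
      obtain ⟨p, hp⟩ := ih (r - algebraMap k K c * h ^ (n + 1)) (by
        intro V hVV hq
        refine (V.valuation.map_sub _ _).trans (max_le (hr V hVV hq) ?_)
        rw [map_mul, map_pow]
        exact mul_le_one' (hVV.le_one c) (pow_le_one' (hV V hVV hq) _)) (by
        have := hm _ hc
        convert this using 2
        rw [inv_pow, inv_pow, pow_succ]
        field_simp)
      refine ⟨p + Polynomial.C c * Polynomial.X ^ (n + 1), ?_⟩
      simp only [map_add, map_mul, Polynomial.aeval_C, map_pow, Polynomial.aeval_X, ← hp]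
      ring
  -- integral elements
  have key2 : ∀ r : K, (∃ F : Polynomial (Polynomial k), F.Monic ∧ ev2 h r F = 0) →
      ∃ p : Polynomial k, r = Polynomial.aeval h p := by
    rintro r ⟨F, hF, hFr⟩
    have hexp : r ^ F.natDegree = - ∑ i ∈ Finset.range F.natDegree, Polynomial.aeval h (F.coeff i) * r ^ i := by
      unfold ev2 at hFr
      rw [Polynomial.eval₂_eq_sum_range, Finset.sum_range_succ, hF.coeff_natDegree, map_one, one_mul] at hFr
      rw [eq_neg_iff_add_eq_zero, add_comm]
      exact hFr
    have hd : F.natDegree ≠ 0 := by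
      intro h0
      rw [h0] at hexp
      simp at hexp
    have bound : ∀ (V : ValuationSubring K), Over k V → ∀ (B : V.ValueGroup), 1 ≤ B →
        (∀ i, V.valuation (Polynomial.aeval h (F.coeff i)) ≤ B) → V.valuation r ≤ B := by
      intro V hVV B hB hco
      by_contra hcon
      push Not at hcon
      have h1r : 1 ≤ V.valuation r := hB.trans hcon.le
      have : V.valuation (r ^ F.natDegree) < V.valuation r ^ F.natDegree := by
        nth_rewrite 1 [hexp]
        rw [V.valuation.map_neg]
        apply V.valuation.map_sum_lt
        · exact pow_ne_zero _ (by intro h; rw [h] at h1r; simp at h1r)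
        · intro i hi
          have hi' : i + 1 ≤ F.natDegree := Finset.mem_range.1 hi
          rw [map_mul, map_pow]
          calc _ ≤ B * V.valuation r ^ i := mul_le_mul' (hco i) le_rfl
            _ < V.valuation r * V.valuation r ^ i := by
              apply mul_lt_mul_of_pos_right hcon
              exact pow_pos (lt_of_lt_of_le zero_lt_one h1r) _
            _ = V.valuation r ^ (i + 1) := by rw [pow_succ, mul_comm]
            _ ≤ _ := pow_le_pow_right₀ h1r hi'
      rw [map_pow] at this
      exact lt_irrefl _ this
    have haev : ∀ (V : ValuationSubring K), Over k V → ∀ (B : V.ValueGroup), 1 ≤ B → V.valuation h ≤ B →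
        ∀ p : Polynomial k, ∀ N, p.natDegree ≤ N → V.valuation (Polynomial.aeval h p) ≤ B ^ N := by
      intro V hVV B hB hhB p N hN
      rw [Polynomial.aeval_eq_sum_range]
      apply V.valuation.map_sum_le
      intro i hi
      rw [Algebra.smul_def, map_mul, map_pow]
      calc _ ≤ 1 * B ^ i := mul_le_mul' (hVV.le_one _) (pow_le_pow_left' hhB i)
        _ = B ^ i := one_mul _
        _ ≤ _ := pow_le_pow_right₀ hB ((Nat.lt_succ_iff.1 (Finset.mem_range.1 hi)).trans hN)
    obtain ⟨N, hN⟩ := exists_degree_bound (fun _ : Unit => F)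
    apply key N r
    · intro V hVV hq
      apply bound V hVV 1 le_rfl
      intro i
      have := haev V hVV 1 le_rfl (hV V hVV hq) (F.coeff i) N (hN () i)
      simpa using this
    · have h1 : 1 ≤ V0.valuation h := le_of_not_ge h0
      have := bound V0 hV0 (V0.valuation h ^ N) (one_le_pow₀ h1) (fun i =>
        haev V0 hV0 _ h1 le_rfl _ _ (hN () i))
      rw [map_mul, map_pow, map_inv₀, inv_pow]
      refine (mul_le_mul' this le_rfl).trans_eq (mul_inv_cancel₀ ?_)
      exact pow_ne_zero _ (by simpa using hne)
  obtain ⟨F, hF, hFy⟩ := hT h y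
  have htr : Transcendental k h := transc (by
    intro c hc; rw [hc] at h0; exact h0 (hV0.le_one c))
  have hlc : Polynomial.aeval h F.leadingCoeff ≠ 0 := by
    intro h3
    exact (Polynomial.leadingCoeff_ne_zero.2 hF) ((transcendental_iff.1 htr) _ h3)
  have h4 := Polynomial.integralNormalization_eval₂_eq_zero
    ((Polynomial.aeval h : Polynomial k →ₐ[k] K) : Polynomial k →+* K) (z := y) (p := F) hFy
    (fun x hx => (transcendental_iff.1 htr) _ hx)
  obtain ⟨p, hp⟩ := key2 _ ⟨_, Polynomial.monic_integralNormalization hF, h4⟩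
  refine ⟨p, F.leadingCoeff, hlc, ?_⟩
  rw [← hp]
  exact (mul_div_cancel_left₀ _ hlc).symm

/-- Nullstellensatz -/
theorem NS {σ : Type} [Finite σ] (v : σ → K) (θ : MvPolynomial σ k) (hθ : aeval v θ ≠ 0) :
    ∃ c : σ → k, (∀ F, aeval v F = 0 → eval c F = 0) ∧ eval c θ ≠ 0 := by
  by_contra hcon
  push Not at hcon
  let I := RingHom.ker (aeval v : MvPolynomial σ k →ₐ[k] K)
  have hI : I.IsPrime := RingHom.ker_isPrime _
  have h1 := MvPolynomial.vanishingIdeal_zeroLocus_eq_radical (K := k) I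
  rw [hI.radical] at h1
  have h2 : θ ∈ I := by
    rw [← h1]
    rw [mem_vanishingIdeal_iff]
    intro c hc
    rw [mem_zeroLocus_iff] at hc
    exact hcon c (fun F hF => hc F hF)
  exact hθ h2

/-- specialization of algebraic elements over a generic point -/
theorem LIFT {ι σ : Type} [Finite σ] (w : ι → K) (hw : AlgebraicIndependent k w) (v : σ → K)
    (hv : ∀ i, ∃ F : Polynomial (MvPolynomial ι k), F ≠ 0 ∧
      Polynomial.eval₂ ((aeval w : MvPolynomial ι k →ₐ[k] K) : MvPolynomial ι k →+* K) (v i) F = 0) :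
    ∃ N : MvPolynomial ι k, N ≠ 0 ∧ ∀ u : ι → k, eval u N ≠ 0 → ∃ c : σ → k,
      ∀ F : MvPolynomial (σ ⊕ ι) k, aeval (Sum.elim v w) F = 0 → eval (Sum.elim c u) F = 0 := by
  have := Fintype.ofFinite σ
  choose P hP hPv using hv
  refine ⟨∏ i, (P i).leadingCoeff, Finset.prod_ne_zero_iff.2 fun i _ =>
    Polynomial.leadingCoeff_ne_zero.2 (hP i), fun u hu => ?_⟩
  rw [map_prod, Finset.prod_ne_zero_iff] at hu
  obtain ⟨V, hV, hc⟩ := exists_V w u (fun F hF => by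
    rw [hw (by simpa using hF : aeval w F = aeval w 0)]; simp)
  have hval : ∀ i, V.valuation (v i) ≤ 1 := by
    intro i
    by_contra hcon
    push Not at hcon
    have h1 := hPv i
    rw [Polynomial.eval₂_eq_sum_range, Finset.sum_range_succ, add_comm, add_eq_zero_iff_eq_neg] at h1
    have h2 : V.valuation (aeval w (P i).leadingCoeff) = 1 :=
      (Cong.aeval hV hc _).val_eq_one hV (hu i (Finset.mem_univ _))
    have h3 := congrArg V.valuation h1
    rw [map_mul, V.valuation.map_neg, map_pow] at h3
    have h4 : V.valuation (aeval w ((P i).coeff (P i).natDegree)) = 1 := h2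
    rw [show V.valuation (((aeval w : MvPolynomial ι k →ₐ[k] K) : MvPolynomial ι k →+* K) ((P i).coeff (P i).natDegree)) = 1 from h2, one_mul] at h3
    refine absurd h3.symm (ne_of_lt ?_)
    apply V.valuation.map_sum_lt
    · exact pow_ne_zero _ (by intro h; rw [h] at hcon; simp at hcon)
    · intro j hj
      rw [map_mul, map_pow]
      have h5 : V.valuation (aeval w ((P i).coeff j)) ≤ 1 := (Cong.aeval hV hc _).le_one hV
      calc _ ≤ 1 * V.valuation (v i) ^ j := mul_le_mul' h5 le_rfl
        _ = V.valuation (v i) ^ j := one_mul _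
        _ < _ := pow_lt_pow_right₀ hcon (Finset.mem_range.1 hj)
  have hres : ∀ i, ∃ c : k, Cong V (v i) c := by
    intro i
    obtain ⟨c, -, h⟩ := root_cong (V := V) ((P i).map (eval u)) (by
      intro h0
      have := congrArg (fun p => p.coeff (P i).natDegree) h0
      simp only [Polynomial.coeff_map, Polynomial.coeff_zero] at this
      exact hu i (Finset.mem_univ _) this) hV (r := v i) (by
      have key : ∀ Q : Polynomial (MvPolynomial ι k), V.valuation
          (Polynomial.eval₂ ((aeval w : MvPolynomial ι k →ₐ[k] K) : MvPolynomial ι k →+* K) (v i) Q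
            - Polynomial.aeval (v i) (Q.map (eval u))) < 1 := by
        intro Q
        induction Q using Polynomial.induction_on' with
        | add p q hp hq =>
          rw [Polynomial.eval₂_add, Polynomial.map_add, map_add, add_sub_add_comm]
          exact V.valuation.map_add_lt hp hq
        | monomial n a =>
          have h1 := Cong.aeval hV hc a
          unfold Cong at h1
          rw [Polynomial.eval₂_monomial, Polynomial.map_monomial, Polynomial.aeval_monomial, ← sub_mul,
            map_mul, map_pow, mul_comm]
          exact vml (pow_le_one' (hval i) n) h1
      have := key (P i)
      rwa [hPv i, zero_sub, V.valuation.map_neg] at this)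
    exact ⟨c, h⟩
  choose c hcc using hres
  refine ⟨c, fun F hF => Cong.rel hV ?_ hF⟩
  rintro (i | i)
  · exact hcc i
  · exact hc i
end
end S19

namespace S19

/-- evaluation at `w` as a ring hom -/
abbrev aevR (k : Type) {E ι : Type} [Field k] [Field E] [Algebra k E] (w : ι → E) : MvPolynomial ι k →+* E :=
  ((aeval w : MvPolynomial ι k →ₐ[k] E) : MvPolynomial ι k →+* E)

def AlgOver (k : Type) {E ι : Type} [Field k] [Field E] [Algebra k E] (w : ι → E) (r : E) : Prop :=
  ∃ F : Polynomial (MvPolynomial ι k), F ≠ 0 ∧ Polynomial.eval₂ (aevR k w) r F = 0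

section
variable {k E ι : Type} [Field k] [Field E] [Algebra k E]

theorem algOver_iff {w : ι → E} (hw : AlgebraicIndependent k w) (r : E) :
    AlgOver k w r ↔ IsAlgebraic (Algebra.adjoin k (Set.range w)) r := by
  let : Algebra (MvPolynomial ι k) E := (aevR k w).toAlgebra
  have h1 : AlgOver k w r ↔ IsAlgebraic (MvPolynomial ι k) r := Iff.rfl
  rw [h1]
  exact (isAlgebraic_ringHom_iff_of_comp_eq (hw.aevalEquiv : MvPolynomial ι k ≃+* _) (RingHom.id E) Function.injective_id (by
    ext <;> simp [RingHom.algebraMap_toAlgebra])).symm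

theorem algOver_basis {w : ι → E} (hw : AlgebraicIndependent k w) (h : ∀ r, AlgOver k w r) :
    IsTranscendenceBasis k w :=
  isTranscendenceBasis_iff_algebraicIndependent_isAlgebraic.2 ⟨hw, ⟨fun r => (algOver_iff hw r).1 (h r)⟩⟩

theorem EXCH {ι' : Type} [Finite ι] [Finite ι'] {w : ι → E} (hw : AlgebraicIndependent k w) (h : ∀ r, AlgOver k w r)
    {w' : ι' → E} (hw' : AlgebraicIndependent k w') (hc : Nat.card ι ≤ Nat.card ι') (r : E) : AlgOver k w' r := by
  rw [algOver_iff hw']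
  have hb := algOver_basis hw h
  have : IsTranscendenceBasis k w' := by
    apply hw'.isTranscendenceBasis_of_trdeg_le_of_finite
    rw [← hb.cardinalMk_eq_trdeg, ← Nat.cast_card, ← Nat.cast_card]
    exact_mod_cast hc
  exact this.isAlgebraic.isAlgebraic r

theorem ALGGEN {σ : Type} {w : ι → E} (hw : AlgebraicIndependent k w) (v : σ → E)
    (hg : ∀ r : E, ∃ F G : MvPolynomial σ k, aeval v G ≠ 0 ∧ r = aeval v F / aeval v G)
    (h : ∀ i, AlgOver k w (v i)) (r : E) : AlgOver k w r := by
  simp only [algOver_iff hw] at *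
  have hp : ∀ F : MvPolynomial σ k, IsAlgebraic (Algebra.adjoin k (Set.range w)) (aeval v F) := by
    intro F
    induction F using MvPolynomial.induction_on with
    | C a =>
      rw [aeval_C, IsScalarTower.algebraMap_apply k (Algebra.adjoin k (Set.range w)) E]
      exact isAlgebraic_algebraMap _
    | add p q hp hq => rw [map_add]; exact hp.add hq
    | mul_X p i hp => rw [map_mul, aeval_X]; exact hp.mul (h i)
  obtain ⟨F, G, -, rfl⟩ := hg r
  rw [div_eq_mul_inv]
  exact (hp F).mul (hp G).inv

theorem DER [CharZero k] {w : ι → E} (hw : AlgebraicIndependent k w) (h : ∀ r, AlgOver k w r) (d : ι → E) :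
    ∃ D : Derivation k E E, ∀ i, D (w i) = d i := by
  let : Algebra (MvPolynomial ι k) E := (aevR k w).toAlgebra
  have : IsScalarTower k (MvPolynomial ι k) E := .of_algebraMap_eq (fun x => by
    simp [RingHom.algebraMap_toAlgebra])
  have : FaithfulSMul (MvPolynomial ι k) E := (faithfulSMul_iff_algebraMap_injective _ _).2 hw
  let : Algebra (FractionRing (MvPolynomial ι k)) E := FractionRing.liftAlgebra _ _
  have : Algebra.IsAlgebraic (MvPolynomial ι k) E := ⟨fun r => h r⟩
  have : Algebra.IsAlgebraic (FractionRing (MvPolynomial ι k)) E :=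
    (IsFractionRing.comap_isAlgebraic_iff (A := MvPolynomial ι k)).1 inferInstance
  have : CharZero (FractionRing (MvPolynomial ι k)) := inferInstance
  have : Algebra.FormallyEtale (FractionRing (MvPolynomial ι k)) E := Algebra.FormallyEtale.of_isSeparable _ _
  have : Algebra.FormallyEtale (MvPolynomial ι k) (FractionRing (MvPolynomial ι k)) := 
    Algebra.FormallyEtale.of_isLocalization (nonZeroDivisors _)
  have : Algebra.FormallyEtale (MvPolynomial ι k) E := Algebra.FormallyEtale.comp _ (FractionRing (MvPolynomial ι k)) _
  have hb := KaehlerDifferential.isBaseChange_of_formallyEtale k (MvPolynomial ι k) E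
  let D0 : Derivation k (MvPolynomial ι k) E := mkDerivation k d
  let L := hb.lift D0.liftKaehlerDifferential
  refine ⟨L.compDer (KaehlerDifferential.D k E), fun i => ?_⟩
  have h1 : L (KaehlerDifferential.map k k (MvPolynomial ι k) E (KaehlerDifferential.D k _ (X i))) = D0.liftKaehlerDifferential (KaehlerDifferential.D k _ (X i)) := hb.lift_eq _ _
  rw [KaehlerDifferential.map_D, Derivation.liftKaehlerDifferential_comp_D] at h1
  have h2 : algebraMap (MvPolynomial ι k) E (X i) = w i := by simp [RingHom.algebraMap_toAlgebra]
  rw [h2] at h1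
  simpa [D0] using h1

end


/-- `ξ` is a generic point of `Z` with function field `K`. -/
structure Gen {k σ K : Type} [Field k] [Field K] [Algebra k K] (Z : Set (σ → k)) (ξ : σ → K) : Prop where
  rel : ∀ F : MvPolynomial σ k, aeval ξ F = 0 ↔ ∀ c ∈ Z, eval c F = 0
  gen : ∀ r : K, ∃ F G : MvPolynomial σ k, aeval ξ G ≠ 0 ∧ r = aeval ξ F / aeval ξ G

theorem Gen.exists {k σ : Type} [Field k] (Z : Set (σ → k)) (hne : Z.Nonempty)
    (hirr : ∀ F G : MvPolynomial σ k, (∀ c ∈ Z, eval c (F * G) = 0) →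
      (∀ c ∈ Z, eval c F = 0) ∨ (∀ c ∈ Z, eval c G = 0)) :
    ∃ (K : Type) (_ : Field K) (_ : Algebra k K) (ξ : σ → K), Gen Z ξ := by
  let I : Ideal (MvPolynomial σ k) := 
    { carrier := {F | ∀ c ∈ Z, eval c F = 0}
      add_mem' := fun {a b} ha hb c hc => by rw [map_add, ha c hc, hb c hc, add_zero]
      zero_mem' := fun c _ => map_zero _
      smul_mem' := fun a b hb c hc => by rw [smul_eq_mul, map_mul, hb c hc, mul_zero] }
  have hI : ∀ F, F ∈ I ↔ ∀ c ∈ Z, eval c F = 0 := fun F => Iff.rfl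
  have hp : I.IsPrime := by
    refine ⟨?_, fun {a b} hab => hirr a b hab⟩
    rw [Ne, Ideal.eq_top_iff_one, hI]
    intro h
    obtain ⟨c, hc⟩ := hne
    simpa using h c hc
  let A := MvPolynomial σ k ⧸ I
  let ξ : σ → FractionRing A := fun i => algebraMap A _ (Ideal.Quotient.mk I (X i))
  have hξ : ∀ F : MvPolynomial σ k, aeval ξ F = algebraMap A (FractionRing A) (Ideal.Quotient.mk I F) := by
    intro F
    have : (aeval ξ : MvPolynomial σ k →ₐ[k] FractionRing A) = (IsScalarTower.toAlgHom k A (FractionRing A)).comp (Ideal.Quotient.mkₐ k I) := by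
      ext i; simp [ξ]; rfl
    rw [this]; rfl
  refine ⟨FractionRing A, inferInstance, inferInstance, ξ, ?_, ?_⟩
  · intro F
    rw [hξ, ← hI, ← Ideal.Quotient.eq_zero_iff_mem]
    exact IsFractionRing.to_map_eq_zero_iff
  · intro r
    obtain ⟨a, b, hb, rfl⟩ := IsFractionRing.div_surjective (A := A) r
    obtain ⟨F, rfl⟩ := Ideal.Quotient.mk_surjective a
    obtain ⟨G, rfl⟩ := Ideal.Quotient.mk_surjective b
    refine ⟨F, G, ?_, by rw [hξ, hξ]⟩
    rw [hξ]
    exact IsFractionRing.to_map_ne_zero_of_mem_nonZeroDivisors hb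

section
variable {k σ K : Type} [Field k] [Field K] [Algebra k K] {Z : Set (σ → k)} {ξ : σ → K}

theorem Gen.lift (hg : Gen Z ξ) {E : Type} [Field E] [Algebra k E] (η : σ → E)
    (h : ∀ F : MvPolynomial σ k, aeval ξ F = 0 ↔ aeval η F = 0) :
    ∃ φ : K →ₐ[k] E, ∀ i, φ (ξ i) = η i := by
  let f : MvPolynomial σ k →ₐ[k] K := aeval ξ
  let A := f.range
  have : IsFractionRing A K := IsFractionRing.of_field _ _ (fun z => by
    obtain ⟨F, G, -, h⟩ := hg.gen z
    exact ⟨⟨aeval ξ F, ⟨F, rfl⟩⟩, ⟨aeval ξ G, ⟨G, rfl⟩⟩, h⟩)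
  let e := Ideal.quotientKerAlgEquivOfSurjective f.rangeRestrict_surjective
  let g0 : (MvPolynomial σ k ⧸ RingHom.ker f.rangeRestrict) →ₐ[k] E := Ideal.Quotient.liftₐ _ (aeval η) (by
    intro F hF
    rw [RingHom.mem_ker] at hF
    exact (h F).1 (congrArg Subtype.val hF))
  let g : A →ₐ[k] E := g0.comp e.symm.toAlgHom
  have hgF : ∀ F, g (f.rangeRestrict F) = aeval η F := by
    intro F
    have : e (Ideal.Quotient.mk _ F) = f.rangeRestrict F := rfl
    change g0 (e.symm _) = _
    rw [← this, e.symm_apply_apply]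
    rfl
  have hginj : Function.Injective g := by
    rw [injective_iff_map_eq_zero]
    intro a ha
    obtain ⟨F, rfl⟩ := f.rangeRestrict_surjective a
    rw [hgF, ← h] at ha
    exact Subtype.ext ha
  refine ⟨IsFractionRing.liftAlgHom hginj, fun i => ?_⟩
  have h1 : ξ i = algebraMap A K (f.rangeRestrict (X i)) := by
    change ξ i = f (X i)
    simp [f]
  rw [h1, IsFractionRing.liftAlgHom_apply, IsFractionRing.lift_algebraMap]
  change g _ = _
  rw [hgF, aeval_X]

/-- morphisms out of `K` are determined on the generators -/
theorem Gen.ext (hg : Gen Z ξ) {E : Type} [Field E] [Algebra k E] {φ ψ : K →ₐ[k] E}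
    (h : ∀ i, φ (ξ i) = ψ (ξ i)) : φ = ψ := by
  have h1 : ∀ F : MvPolynomial σ k, φ (aeval ξ F) = ψ (aeval ξ F) := by
    intro F
    rw [← AlgHom.comp_apply, ← AlgHom.comp_apply]
    congr 1
    ext i; simp [h]
  ext r
  obtain ⟨F, G, -, rfl⟩ := hg.gen r
  rw [map_div₀, map_div₀, h1, h1]

theorem Gen.pt (hg : Gen Z ξ) (F : MvPolynomial σ k) (hF : aeval ξ F ≠ 0) : ∃ c ∈ Z, eval c F ≠ 0 := by
  rw [Ne, hg.rel] at hF
  push Not at hF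
  exact hF

end

theorem AlgebraicIndependent_unit {k K : Type} [Field k] [IsAlgClosed k] [Field K] [Algebra k K] {x : K}
    (h : ∀ c : k, x ≠ algebraMap k K c) : AlgebraicIndependent k (fun _ : Unit => x) := by
  rw [algebraicIndependent_unique_type_iff]
  exact transc h

theorem TD1_of {k K : Type} [Field k] [IsAlgClosed k] [Field K] [Algebra k K] {x : K}
    (hx : ∀ c : k, x ≠ algebraMap k K c) (h : ∀ r, AlgOver k (fun _ : Unit => x) r) : TD1 k K := by
  intro w r
  by_cases hw : ∃ c : k, w = algebraMap k K c
  · obtain ⟨c, rfl⟩ := hw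
    refine ⟨Polynomial.C (Polynomial.X - Polynomial.C c), ?_, by simp [ev2]⟩
    rw [Ne, Polynomial.C_eq_zero]
    exact Polynomial.X_sub_C_ne_zero c
  · push Not at hw
    obtain ⟨F, hF, hF2⟩ := EXCH (AlgebraicIndependent_unit hx) h (AlgebraicIndependent_unit hw) le_rfl r
    refine ⟨F.map ((uniqueAlgEquiv k Unit : MvPolynomial Unit k ≃ₐ[k] Polynomial k) : MvPolynomial Unit k →+* Polynomial k), ?_, ?_⟩
    · rw [Ne, Polynomial.map_eq_zero_iff]
      · exact hF
      · exact (uniqueAlgEquiv k Unit).injective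
    · unfold ev2
      rw [Polynomial.eval₂_map, ← hF2]
      congr 1
      apply MvPolynomial.ringHom_ext
      · intro c; simp [aevR]
      · intro i; simp [aevR]
end S19

namespace S19

/-- derivations vanish on elements algebraic over constants -/
theorem D_zero_alg {R E E' : Type} [CommRing R] [IsDomain R] [CharZero R] [Field E] [Field E'] (f : R →+* E)
    (hf : Function.Injective f) (φ : E →+* E') (δ : E →+ E')
    (hδ : ∀ a b, δ (a * b) = φ a * δ b + φ b * δ a) (h0 : ∀ c, δ (f c) = 0) (r : E)
    (F : Polynomial R) (hF : F ≠ 0) (hr : Polynomial.eval₂ f r F = 0) : δ r = 0 := by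
  have hpow : ∀ n : ℕ, δ (r ^ n) = n * φ r ^ (n - 1) * δ r := by
    intro n
    induction n with
    | zero =>
      have := h0 1
      simpa using this
    | succ n ih =>
      rw [pow_succ, hδ, ih]
      cases n with
      | zero => simp
      | succ m => push_cast; simp only [map_pow]; ring
  have key : ∀ F : Polynomial R, δ (Polynomial.eval₂ f r F) = φ (Polynomial.eval₂ f r F.derivative) * δ r := by
    intro F
    induction F using Polynomial.induction_on' with
    | add p q hp hq => simp only [Polynomial.eval₂_add, map_add, hp, hq]; ring
    | monomial n a =>
      rw [Polynomial.eval₂_monomial, hδ, h0, hpow, Polynomial.derivative_monomial, Polynomial.eval₂_monomial]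
      simp only [map_mul, map_pow, map_natCast]; ring
  induction h : F.natDegree using Nat.strong_induction_on generalizing F with
  | _ n ih =>
    have h1 := key F
    rw [hr, map_zero] at h1
    by_cases h2 : δ r = 0
    · exact h2
    have h3 : Polynomial.eval₂ f r F.derivative = 0 := by
      have := (mul_eq_zero.1 h1.symm).resolve_right h2
      simpa using this
    have hn : n ≠ 0 := by
      rintro rfl
      rw [Polynomial.natDegree_eq_zero] at h
      obtain ⟨a, rfl⟩ := h
      rw [Polynomial.eval₂_C] at hr
      exact hF (by rw [(map_eq_zero_iff f hf).1 hr, Polynomial.C_0])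
    refine ih _ ?_ F.derivative ?_ h3 rfl
    · rw [← h]; exact Polynomial.natDegree_derivative_lt (by omega)
    · intro h4
      have := Polynomial.derivative_eq_zero.1 h4
      omega

section
variable {k E : Type} [Field k] [Field E] [Algebra k E]

theorem D_zero_of [CharZero k] {ι E' : Type} [Field E'] {w : ι → E} (hw : AlgebraicIndependent k w)
    (φ : E →+* E') (δ : E →+ E')
    (hδ : ∀ a b, δ (a * b) = φ a * δ b + φ b * δ a) (h0 : ∀ c : k, δ (algebraMap k E c) = 0)
    (hw0 : ∀ i, δ (w i) = 0) (r : E) (hr : AlgOver k w r) : δ r = 0 := by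
  obtain ⟨F, hF, hFr⟩ := hr
  refine D_zero_alg (aevR k w) hw φ δ hδ (fun F => ?_) r F hF hFr
  change δ (aeval w F) = 0
  induction F using MvPolynomial.induction_on with
  | C a => simpa using h0 a
  | add p q hp hq => simp [hp, hq]
  | mul_X p i hp => rw [map_mul, aeval_X, hδ, hp, hw0]; simp

theorem algOver_of_not_indep [IsAlgClosed k] {s t : E} (hs : ∀ c : k, s ≠ algebraMap k E c)
    (h : ¬ AlgebraicIndependent k ![s, t]) : AlgOver k (fun _ : Unit => s) t := by
  have hu := AlgebraicIndependent_unit hs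
  by_contra hcon
  rw [algOver_iff hu] at hcon
  have := (hu.option_iff_transcendental t).2 hcon
  apply h
  have h2 := this.comp (![some (), none] : Fin 2 → Option Unit) (by
    intro i j hij
    fin_cases i <;> fin_cases j <;> simp_all)
  convert h2 using 1
  funext i
  fin_cases i <;> rfl

theorem AlgOver.map {E' ι ι' : Type} [Field E'] [Algebra k E'] {w : ι → E} {r : E} (h : AlgOver k w r)
    (φ : E →ₐ[k] E') (j : ι → ι') (hj : Function.Injective j) (w' : ι' → E') (hw' : ∀ i, w' (j i) = φ (w i)) :
    AlgOver k w' (φ r) := by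
  obtain ⟨F, hF, hFr⟩ := h
  refine ⟨F.map (rename j : MvPolynomial ι k →ₐ[k] MvPolynomial ι' k).toRingHom, ?_, ?_⟩
  · rw [Ne, Polynomial.map_eq_zero_iff]
    · exact hF
    · exact rename_injective j hj
  · rw [Polynomial.eval₂_map]
    have : (aevR k w').comp (rename j : MvPolynomial ι k →ₐ[k] MvPolynomial ι' k).toRingHom = (φ : E →+* E').comp (aevR k w) := by
      apply MvPolynomial.ringHom_ext
      · intro c; simp [aevR]
      · intro i; simp [aevR, hw']
    rw [this]
    have h2 := Polynomial.hom_eval₂ F (aevR k w) (φ : E →+* E') r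
    rw [hFr, map_zero] at h2
    exact h2.symm
end

/-- an affine space curve, not contained in a plane -/
structure AffCurve {k : Type} [Field k] (Z : Set (Fin 3 → k)) : Prop where
  ne : Z.Nonempty
  irr : ∀ F G : MvPolynomial (Fin 3) k, (∀ c ∈ Z, eval c (F * G) = 0) →
      (∀ c ∈ Z, eval c F = 0) ∨ (∀ c ∈ Z, eval c G = 0)
  fin : ∀ F : MvPolynomial (Fin 3) k, (∃ c ∈ Z, eval c F ≠ 0) → {c ∈ Z | eval c F = 0}.Finite
  closed : ∀ c : Fin 3 → k, (∀ F : MvPolynomial (Fin 3) k, (∀ b ∈ Z, eval b F = 0) → eval c F = 0) → c ∈ Z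
  np : ∀ e0 e1 e2 e3 : k, (∀ c ∈ Z, e0 + e1 * c 0 + e2 * c 1 + e3 * c 2 = 0) → e1 = 0 ∧ e2 = 0 ∧ e3 = 0

section
variable {k K : Type} [Field k] [IsAlgClosed k] [Field K] [Algebra k K]
  {Z : Set (Fin 3 → k)} {ξ : Fin 3 → K}

theorem AffCurve.plane (hZ : AffCurve Z) (hg : Gen Z ξ) (e0 e1 e2 e3 : k) (h : algebraMap k K e0 + algebraMap k K e1 * ξ 0 + algebraMap k K e2 * ξ 1
    + algebraMap k K e3 * ξ 2 = 0) : e1 = 0 ∧ e2 = 0 ∧ e3 = 0 := by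
  apply hZ.np e0
  have := (hg.rel (C e0 + C e1 * X 0 + C e2 * X 1 + C e3 * X 2)).1 (by simpa using h)
  intro c hc
  simpa using this c hc

theorem AffCurve.nc0 (hZ : AffCurve Z) (hg : Gen Z ξ) (c : k) : ξ 0 ≠ algebraMap k K c := by
  intro h
  have := hZ.plane hg (-c) 1 0 0 (by simp [h])
  simp at this

theorem AffCurve.nc1 (hZ : AffCurve Z) (hg : Gen Z ξ) (c : k) : ξ 1 ≠ algebraMap k K c := by
  intro h
  have := hZ.plane hg (-c) 0 1 0 (by simp [h])
  simp at this

theorem AffCurve.nc2 (hZ : AffCurve Z) (hg : Gen Z ξ) (c : k) : ξ 2 ≠ algebraMap k K c := by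
  intro h
  have := hZ.plane hg (-c) 0 0 1 (by simp [h])
  simp at this

theorem AffCurve.nc (hZ : AffCurve Z) (hg : Gen Z ξ) (i : Fin 3) (c : k) : ξ i ≠ algebraMap k K c := by
  fin_cases i
  · exact hZ.nc0 hg c
  · exact hZ.nc1 hg c
  · exact hZ.nc2 hg c

theorem AffCurve.mem_of_rel (hZ : AffCurve Z) (hg : Gen Z ξ) (c : Fin 3 → k) (h : ∀ F : MvPolynomial (Fin 3) k, aeval ξ F = 0 → eval c F = 0) : c ∈ Z :=
  hZ.closed c fun F hF => h F ((hg.rel F).2 hF)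

theorem AffCurve.alg0 (hZ : AffCurve Z) (hg : Gen Z ξ) (r : K) : AlgOver k (fun _ : Unit => ξ 0) r := by
  have hu := AlgebraicIndependent_unit (hZ.nc0 hg)
  refine ALGGEN hu ξ hg.gen (fun j => ?_) r
  by_contra hcon
  have hind : AlgebraicIndependent k ![ξ 0, ξ j] := by
    by_contra h
    exact hcon (algOver_of_not_indep (hZ.nc0 hg) h)
  have hset : AlgebraicIndepOn k id (Set.range ![ξ 0, ξ j]) := hind.to_subtype_range
  have hsub : Set.range ![ξ 0, ξ j] ⊆ Set.range ξ := by
    rintro _ ⟨i, rfl⟩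
    fin_cases i
    · exact ⟨0, rfl⟩
    · exact ⟨j, rfl⟩
  have hA : Algebra.IsAlgebraic (Algebra.adjoin k (Set.range ξ)) K := by
    refine ⟨fun r => ?_⟩
    have hp : ∀ F : MvPolynomial (Fin 3) k, IsAlgebraic (Algebra.adjoin k (Set.range ξ)) (aeval ξ F) := by
      intro F
      have : aeval ξ F ∈ Algebra.adjoin k (Set.range ξ) := by
        rw [Algebra.adjoin_range_eq_range_aeval]; exact ⟨F, rfl⟩
      exact isAlgebraic_algebraMap (⟨aeval ξ F, this⟩ : Algebra.adjoin k (Set.range ξ))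
    obtain ⟨F, G, -, rfl⟩ := hg.gen r
    rw [div_eq_mul_inv]
    exact (hp F).mul (hp G).inv
  obtain ⟨u, hu1, hu2, hu3⟩ := exists_isTranscendenceBasis_between _ _ hsub hset
  have h0u : ξ 0 ∈ u := hu1 ⟨0, rfl⟩
  have hju : ξ j ∈ u := hu1 ⟨1, rfl⟩
  have hne : (⟨ξ 0, h0u⟩ : u) ≠ ⟨ξ j, hju⟩ := by
    intro h
    have := hind.injective (show ![ξ 0, ξ j] 0 = ![ξ 0, ξ j] 1 from congrArg Subtype.val h)
    simp at this
  obtain ⟨N, hN, hL⟩ := LIFT (fun x : u => (x : K)) hu3.1 ξ (fun i => by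
    exact (algOver_iff hu3.1 _).2 (hu3.isAlgebraic.isAlgebraic _))
  have hinf : Infinite k := IsAlgClosed.instInfinite
  obtain ⟨v, hv⟩ : ∃ v, eval v N ≠ 0 := by
    by_contra h
    push Not at h
    exact hN (MvPolynomial.funext (by simpa using h))
  classical
  -- the line
  let p : Polynomial k := aeval (fun x : u => if x = ⟨ξ j, hju⟩ then Polynomial.X else Polynomial.C (v x)) N
  have hp : ∀ τ, p.eval τ = eval (fun x : u => if x = ⟨ξ j, hju⟩ then τ else v x) N := by
    intro τ
    rw [← Polynomial.coe_evalRingHom]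
    have : (Polynomial.evalRingHom τ).comp ((aeval (fun x : u => if x = ⟨ξ j, hju⟩ then Polynomial.X else Polynomial.C (v x)) : MvPolynomial u k →ₐ[k] Polynomial k) : MvPolynomial u k →+* Polynomial k) = eval (fun x : u => if x = ⟨ξ j, hju⟩ then τ else v x) := by
      apply MvPolynomial.ringHom_ext
      · intro c; simp
      · intro i
        by_cases hi : i = ⟨ξ j, hju⟩ <;> simp [hi]
    rw [← this]; rfl
  have hpne : p ≠ 0 := by
    intro h
    apply hv
    have := hp (v ⟨ξ j, hju⟩)
    rw [h, Polynomial.eval_zero] at this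
    convert this.symm using 2
    congr 1
    funext x
    by_cases hx : x = ⟨ξ j, hju⟩ <;> simp [hx]
  have hfin : {c ∈ Z | eval c (X 0 - C (v ⟨ξ 0, h0u⟩) : MvPolynomial (Fin 3) k) = 0}.Finite := by
    apply hZ.fin
    apply hg.pt
    simp only [map_sub, aeval_X, algHom_C, sub_ne_zero]
    exact hZ.nc0 hg _
  have hinf2 : {τ : k | ¬ p.IsRoot τ}.Infinite := (Polynomial.finite_setOfPred_isRoot hpne).infinite_compl
  have hsub : {τ : k | ¬ p.IsRoot τ} ⊆ (fun c : Fin 3 → k => c j) '' {c ∈ Z | eval c (X 0 - C (v ⟨ξ 0, h0u⟩) : MvPolynomial (Fin 3) k) = 0} := by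
    intro τ hτ
    have h1 : eval (fun x : u => if x = ⟨ξ j, hju⟩ then τ else v x) N ≠ 0 := by rw [← hp]; exact hτ
    obtain ⟨c, hc⟩ := hL _ h1
    have hc2 : ∀ i (hi : ξ i ∈ u), c i = if (⟨ξ i, hi⟩ : u) = ⟨ξ j, hju⟩ then τ else v ⟨ξ i, hi⟩ := by
      intro i hi
      have := hc (X (Sum.inl i) - X (Sum.inr ⟨ξ i, hi⟩)) (by simp)
      simpa [sub_eq_zero] using this
    refine ⟨c, ⟨hZ.mem_of_rel hg c fun F hF => ?_, ?_⟩, ?_⟩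
    · have := hc (rename Sum.inl F) (by rw [aeval_rename]; simpa [Function.comp_def] using hF)
      rw [eval_rename] at this
      simpa [Function.comp_def] using this
    · have := hc2 0 h0u
      rw [if_neg hne] at this
      simp [this]
    · have := hc2 j hju
      simpa using this
  exact hinf2 ((hfin.image _).subset hsub)

theorem AffCurve.td1 (hZ : AffCurve Z) (hg : Gen Z ξ) : TD1 k K := TD1_of (hZ.nc0 hg) (hZ.alg0 hg)

end
end S19

namespace S19

/-- the square of `Z` -/
def Z2 {k : Type} (Z : Set (Fin 3 → k)) : Set (Fin 3 ⊕ Fin 3 → k) :=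
  {c | (fun i => c (Sum.inl i)) ∈ Z ∧ (fun i => c (Sum.inr i)) ∈ Z}

/-- partial evaluation -/
def pevL {k α β : Type} [Field k] (a : α → k) (F : MvPolynomial (α ⊕ β) k) : MvPolynomial β k :=
  aeval (Sum.elim (fun i => C (a i)) X) F

def pevR {k α β : Type} [Field k] (b : β → k) (F : MvPolynomial (α ⊕ β) k) : MvPolynomial α k :=
  aeval (Sum.elim X (fun i => C (b i))) F

theorem aeval_pevL {k α β : Type} [Field k] {A : Type} [CommRing A] [Algebra k A] (a : α → k) (b : β → A) (F : MvPolynomial (α ⊕ β) k) :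
    aeval b (pevL a F) = aeval (Sum.elim (fun i => algebraMap k A (a i)) b) F := by
  unfold pevL
  rw [← AlgHom.comp_apply]
  congr 1
  ext i
  rcases i with i | i <;> simp

theorem aeval_pevR {k α β : Type} [Field k] {A : Type} [CommRing A] [Algebra k A] (a : α → A) (b : β → k) (F : MvPolynomial (α ⊕ β) k) :
    aeval a (pevR b F) = aeval (Sum.elim a (fun i => algebraMap k A (b i))) F := by
  unfold pevR
  rw [← AlgHom.comp_apply]
  congr 1
  ext i
  rcases i with i | i <;> simp

theorem eval_pevL {k α β : Type} [Field k] (a : α → k) (b : β → k) (F : MvPolynomial (α ⊕ β) k) :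
    eval b (pevL a F) = eval (Sum.elim a b) F := by
  have := aeval_pevL a b F
  simpa [aeval_eq_eval] using this

theorem eval_pevR {k α β : Type} [Field k] (a : α → k) (b : β → k) (F : MvPolynomial (α ⊕ β) k) :
    eval a (pevR b F) = eval (Sum.elim a b) F := by
  have := aeval_pevR a b F
  simpa [aeval_eq_eval] using this

theorem mem_Z2 {k : Type} {Z : Set (Fin 3 → k)} {a b : Fin 3 → k} : Sum.elim a b ∈ Z2 Z ↔ a ∈ Z ∧ b ∈ Z := Iff.rfl

theorem Z2_forall {k : Type} {Z : Set (Fin 3 → k)} (P : (Fin 3 ⊕ Fin 3 → k) → Prop) :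
    (∀ c ∈ Z2 Z, P c) ↔ ∀ a ∈ Z, ∀ b ∈ Z, P (Sum.elim a b) := by
  constructor
  · intro h a ha b hb; exact h _ ⟨ha, hb⟩
  · intro h c hc
    have := h _ hc.1 _ hc.2
    convert this
    funext i
    rcases i with i | i <;> rfl

theorem AffCurve.irr2 {k : Type} [Field k] {Z : Set (Fin 3 → k)} (hZ : AffCurve Z)
    (F G : MvPolynomial (Fin 3 ⊕ Fin 3) k) (h : ∀ c ∈ Z2 Z, eval c (F * G) = 0) :
      (∀ c ∈ Z2 Z, eval c F = 0) ∨ (∀ c ∈ Z2 Z, eval c G = 0) := by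
  rw [Z2_forall (fun c => eval c _ = 0)] at *
  rw [Z2_forall (fun c => eval c G = 0)]
  by_contra hcon
  push Not at hcon
  obtain ⟨⟨a1, ha1, b1, hb1, h1⟩, ⟨a2, ha2, b2, hb2, h2⟩⟩ := hcon
  have h3 : ∃ a ∈ Z, eval a (pevR b1 F * pevR b2 G) ≠ 0 := by
    by_contra hc
    push Not at hc
    rcases hZ.irr _ _ hc with h | h
    · exact h1 (by rw [← eval_pevR]; exact h a1 ha1)
    · exact h2 (by rw [← eval_pevR]; exact h a2 ha2)
  obtain ⟨a, ha, h4⟩ := h3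
  rw [map_mul, eval_pevR, eval_pevR] at h4
  rcases hZ.irr (pevL a F) (pevL a G) (by
    intro c hc
    have := h a ha c hc
    rw [map_mul] at *
    rwa [eval_pevL, eval_pevL]) with h5 | h5
  · have := h5 b1 hb1
    rw [eval_pevL] at this
    simp [this] at h4
  · have := h5 b2 hb2
    rw [eval_pevL] at this
    simp [this] at h4

structure Pair {k K E : Type} [Field k] [Field K] [Algebra k K] [Field E] [Algebra k E] 
    (Z : Set (Fin 3 → k)) (ξ : Fin 3 → K) (ia ib : K →ₐ[k] E) (τ : E →ₐ[k] E) (D : Derivation k K K)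
    (Da Db : Derivation k E E) : Prop where
  hZ : AffCurve Z
  hg : Gen Z ξ
  hE : Gen (Z2 Z) (Sum.elim (fun i => ia (ξ i)) (fun i => ib (ξ i)))
  τa : ∀ r, τ (ia r) = ib r
  τb : ∀ r, τ (ib r) = ia r
  D0 : D (ξ 0) = 1
  Daa : ∀ r, Da (ia r) = ia (D r)
  Dab : ∀ r, Da (ib r) = 0
  Dba : ∀ r, Db (ia r) = 0
  Dbb : ∀ r, Db (ib r) = ib (D r)
  ind : AlgebraicIndependent k ![ia (ξ 0), ib (ξ 0)]
  alg : ∀ r, AlgOver k ![ia (ξ 0), ib (ξ 0)] r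

theorem Derivation.leib' {k E : Type} [Field k] [Field E] [Algebra k E] (D : Derivation k E E) (a b : E) :
    D (a * b) = a * D b + b * D a := by
  rw [D.leibniz]; simp

theorem Pair.exists {k : Type} [Field k] [IsAlgClosed k] [CharZero k] {Z : Set (Fin 3 → k)} (hZ : AffCurve Z) :
    ∃ (K : Type) (_ : Field K) (_ : Algebra k K) (E : Type) (_ : Field E) (_ : Algebra k E)
    (ξ : Fin 3 → K) (ia ib : K →ₐ[k] E) (τ : E →ₐ[k] E) (D : Derivation k K K)
    (Da Db : Derivation k E E), Pair Z ξ ia ib τ D Da Db := by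
  obtain ⟨K, iK, aK, ξ, hg⟩ := Gen.exists Z hZ.ne hZ.irr
  obtain ⟨a0, ha0⟩ := hZ.ne
  obtain ⟨E, iE, aE, η, hE⟩ := Gen.exists (Z2 Z) ⟨Sum.elim a0 a0, ha0, ha0⟩ hZ.irr2
  have hla : ∀ F : MvPolynomial (Fin 3) k, aeval ξ F = 0 ↔ aeval (fun i => η (Sum.inl i)) F = 0 := by
    intro F
    have h1 : aeval (fun i => η (Sum.inl i)) F = aeval η (rename Sum.inl F) := by rw [aeval_rename]; rfl
    rw [h1, hg.rel, hE.rel, Z2_forall (fun c => eval c _ = 0)]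
    simp only [eval_rename, Sum.elim_comp_inl]
    exact ⟨fun h a ha _ _ => h a ha, fun h a ha => h a ha a0 ha0⟩
  have hlb : ∀ F : MvPolynomial (Fin 3) k, aeval ξ F = 0 ↔ aeval (fun i => η (Sum.inr i)) F = 0 := by
    intro F
    have h1 : aeval (fun i => η (Sum.inr i)) F = aeval η (rename Sum.inr F) := by rw [aeval_rename]; rfl
    rw [h1, hg.rel, hE.rel, Z2_forall (fun c => eval c _ = 0)]
    simp only [eval_rename, Sum.elim_comp_inr]
    exact ⟨fun h _ _ a ha => h a ha, fun h a ha => h a0 ha0 a ha⟩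
  obtain ⟨ia, hia⟩ := hg.lift _ hla
  obtain ⟨ib, hib⟩ := hg.lift _ hlb
  obtain ⟨τ, hτ⟩ := hE.lift (fun i => η i.swap) (by
    intro F
    have h1 : aeval (fun i => η (Sum.swap i)) F = aeval η (rename Sum.swap F) := by rw [aeval_rename]; rfl
    rw [h1, hE.rel, hE.rel, Z2_forall (fun c => eval c _ = 0), Z2_forall (fun c => eval c _ = 0)]
    simp only [eval_rename]
    have : ∀ a b : Fin 3 → k, Sum.elim a b ∘ Sum.swap = Sum.elim b a := by
      intro a b; funext i; rcases i with i | i <;> rfl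
    simp only [this]
    exact ⟨fun h a ha b hb => h b hb a ha, fun h a ha b hb => h b hb a ha⟩)
  have hη : η = Sum.elim (fun i => ia (ξ i)) (fun i => ib (ξ i)) := by
    funext i; rcases i with i | i
    · exact (hia i).symm
    · exact (hib i).symm
  have hτa : ∀ r, τ (ia r) = ib r := by
    have : τ.comp ia = ib := hg.ext (fun i => by
      rw [AlgHom.comp_apply, hia, hτ, hib]; rfl)
    intro r; rw [← this]; rfl
  have hτb : ∀ r, τ (ib r) = ia r := by
    have : τ.comp ib = ia := hg.ext (fun i => by
      rw [AlgHom.comp_apply, hib, hτ, hia]; rfl)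
    intro r; rw [← this]; rfl
  obtain ⟨D, hD⟩ := DER (AlgebraicIndependent_unit (hZ.nc0 hg)) (hZ.alg0 hg) (fun _ => 1)
  -- independence of x_a, x_b
  let S : Set k := (fun c : Fin 3 → k => c 0) '' Z
  have hS : S.Infinite := by
    intro hfin
    let F : MvPolynomial (Fin 3) k := ∏ s ∈ hfin.toFinset, (X 0 - C s)
    have hF : aeval ξ F = 0 := by
      rw [hg.rel]
      intro c hc
      simp only [F, map_prod]
      apply Finset.prod_eq_zero (i := c 0)
      · rw [hfin.mem_toFinset]; exact ⟨c, hc, rfl⟩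
      · simp
    simp only [F, map_prod, Finset.prod_eq_zero_iff] at hF
    obtain ⟨s, -, hs⟩ := hF
    exact hZ.nc0 hg s (by simpa [sub_eq_zero] using hs)
  have hind : AlgebraicIndependent k ![ia (ξ 0), ib (ξ 0)] := by
    rw [algebraicIndependent_iff]
    intro F hF
    have h1 : aeval η (rename ![Sum.inl 0, Sum.inr 0] F) = 0 := by
      rw [aeval_rename, ← hF]
      congr 1
      congr 1
      funext i
      fin_cases i
      · exact (hia 0).symm
      · exact (hib 0).symm
    rw [hE.rel, Z2_forall (fun c => eval c _ = 0)] at h1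
    apply MvPolynomial.funext_set (fun _ => S) (fun _ => hS)
    intro x hx
    obtain ⟨a, ha, ha2⟩ := hx 0 (Set.mem_univ _)
    obtain ⟨b, hb, hb2⟩ := hx 1 (Set.mem_univ _)
    have := h1 a ha b hb
    rw [eval_rename] at this
    rw [map_zero, ← this]
    congr 2
    funext i
    fin_cases i
    · exact ha2.symm
    · exact hb2.symm
  have hala : ∀ r, AlgOver k ![ia (ξ 0), ib (ξ 0)] (ia r) := fun r =>
    (hZ.alg0 hg r).map ia (fun _ => 0) (fun _ _ _ => rfl) _ (fun _ => rfl)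
  have halb : ∀ r, AlgOver k ![ia (ξ 0), ib (ξ 0)] (ib r) := fun r =>
    (hZ.alg0 hg r).map ib (fun _ => 1) (fun _ _ _ => rfl) _ (fun _ => rfl)
  have halg : ∀ r, AlgOver k ![ia (ξ 0), ib (ξ 0)] r := by
    refine ALGGEN hind η hE.gen ?_
    rw [hη]
    rintro (i | i)
    · exact hala _
    · exact halb _
  obtain ⟨Da, hDa⟩ := DER hind halg ![1, 0]
  obtain ⟨Db, hDb⟩ := DER hind halg ![0, 1]
  have e1 : Da (ia (ξ 0)) = 1 := hDa 0
  have e2 : Da (ib (ξ 0)) = 0 := hDa 1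
  have e3 : Db (ia (ξ 0)) = 0 := hDb 0
  have e4 : Db (ib (ξ 0)) = 1 := hDb 1
  have gen0 : ∀ (D' : Derivation k E E) (i : K →ₐ[k] E), D' (i (ξ 0)) = 0 → ∀ r, D' (i r) = 0 := by
    intro D' i h r
    refine D_zero_of (AlgebraicIndependent_unit (hZ.nc0 hg)) (i : K →+* E)
      ((D' : E →ₗ[k] E).toAddMonoidHom.comp (i : K →+* E).toAddMonoidHom) ?_ ?_ ?_ r (hZ.alg0 hg r)
    · intro a b
      change D' (i (a * b)) = i a * D' (i b) + i b * D' (i a)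
      rw [map_mul, Derivation.leib']
    · intro c
      change D' (i (algebraMap k K c)) = 0
      rw [AlgHom.commutes]; simp
    · intro _; exact h
  have gen1 : ∀ (D' : Derivation k E E) (i : K →ₐ[k] E), D' (i (ξ 0)) = 1 → ∀ r, D' (i r) = i (D r) := by
    intro D' i h r
    rw [← sub_eq_zero]
    refine D_zero_of (AlgebraicIndependent_unit (hZ.nc0 hg)) (i : K →+* E)
      ((D' : E →ₗ[k] E).toAddMonoidHom.comp (i : K →+* E).toAddMonoidHom - (i : K →+* E).toAddMonoidHom.comp (D : K →ₗ[k] K).toAddMonoidHom) ?_ ?_ ?_ r (hZ.alg0 hg r)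
    · intro a b
      change D' (i (a * b)) - i (D (a * b)) = i a * (D' (i b) - i (D b)) + i b * (D' (i a) - i (D a))
      rw [map_mul, Derivation.leib', Derivation.leib', map_add, map_mul, map_mul]; ring
    · intro c
      change D' (i (algebraMap k K c)) - i (D (algebraMap k K c)) = 0
      rw [AlgHom.commutes]; simp
    · intro _
      change D' (i (ξ 0)) - i (D (ξ 0)) = 0
      rw [h, hD ()]; simp
  exact ⟨K, iK, aK, E, iE, aE, ξ, ia, ib, τ, D, Da, Db, hZ, hg, hη ▸ hE, hτa, hτb, hD (), gen1 Da ia e1,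
    gen0 Da ib e2, gen0 Db ia e3, gen1 Db ib e4, hind, halg⟩

end S19

namespace S19
set_option linter.unusedSectionVars false

section
variable {k K E : Type} [Field k] [IsAlgClosed k] [CharZero k] [Field K] [Algebra k K] [Field E] [Algebra k E]
  {Z : Set (Fin 3 → k)} {ξ : Fin 3 → K} {ia ib : K →ₐ[k] E} {τ : E →ₐ[k] E} {D : Derivation k K K}
    {Da Db : Derivation k E E}

theorem Pair.Dker (h : Pair Z ξ ia ib τ D Da Db) (r : K) (hr : D r = 0) : ∃ c, r = algebraMap k K c := by
  by_contra hc
  push Not at hc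
  have h1 := D_zero_of (AlgebraicIndependent_unit hc) (RingHom.id K) ((D : K →ₗ[k] K).toAddMonoidHom)
    (fun a b => Derivation.leib' D a b) (fun c => D.map_algebraMap c) (fun _ => hr) (ξ 0)
    (EXCH (AlgebraicIndependent_unit (h.hZ.nc0 h.hg)) (h.hZ.alg0 h.hg) (AlgebraicIndependent_unit hc) le_rfl _)
  have h2 : D (ξ 0) = 0 := h1
  rw [h.D0] at h2
  exact one_ne_zero h2

theorem Pair.Fc (h : Pair Z ξ ia ib τ D Da Db) (r r' : K) (e : ia r = ib r') : ∃ c, r = algebraMap k K c := by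
  apply h.Dker
  apply (map_eq_zero ia).1
  rw [← h.Daa, e, h.Dab]

/-- slope functions -/
def SS (ξ : Fin 3 → K) (ia ib : K →ₐ[k] E) (i : Fin 3) : E :=
  (ia (ξ i) - ib (ξ i)) / (ia (ξ 0) - ib (ξ 0))

theorem Pair.Xne (h : Pair Z ξ ia ib τ D Da Db) : ia (ξ 0) - ib (ξ 0) ≠ 0 := by
  intro h0
  have := congrArg Da h0
  rw [map_sub, h.Daa, h.Dab, h.D0] at this
  simp at this

theorem Pair.lin2 (h : Pair Z ξ ia ib τ D Da Db) (r : K) (hr : D (D r) = 0) :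
    ∃ e0 e1 : k, algebraMap k K e0 + algebraMap k K e1 * ξ 0 = r := by
  obtain ⟨c, hc⟩ := h.Dker _ hr
  obtain ⟨c', hc'⟩ := h.Dker (r - algebraMap k K c * ξ 0) (by
    rw [map_sub, hc, Derivation.leib', h.D0, D.map_algebraMap]; simp)
  exact ⟨c', c, by rw [← hc']; ring⟩

theorem Pair.y2 (h : Pair Z ξ ia ib τ D Da Db) : D (D (ξ 1)) ≠ 0 := by
  intro h0
  obtain ⟨e0, e1, he⟩ := h.lin2 _ h0
  have := h.hZ.plane h.hg e0 e1 (-1) 0 (by rw [← he]; simp)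
  simp at this

theorem Pair.z2 (h : Pair Z ξ ia ib τ D Da Db) : D (D (ξ 2)) ≠ 0 := by
  intro h0
  obtain ⟨e0, e1, he⟩ := h.lin2 _ h0
  have := h.hZ.plane h.hg e0 e1 0 (-1) (by rw [← he]; simp)
  simp at this

theorem Pair.Une' (h : Pair Z ξ ia ib τ D Da Db) (i : Fin 3) (hi : D (D (ξ i)) ≠ 0) : SS ξ ia ib i - ib (D (ξ i)) ≠ 0 := by
  intro h0
  have h1 : ia (ξ i) - ib (ξ i) = ib (D (ξ i)) * (ia (ξ 0) - ib (ξ 0)) := by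
    have hX := h.Xne
    rw [sub_eq_zero, SS, div_eq_iff hX] at h0
    exact h0
  have h2 := congrArg Da h1
  rw [Derivation.leib', map_sub, map_sub, h.Daa, h.Daa, h.Dab, h.Dab, h.Dab, h.D0] at h2
  obtain ⟨c, hc⟩ := h.Fc (D (ξ i)) (D (ξ i)) (by simpa using h2)
  apply hi
  rw [hc, D.map_algebraMap]

theorem Pair.Une (h : Pair Z ξ ia ib τ D Da Db) : SS ξ ia ib 1 - ib (D (ξ 1)) ≠ 0 := h.Une' 1 h.y2

theorem Pair.A0 (h : Pair Z ξ ia ib τ D Da Db) : AlgebraicIndependent k ![SS ξ ia ib 1, SS ξ ia ib 2] := by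
  by_contra hcon
  have hX := h.Xne
  have hU := h.Une
  set s := SS ξ ia ib 1 with hs
  set t := SS ξ ia ib 2 with ht
  set X := ia (ξ 0) - ib (ξ 0) with hXd
  have hY : ia (ξ 1) - ib (ξ 1) = s * X := by rw [hs, SS, div_mul_cancel₀]; exact hX
  have hW : ia (ξ 2) - ib (ξ 2) = t * X := by rw [ht, SS, div_mul_cancel₀]; exact hX
  have dX : Da X = 1 := by rw [hXd, map_sub, h.Daa, h.Dab, h.D0]; simp
  have dX' : Db X = -1 := by rw [hXd, map_sub, h.Dbb, h.Dba, h.D0]; simp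
  have y1 := congrArg Da hY
  have y2 := congrArg Db hY
  have z1 := congrArg Da hW
  have z2 := congrArg Db hW
  rw [Derivation.leib', map_sub, h.Daa, h.Dab, dX] at y1 z1
  rw [Derivation.leib', map_sub, h.Dbb, h.Dba, dX'] at y2 z2
  have hsk : ∀ c : k, s ≠ algebraMap k E c := by
    intro c hc
    have : Db s = 0 := by rw [hc, Db.map_algebraMap]
    apply hU
    rw [this] at y2
    linear_combination y2
  have halg := algOver_of_not_indep hsk hcon
  let δ : Derivation k E E := Db s • Da - Da s • Db
  have hδ : ∀ r, δ r = Db s * Da r - Da s * Db r := fun r => rfl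
  have hδt : δ t = 0 := by
    refine D_zero_of (AlgebraicIndependent_unit hsk) (RingHom.id E) ((δ : E →ₗ[k] E).toAddMonoidHom)
      (fun a b => Derivation.leib' δ a b) (fun c => δ.map_algebraMap c) (fun _ => ?_) t halg
    change δ s = 0
    rw [hδ]; ring
  rw [hδ] at hδt
  have key : (s - ib (D (ξ 1))) * (ia (D (ξ 2)) - ib (D (ξ 2))) = (t - ib (D (ξ 2))) * (ia (D (ξ 1)) - ib (D (ξ 1))) := by
    have e1 : X * Da s = ia (D (ξ 1)) - s := by linear_combination -y1
    have e2 : X * Db s = s - ib (D (ξ 1)) := by linear_combination -y2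
    have e3 : X * Da t = ia (D (ξ 2)) - t := by linear_combination -z1
    have e4 : X * Db t = t - ib (D (ξ 2)) := by linear_combination -z2
    have : (s - ib (D (ξ 1))) * (ia (D (ξ 2)) - t) = (ia (D (ξ 1)) - s) * (t - ib (D (ξ 2))) := by
      rw [← e1, ← e2, ← e3, ← e4]; linear_combination X^2 * hδt
    linear_combination this
  set r := (t - ib (D (ξ 2))) / (s - ib (D (ξ 1))) with hr
  have hrU : t - ib (D (ξ 2)) = r * (s - ib (D (ξ 1))) := by rw [hr, div_mul_cancel₀ _ hU]
  have k2 : ia (D (ξ 2)) - ib (D (ξ 2)) = r * (ia (D (ξ 1)) - ib (D (ξ 1))) := by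
    apply mul_left_cancel₀ hU
    rw [key, hrU]; ring
  have hDr : Da r = 0 := by
    have e1 := congrArg Da hrU
    rw [Derivation.leib', map_sub, map_sub, h.Dab, h.Dab] at e1
    have : X * (s - ib (D (ξ 1))) * Da r = 0 := by
      linear_combination k2 - z1 + r * y1 - X * e1 - hrU
    rcases mul_eq_zero.1 this with h0 | h0
    · exact absurd h0 (mul_ne_zero hX hU)
    · exact h0
  have k3 := congrArg Da k2
  rw [Derivation.leib', map_sub, map_sub, h.Dab, h.Dab, h.Daa, h.Daa, hDr] at k3
  have hy2 := h.y2
  have hr2 : r = ia (D (D (ξ 2)) / D (D (ξ 1))) := by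
    rw [map_div₀, eq_div_iff ((map_ne_zero ia).2 hy2)]
    linear_combination -k3
  obtain ⟨c, hc⟩ := h.Dker (D (D (ξ 2)) / D (D (ξ 1))) (by
    apply (map_eq_zero ia).1
    rw [← h.Daa, ← hr2, hDr])
  rw [div_eq_iff hy2] at hc
  obtain ⟨e0, e1, he⟩ := h.lin2 (ξ 2 - algebraMap k K c * ξ 1) (by
    simp only [map_sub, Derivation.leib', D.map_algebraMap, map_add, map_mul, mul_zero, add_zero, hc, sub_self])
  have := h.hZ.plane h.hg e0 e1 c (-1) (by
    simp only [map_neg, map_one]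
    linear_combination he)
  simp at this

theorem Pair.algST (h : Pair Z ξ ia ib τ D Da Db) (r : E) : AlgOver k ![SS ξ ia ib 1, SS ξ ia ib 2] r :=
  EXCH h.ind h.alg h.A0 le_rfl r

end
end S19

namespace S19
set_option linter.unusedSectionVars false

/-- `s0, t0` are the slopes of the pair `a, b` -/
def Slp {k : Type} [Field k] (a b : Fin 3 → k) (s0 t0 : k) : Prop :=
  a 0 ≠ b 0 ∧ a 1 - b 1 = s0 * (a 0 - b 0) ∧ a 2 - b 2 = t0 * (a 0 - b 0)

theorem uni_cof {k : Type} [Field k] [CharZero k] (p : Polynomial k) (hp : p ≠ 0) :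
    ∀ᶠ s : ℚ in Filter.cofinite, p.eval (s : k) ≠ 0 := by
  have hinj : Function.Injective (fun s : ℚ => (s : k)) := Rat.cast_injective
  have h1 : ∀ᶠ s : k in Filter.cofinite, p.eval s ≠ 0 := by
    rw [Filter.eventually_cofinite]
    simp only [not_not]
    exact Polynomial.finite_setOfPred_isRoot hp
  exact hinj.tendsto_cofinite.eventually h1

theorem gen_ne {k : Type} [Field k] [CharZero k] (N : MvPolynomial (Fin 2) k) (hN : N ≠ 0) :
    ∀ᶠ s : ℚ in Filter.cofinite, ∀ᶠ t : ℚ in Filter.cofinite, eval ![(s : k), (t : k)] N ≠ 0 := by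
  have hinf : Infinite k := CharZero.infinite k
  obtain ⟨c, hc⟩ : ∃ c, eval c N ≠ 0 := by
    by_contra h
    push Not at h
    exact hN (MvPolynomial.funext (by simpa using h))
  have e1 : ∀ s t : k, (aeval ![Polynomial.X, Polynomial.C t] N : Polynomial k).eval s = eval ![s, t] N := by
    intro s t
    change ((Polynomial.evalRingHom s).comp (aeval ![Polynomial.X, Polynomial.C t] : MvPolynomial (Fin 2) k →ₐ[k] Polynomial k).toRingHom) N = _
    congr 1
    ext i
    · simp
    · fin_cases i <;> simp
  have e2 : ∀ s t : k, (aeval ![Polynomial.C s, Polynomial.X] N : Polynomial k).eval t = eval ![s, t] N := by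
    intro s t
    change ((Polynomial.evalRingHom t).comp (aeval ![Polynomial.C s, Polynomial.X] : MvPolynomial (Fin 2) k →ₐ[k] Polynomial k).toRingHom) N = _
    congr 1
    ext i
    · simp
    · fin_cases i <;> simp
  have hcc : c = ![c 0, c 1] := by funext i; fin_cases i <;> rfl
  have h1 := uni_cof (aeval ![Polynomial.X, Polynomial.C (c 1)] N) (by
    intro h
    have := e1 (c 0) (c 1)
    rw [h, ← hcc] at this
    exact hc (by simpa using this.symm))
  filter_upwards [h1] with s hs
  rw [e1] at hs
  have h2 := uni_cof (aeval ![Polynomial.C (s : k), Polynomial.X] N) (by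
    intro h
    have := e2 s (c 1)
    rw [h] at this
    exact hs (by simpa using this.symm))
  filter_upwards [h2] with t ht
  rwa [e2] at ht

section
variable {k K E : Type} [Field k] [IsAlgClosed k] [CharZero k] [Field K] [Algebra k K] [Field E] [Algebra k E]
  {Z : Set (Fin 3 → k)} {ξ : Fin 3 → K} {ia ib : K →ₐ[k] E} {τ : E →ₐ[k] E} {D : Derivation k K K}
    {Da Db : Derivation k E E}

/-- the generic tuple -/
def TH (ξ : Fin 3 → K) (ia ib : K →ₐ[k] E) : (Fin 3 ⊕ Fin 3) ⊕ Fin 2 → E :=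
  Sum.elim (Sum.elim (fun i => ia (ξ i)) (fun i => ib (ξ i))) ![SS ξ ia ib 1, SS ξ ia ib 2]

/-- a special tuple -/
def th (a b : Fin 3 → k) (s t : k) : (Fin 3 ⊕ Fin 3) ⊕ Fin 2 → k := Sum.elim (Sum.elim a b) ![s, t]

theorem Pair.ss (h : Pair Z ξ ia ib τ D Da Db) (i : Fin 3) :
    ia (ξ i) - ib (ξ i) = SS ξ ia ib i * (ia (ξ 0) - ib (ξ 0)) := by
  rw [SS, div_mul_cancel₀ _ h.Xne]

theorem Pair.spec (h : Pair Z ξ ia ib τ D Da Db) {a b : Fin 3 → k} (ha : a ∈ Z) (hb : b ∈ Z) {s0 t0 : k}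
    (hs : Slp a b s0 t0) (F : MvPolynomial ((Fin 3 ⊕ Fin 3) ⊕ Fin 2) k) (hF : aeval (TH ξ ia ib) F = 0) :
    eval (th a b s0 t0) F = 0 := by
  obtain ⟨V, hV, hc⟩ := exists_V (k := k) (Sum.elim (fun i => ia (ξ i)) (fun i => ib (ξ i))) (Sum.elim a b)
    (fun F hF => (h.hE.rel F).1 hF _ ⟨ha, hb⟩)
  have hca : ∀ i, Cong V (ia (ξ i)) (a i) := fun i => hc (Sum.inl i)
  have hcb : ∀ i, Cong V (ib (ξ i)) (b i) := fun i => hc (Sum.inr i)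
  have hX := ((hca 0).sub (hcb 0)).val_eq_one hV (sub_ne_zero.2 hs.1)
  have key : ∀ i (u : k), a i - b i = u * (a 0 - b 0) → Cong V (SS ξ ia ib i) u := by
    intro i u hu
    have h1 := ((hca i).sub (hcb i)).sub ((Cong.const u).mul hV ((hca 0).sub (hcb 0)))
    rw [hu, sub_self, cong_zero, h.ss, ← sub_mul, map_mul, hX, mul_one] at h1
    exact h1
  refine Cong.rel hV (w := TH ξ ia ib) ?_ hF
  rintro ((i | i) | i)
  · exact hca i
  · exact hcb i
  · fin_cases i
    · exact key 1 s0 hs.2.1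
    · exact key 2 t0 hs.2.2

/-- a tuple satisfying all relations is a pair with slopes -/
theorem Pair.unspec (h : Pair Z ξ ia ib τ D Da Db) (c : (Fin 3 ⊕ Fin 3) ⊕ Fin 2 → k)
    (hc : ∀ F, aeval (TH ξ ia ib) F = 0 → eval c F = 0) (hne : c (Sum.inl (Sum.inl 0)) ≠ c (Sum.inl (Sum.inr 0))) :
    (fun i => c (Sum.inl (Sum.inl i))) ∈ Z ∧ (fun i => c (Sum.inl (Sum.inr i))) ∈ Z ∧
      Slp (fun i => c (Sum.inl (Sum.inl i))) (fun i => c (Sum.inl (Sum.inr i))) (c (Sum.inr 0)) (c (Sum.inr 1)) ∧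
      c = th (fun i => c (Sum.inl (Sum.inl i))) (fun i => c (Sum.inl (Sum.inr i))) (c (Sum.inr 0)) (c (Sum.inr 1)) := by
  refine ⟨h.hZ.mem_of_rel h.hg _ fun F hF => ?_, h.hZ.mem_of_rel h.hg _ fun F hF => ?_, ⟨hne, ?_, ?_⟩, ?_⟩
  · have := hc (rename (fun i => Sum.inl (Sum.inl i)) F) (by
      rw [aeval_rename]
      have := congrArg ia hF
      rw [map_zero, MvPolynomial.comp_aeval_apply] at this
      exact this)
    rwa [eval_rename] at this
  · have := hc (rename (fun i => Sum.inl (Sum.inr i)) F) (by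
      rw [aeval_rename]
      have := congrArg ib hF
      rw [map_zero, MvPolynomial.comp_aeval_apply] at this
      exact this)
    rwa [eval_rename] at this
  · have := hc (X (Sum.inl (Sum.inl 1)) - X (Sum.inl (Sum.inr 1)) - X (Sum.inr 0) * (X (Sum.inl (Sum.inl 0)) - X (Sum.inl (Sum.inr 0)))) (by
      simp only [map_sub, map_mul, aeval_X]
      exact sub_eq_zero.2 (h.ss 1))
    simp only [map_sub, map_mul, eval_X] at this
    linear_combination this
  · have := hc (X (Sum.inl (Sum.inl 2)) - X (Sum.inl (Sum.inr 2)) - X (Sum.inr 1) * (X (Sum.inl (Sum.inl 0)) - X (Sum.inl (Sum.inr 0)))) (by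
      simp only [map_sub, map_mul, aeval_X]
      exact sub_eq_zero.2 (h.ss 2))
    simp only [map_sub, map_mul, eval_X] at this
    linear_combination this
  · funext i
    rcases i with (i | i) | i
    · rfl
    · rfl
    · fin_cases i <;> rfl

theorem Pair.A2 (h : Pair Z ξ ia ib τ D Da Db) : ∀ᶠ s : ℚ in Filter.cofinite, ∀ᶠ t : ℚ in Filter.cofinite,
    ∃ a ∈ Z, ∃ b ∈ Z, Slp a b (s : k) (t : k) := by
  let v : (Fin 3 ⊕ Fin 3) ⊕ Unit → E := Sum.elim (Sum.elim (fun i => ia (ξ i)) (fun i => ib (ξ i))) (fun _ => (ia (ξ 0) - ib (ξ 0))⁻¹)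
  obtain ⟨N, hN, hL⟩ := LIFT (σ := (Fin 3 ⊕ Fin 3) ⊕ Unit) _ h.A0 v (fun i => h.algST _)
  filter_upwards [gen_ne N hN] with s hs
  filter_upwards [hs] with t ht
  obtain ⟨c, hc⟩ := hL _ ht
  let ρ : (Fin 3 ⊕ Fin 3) ⊕ Fin 2 → ((Fin 3 ⊕ Fin 3) ⊕ Unit) ⊕ Fin 2 := Sum.elim (fun i => Sum.inl (Sum.inl i)) Sum.inr
  have hρ : Sum.elim v ![SS ξ ia ib 1, SS ξ ia ib 2] ∘ ρ = TH ξ ia ib := by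
    funext i; rcases i with (i | i) | i <;> rfl
  have h1 := h.unspec (Sum.elim c ![(s : k), (t : k)] ∘ ρ) (fun F hF => by
    have := hc (rename ρ F) (by rw [aeval_rename, hρ, hF])
    rwa [eval_rename] at this) (by
    intro h0
    have := hc ((X (Sum.inl (Sum.inl (Sum.inl 0))) - X (Sum.inl (Sum.inl (Sum.inr 0)))) * X (Sum.inl (Sum.inr ())) - 1) (by
      simp [v, mul_inv_cancel₀ h.Xne])
    have h0' : c (Sum.inl (Sum.inl 0)) = c (Sum.inl (Sum.inr 0)) := h0
    simp [h0'] at this)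
  exact ⟨_, h1.1, _, h1.2.1, h1.2.2.1⟩

theorem alg_flip {r : E} (hr : r ≠ 0) {w : Fin 2 → E} (h : AlgOver k w r) :
    ∃ N : MvPolynomial (Fin 2) k, N ≠ 0 ∧ ∃ F : MvPolynomial (Fin 2 ⊕ Unit) k,
      aeval w N = r * aeval (Sum.elim w (fun _ => r)) F := by
  classical
  obtain ⟨P, hP, hPr⟩ := h
  -- strip powers of the variable
  obtain ⟨P', n, hP', hPP⟩ : ∃ P' : Polynomial (MvPolynomial (Fin 2) k), ∃ n : ℕ, P'.coeff 0 ≠ 0 ∧ P = P' * Polynomial.X ^ n := by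
    obtain ⟨Q, hQ, hQ2⟩ := (Polynomial.finiteMultiplicity_X_sub_C 0 hP).exists_eq_pow_mul_and_not_dvd
    rw [map_zero, sub_zero] at hQ hQ2
    exact ⟨Q, _, fun h0 => hQ2 (Polynomial.X_dvd_iff.2 h0), by rw [mul_comm]; exact hQ⟩
  have h0 : Polynomial.eval₂ (aevR k w) r P' = 0 := by
    rw [hPP, Polynomial.eval₂_mul, Polynomial.eval₂_X_pow] at hPr
    rcases mul_eq_zero.1 hPr with h | h
    · exact h
    · exact absurd h (pow_ne_zero _ hr)
  rw [← Polynomial.divX_mul_X_add P', Polynomial.eval₂_add, Polynomial.eval₂_mul, Polynomial.eval₂_X, Polynomial.eval₂_C] at h0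
  refine ⟨P'.coeff 0, hP', Polynomial.eval₂ (rename Sum.inl : MvPolynomial (Fin 2) k →ₐ[k] MvPolynomial (Fin 2 ⊕ Unit) k).toRingHom (- X (Sum.inr ())) 0 - 
    Polynomial.eval₂ (rename Sum.inl : MvPolynomial (Fin 2) k →ₐ[k] MvPolynomial (Fin 2 ⊕ Unit) k).toRingHom (X (Sum.inr ())) P'.divX, ?_⟩
  have e : aeval (Sum.elim w (fun _ : Unit => r)) (Polynomial.eval₂ (rename Sum.inl : MvPolynomial (Fin 2) k →ₐ[k] MvPolynomial (Fin 2 ⊕ Unit) k).toRingHom (X (Sum.inr ())) P'.divX) = Polynomial.eval₂ (aevR k w) r P'.divX := by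
    change (aeval (Sum.elim w (fun _ : Unit => r)) : MvPolynomial (Fin 2 ⊕ Unit) k →ₐ[k] E).toRingHom _ = _
    rw [Polynomial.hom_eval₂]
    congr 1
    · ext i <;> simp [aevR]
    · simp
  rw [map_sub, e]
  have e3 : aevR k w (P'.coeff 0) = aeval w (P'.coeff 0) := rfl
  rw [e3] at h0
  simp only [Polynomial.eval₂_zero, map_zero]
  linear_combination h0

theorem Pair.density (h : Pair Z ξ ia ib τ D Da Db) (F : MvPolynomial ((Fin 3 ⊕ Fin 3) ⊕ Fin 2) k)
    (hF : ∃ᶠ s : ℚ in Filter.cofinite, ∃ᶠ t : ℚ in Filter.cofinite, ∃ a ∈ Z, ∃ b ∈ Z, Slp a b (s : k) (t : k) ∧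
      eval (th a b (s : k) (t : k)) F = 0) : aeval (TH ξ ia ib) F = 0 := by
  by_contra hne
  obtain ⟨N, hN, G, hG⟩ := alg_flip hne (h.algST _)
  have h2 := gen_ne N hN
  apply hF
  filter_upwards [h2] with s hs
  rw [Filter.not_frequently]
  filter_upwards [hs] with t ht
  rintro ⟨a, ha, b, hb, hsl, h0⟩
  apply ht
  have := h.spec ha hb hsl (rename Sum.inr N - F * aeval (Sum.elim (fun i => X (Sum.inr i)) (fun _ => F)) G) (by
    rw [map_sub, map_mul, aeval_rename, sub_eq_zero]
    have e1 : TH ξ ia ib ∘ Sum.inr = ![SS ξ ia ib 1, SS ξ ia ib 2] := rfl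
    rw [e1, hG, MvPolynomial.comp_aeval_apply]
    congr 3
    funext i
    rcases i with i | i
    · simp [TH]
    · rfl)
  rw [map_sub, map_mul, h0, zero_mul, sub_zero, eval_rename] at this
  exact this

theorem Pair.A1 (h : Pair Z ξ ia ib τ D Da Db) : ∀ᶠ s : ℚ in Filter.cofinite, ∀ᶠ t : ℚ in Filter.cofinite,
    {p : (Fin 3 → k) × (Fin 3 → k) | p.1 ∈ Z ∧ p.2 ∈ Z ∧ Slp p.1 p.2 (s : k) (t : k)}.Finite := by
  choose P hP hPr using fun i : Fin 3 ⊕ Fin 3 => h.algST (TH ξ ia ib (Sum.inl i))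
  have hN : ∏ i, (P i).leadingCoeff ≠ 0 := Finset.prod_ne_zero_iff.2 fun i _ => Polynomial.leadingCoeff_ne_zero.2 (hP i)
  filter_upwards [gen_ne _ hN] with s hs
  filter_upwards [hs] with t ht
  rw [map_prod, Finset.prod_ne_zero_iff] at ht
  let f : ∀ i, Polynomial k := fun i => (P i).map (eval ![(s : k), (t : k)])
  have hf : ∀ i, f i ≠ 0 := by
    intro i h0
    have := congrArg (fun q => Polynomial.coeff q (P i).natDegree) h0
    simp only [f, Polynomial.coeff_map, Polynomial.coeff_zero] at this
    exact ht i (Finset.mem_univ _) this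
  have hfin : (Set.pi Set.univ (fun i : Fin 3 ⊕ Fin 3 => {c | (f i).IsRoot c})).Finite :=
    Set.Finite.pi fun i => Polynomial.finite_setOfPred_isRoot (hf i)
  refine Set.Finite.subset (hfin.image (fun c => ((fun i => c (Sum.inl i)), (fun i => c (Sum.inr i))))) ?_
  rintro ⟨a, b⟩ ⟨ha, hb, hsl⟩
  refine ⟨Sum.elim a b, ?_, rfl⟩
  intro i _
  have := h.spec ha hb hsl (Polynomial.eval₂ (rename Sum.inr : MvPolynomial (Fin 2) k →ₐ[k] MvPolynomial ((Fin 3 ⊕ Fin 3) ⊕ Fin 2) k).toRingHom (X (Sum.inl i)) (P i)) (by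
    change (aeval (TH ξ ia ib) : _ →ₐ[k] E).toRingHom _ = 0
    rw [Polynomial.hom_eval₂, ← hPr i]
    congr 1
    · ext i <;> simp [aevR, TH]
    · simp)
  rw [Polynomial.hom_eval₂] at this
  change Polynomial.eval _ _ = 0
  simp only [f]
  rw [Polynomial.eval_map]
  convert this using 2
  · ext i <;> simp [th]
  · rcases i with i | i <;> simp [th]

end
end S19

namespace S19
set_option linter.unusedSectionVars false

section
variable {k : Type} [Field k] [CharZero k]

/-- rational bivariate polynomials as multivariate polynomials -/
def kap (k : Type) [Field k] [CharZero k] : Polynomial (Polynomial ℚ) →+* MvPolynomial (Fin 2) k :=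
  Polynomial.eval₂RingHom (Polynomial.eval₂RingHom (C.comp (Rat.castHom k)) (X 0)) (X 1)

theorem kap_eval (s t : ℚ) (N : Polynomial (Polynomial ℚ)) :
    eval ![(s : k), (t : k)] (kap k N) = ((N.evalEval s t : ℚ) : k) := by
  change ((eval ![(s : k), (t : k)]).comp (kap k)) N = ((Rat.castHom k).comp (Polynomial.evalEvalRingHom s t)) N
  congr 1
  ext <;> simp [kap]

theorem kap_inj (N : Polynomial (Polynomial ℚ)) (h : kap k N = 0) : N = 0 := by
  have h1 : ∀ s t : ℚ, N.evalEval s t = 0 := by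
    intro s t
    have := kap_eval (k := k) s t N
    rw [h, map_zero] at this
    exact_mod_cast this.symm
  apply Polynomial.eq_zero_of_infinite_isRoot
  refine Set.Infinite.mono (s := Set.range (fun t : ℚ => Polynomial.C t)) ?_ ?_
  · rintro _ ⟨t, rfl⟩
    change N.eval (Polynomial.C t) = 0
    apply Polynomial.funext
    intro s
    simpa using h1 s t
  · exact Set.infinite_range_of_injective Polynomial.C_injective

end

theorem alg_desc {k E : Type} [Field k] [CharZero k] [Field E] [Algebra k E]
    (hQ : ∀ c : k, ∃ p : Polynomial ℚ, p ≠ 0 ∧ p.eval₂ (Rat.castHom k) c = 0) {w : Fin 2 → E}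
    (hw : AlgebraicIndependent k w) (r : E) (h : AlgOver k w r) :
    ∃ P : Polynomial (Polynomial (Polynomial ℚ)), P ≠ 0 ∧ 
      P.eval₂ (((aeval w : MvPolynomial (Fin 2) k →ₐ[k] E) : MvPolynomial (Fin 2) k →+* E).comp (kap k)) r = 0 := by
  set f := ((aeval w : MvPolynomial (Fin 2) k →ₐ[k] E) : MvPolynomial (Fin 2) k →+* E).comp (kap k) with hf
  let : Algebra (Polynomial (Polynomial ℚ)) E := f.toAlgebra
  suffices IsAlgebraic (Polynomial (Polynomial ℚ)) r from this
  let M := Subalgebra.algebraicClosure (Polynomial (Polynomial ℚ)) E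
  have hM : ∀ x, x ∈ M ↔ IsAlgebraic (Polynomial (Polynomial ℚ)) x := fun x => Iff.rfl
  have hk : ∀ c : k, algebraMap k E c ∈ M := by
    intro c
    obtain ⟨p, hp, hpc⟩ := hQ c
    refine ⟨p.map (Polynomial.C.comp Polynomial.C), ?_, ?_⟩
    · rw [Ne, Polynomial.map_eq_zero_iff]
      · exact hp
      · exact Polynomial.C_injective.comp Polynomial.C_injective
    · rw [Polynomial.aeval_def, Polynomial.eval₂_map]
      have := congrArg (algebraMap k E) hpc
      rw [map_zero, Polynomial.hom_eval₂] at this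
      rw [← this]
      congr 1
      refine RingHom.ext fun x => ?_
      change f (Polynomial.C (Polynomial.C x)) = algebraMap k E (x : k)
      simp [hf, kap]
  have hwM : ∀ i, w i ∈ M := by
    intro i
    have h2 : ∃ N, f N = w i := by
      fin_cases i
      · exact ⟨Polynomial.C Polynomial.X, by simp [hf, kap]⟩
      · exact ⟨Polynomial.X, by simp [hf, kap]⟩
    obtain ⟨N, hN⟩ := h2
    rw [← hN]
    exact isAlgebraic_algebraMap (A := E) N
  have hall : ∀ F : MvPolynomial (Fin 2) k, aevR k w F ∈ M := by
    intro F
    change aeval w F ∈ M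
    induction F using MvPolynomial.induction_on with
    | C a => simpa using hk a
    | add p q hp hq => rw [map_add]; exact M.add_mem hp hq
    | mul_X p i hp => rw [map_mul, aeval_X]; exact M.mul_mem hp (hwM i)
  let g : MvPolynomial (Fin 2) k →+* M := (aevR k w).codRestrict M hall
  have hg : Function.Injective g := by
    intro a b hab
    have : aevR k w a = aevR k w b := congrArg Subtype.val hab
    exact hw this
  obtain ⟨F, hF, hFr⟩ := h
  have h1 : IsAlgebraic M r := by
    refine ⟨F.map g, ?_, ?_⟩
    · rwa [Ne, Polynomial.map_eq_zero_iff hg]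
    · rw [Polynomial.aeval_def, Polynomial.eval₂_map, ← hFr]
      congr 1
  have : Algebra.IsAlgebraic (Polynomial (Polynomial ℚ)) M := ⟨fun x => by
    have := (hM x.1).1 x.2
    exact (isAlgebraic_algebraMap_iff (S := M) (A := E) (a := x) Subtype.val_injective).1 this⟩
  exact h1.restrictScalars _

section
variable {k K E : Type} [Field k] [IsAlgClosed k] [CharZero k] [Field K] [Algebra k K] [Field E] [Algebra k E]
  {Z : Set (Fin 3 → k)} {ξ : Fin 3 → K} {ia ib : K →ₐ[k] E} {τ : E →ₐ[k] E} {D : Derivation k K K}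
    {Da Db : Derivation k E E}

/-- the four rational functions -/
def Yp (k : Type) [Field k] : Fin 4 → MvPolynomial ((Fin 3 ⊕ Fin 3) ⊕ Fin 2) k :=
  ![X (.inl (.inl 0)) + X (.inl (.inr 0)), X (.inl (.inl 0)) * X (.inl (.inr 0)),
    X (.inl (.inl 1)) - X (.inr 0) * X (.inl (.inl 0)), X (.inl (.inl 2)) - X (.inr 1) * X (.inl (.inl 0))]

theorem Pair.hilb (h : Pair Z ξ ia ib τ D Da Db)
    (hQ : ∀ c : k, ∃ p : Polynomial ℚ, p ≠ 0 ∧ p.eval₂ (Rat.castHom k) c = 0)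
    (hR : ∀ᶠ s : ℚ in Filter.cofinite, ∀ᶠ t : ℚ in Filter.cofinite, ∃ a ∈ Z, ∃ b ∈ Z, Slp a b (s : k) (t : k) ∧ 
      ∃ y : Fin 4 → ℚ, ∀ j, eval (th a b (s : k) (t : k)) (Yp k j) = (y j : k)) :
    ∃ ℓ g : Fin 4 → MvPolynomial (Fin 2) k, (∀ j, ℓ j ≠ 0) ∧ ∀ j,
      aeval ![SS ξ ia ib 1, SS ξ ia ib 2] (ℓ j) * aeval (TH ξ ia ib) (Yp k j) = aeval ![SS ξ ia ib 1, SS ξ ia ib 2] (g j) := by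
  choose P0 hP0 hP0r using fun j => alg_desc hQ h.A0 _ (h.algST (aeval (TH ξ ia ib) (Yp k j)))
  let P := fun j => P0 j * Polynomial.X
  have hP : ∀ j, P j ≠ 0 := fun j => mul_ne_zero (hP0 j) Polynomial.X_ne_zero
  have hdeg : ∀ j, 1 ≤ (P j).natDegree := by
    intro j
    simp only [P]
    rw [Polynomial.natDegree_mul_X (hP0 j)]; omega
  have hPr : ∀ j, (P j).eval₂ (((aeval ![SS ξ ia ib 1, SS ξ ia ib 2] : MvPolynomial (Fin 2) k →ₐ[k] E) : MvPolynomial (Fin 2) k →+* E).comp (kap k)) (aeval (TH ξ ia ib) (Yp k j)) = 0 := by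
    intro j; simp only [P]; rw [Polynomial.eval₂_mul, hP0r, zero_mul]
  let rn : MvPolynomial (Fin 2) k →+* MvPolynomial ((Fin 3 ⊕ Fin 3) ⊕ Fin 2) k := (rename Sum.inr : MvPolynomial (Fin 2) k →ₐ[k] MvPolynomial ((Fin 3 ⊕ Fin 3) ⊕ Fin 2) k).toRingHom
  have rn1 : ∀ N, aeval (TH ξ ia ib) (rn N) = aeval ![SS ξ ia ib 1, SS ξ ia ib 2] N := by
    intro N
    exact aeval_rename _ _ _
  have rn2 : ∀ N a b (s t : k), eval (th a b s t) (rn N) = eval ![s, t] N := by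
    intro N a b s t
    exact eval_rename _ _ _
  let R : ℚ → ℚ → (Fin 4 → ℚ) → Prop := fun s t y => ∃ a ∈ Z, ∃ b ∈ Z, Slp a b (s : k) (t : k) ∧
    ∀ j, (y j : k) = (((P j).leadingCoeff.evalEval s t : ℚ) : k) * eval (th a b (s : k) (t : k)) (Yp k j)
  obtain ⟨g, hg⟩ := WH2 (fun j => (P j).integralNormalization) (fun j => Polynomial.monic_integralNormalization (hP j)) R (by
    filter_upwards [hR] with s hs
    filter_upwards [hs] with t ht
    obtain ⟨a, ha, b, hb, hsl, y, hy⟩ := ht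
    refine ⟨fun j => (P j).leadingCoeff.evalEval s t * y j, ⟨a, ha, b, hb, hsl, fun j => by rw [hy]; push_cast; rfl⟩, fun j => ?_⟩
    rw [Polynomial.eval_map]
    have := Polynomial.integralNormalization_eval₂_leadingCoeff_mul (hdeg j) (Polynomial.evalEvalRingHom s t) (y j)
    change Polynomial.eval₂ _ ((Polynomial.evalEvalRingHom s t) (P j).leadingCoeff * y j) _ = 0
    rw [this]
    have h3 := h.spec ha hb hsl ((P j).eval₂ (rn.comp (kap k)) (Yp k j)) (by
      have := hPr j
      change (aeval (TH ξ ia ib) : _ →ₐ[k] E).toRingHom _ = 0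
      rw [Polynomial.hom_eval₂, ← this]
      congr 1
      refine RingHom.ext fun N => ?_
      exact rn1 _)
    have h4 : ((Polynomial.eval₂ (Polynomial.evalEvalRingHom s t) (y j) (P j) : ℚ) : k) = 0 := by
      rw [← h3, Polynomial.hom_eval₂, hy]
      change Rat.castHom k _ = _
      rw [Polynomial.hom_eval₂]
      congr 1
      refine RingHom.ext fun N => ?_
      change _ = eval (th a b (s : k) (t : k)) (rn (kap k N))
      rw [rn2, kap_eval]
      rfl
    have h5 : Polynomial.eval₂ (Polynomial.evalEvalRingHom s t) (y j) (P j) = 0 := by exact_mod_cast h4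
    rw [h5, mul_zero])
  refine ⟨fun j => kap k (P j).leadingCoeff, fun j => kap k (g j), fun j h0 => hP j (Polynomial.leadingCoeff_eq_zero.1 (kap_inj _ h0)), fun j => ?_⟩
  have := h.density (rn (kap k (P j).leadingCoeff) * Yp k j - rn (kap k (g j))) (by
    refine hg.mono fun s hs => hs.mono fun t ht => ?_
    obtain ⟨a, ha, b, hb, hsl, hy⟩ := ht
    refine ⟨a, ha, b, hb, hsl, ?_⟩
    rw [map_sub, map_mul, rn2, rn2, kap_eval, kap_eval, ← hy, sub_self])
  rw [map_sub, map_mul, rn1, rn1, sub_eq_zero] at this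
  exact this

end
end S19

namespace S19
set_option linter.unusedSectionVars false

theorem ker_poly {A E : Type} [CommRing A] [IsDomain A] [UniqueFactorizationMonoid A] [Field E] (φ : Polynomial A →+* E)
    (hinj : ∀ a, φ (Polynomial.C a) = 0 → a = 0) (R : Polynomial A) (hR : R ≠ 0) (hR0 : φ R = 0) :
    ∃ G, φ G = 0 ∧ G ≠ 0 ∧ ∀ R, φ R = 0 → G ∣ R := by
  have hirr : ∃ G, Irreducible G ∧ φ G = 0 := by
    induction R using WfDvdMonoid.induction_on_irreducible with
    | zero => exact absurd rfl hR
    | unit u hu => exact absurd hR0 (hu.map φ).ne_zero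
    | mul a i ha hi ih =>
      rw [map_mul] at hR0
      rcases mul_eq_zero.1 hR0 with h | h
      · exact ⟨i, hi, h⟩
      · exact ih ha h
  obtain ⟨G, hG, hG0⟩ := hirr
  refine ⟨G, hG0, hG.ne_zero, fun R hR => ?_⟩
  have hdeg : G.natDegree ≠ 0 := by
    intro h0
    rw [Polynomial.eq_C_of_natDegree_eq_zero h0] at hG0
    have := hinj _ hG0
    apply hG.ne_zero
    rw [Polynomial.eq_C_of_natDegree_eq_zero h0, this, map_zero]
  have hprim := hG.isPrimitive hdeg
  let F := FractionRing A
  let f : A →+* E := φ.comp Polynomial.C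
  have hf : Function.Injective f := (injective_iff_map_eq_zero f).2 hinj
  let g : F →+* E := IsFractionRing.lift hf
  have hg : ∀ P : Polynomial A, Polynomial.eval₂ g (φ Polynomial.X) (P.map (algebraMap A F)) = φ P := by
    intro P
    rw [Polynomial.eval₂_map]
    have : g.comp (algebraMap A F) = f := by
      ext a; exact IsFractionRing.lift_algebraMap hf a
    rw [this]
    change Polynomial.eval₂RingHom f (φ Polynomial.X) P = φ P
    congr 1
    ext <;> simp [f]
  let : Algebra F E := g.toAlgebra
  have hae : ∀ P : Polynomial A, Polynomial.aeval (φ Polynomial.X) (P.map (algebraMap A F)) = φ P := hg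
  have hirr := (hprim.irreducible_iff_irreducible_map_fraction_map (K := F)).1 hG
  apply hprim.dvd_of_fraction_map_dvd_fraction_map (K := F)
  have h1 : minpoly F (φ Polynomial.X) ∣ G.map (algebraMap A F) := minpoly.dvd _ _ (by rw [hae, hG0])
  have h2 : minpoly F (φ Polynomial.X) ∣ R.map (algebraMap A F) := minpoly.dvd _ _ (by rw [hae, hR])
  have hu : ¬ IsUnit (minpoly F (φ Polynomial.X)) := minpoly.not_isUnit _ _
  exact ((hirr.dvd_iff.1 h1).resolve_left hu).dvd.trans h2

theorem ker_mv {K E : Type} [Field K] [Field E] (ψ : MvPolynomial (Fin 2) K →+* E)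
    (hinj : ∀ p : MvPolynomial (Fin 1) K, ψ (rename Fin.succ p) = 0 → p = 0) (R : MvPolynomial (Fin 2) K)
    (hR : R ≠ 0) (hR0 : ψ R = 0) : ∃ G, ψ G = 0 ∧ G ≠ 0 ∧ ∀ R, ψ R = 0 → G ∣ R := by
  let e : MvPolynomial (Fin 2) K ≃ₐ[K] Polynomial (MvPolynomial (Fin 1) K) := finSuccEquiv K 1
  have hC : ∀ p, e (rename Fin.succ p) = Polynomial.C p := by
    intro p
    induction p using MvPolynomial.induction_on with
    | C a => simp [e, finSuccEquiv_apply]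
    | add p q hp hq => rw [map_add, map_add, hp, hq, map_add]
    | mul_X p i hp =>
      rw [map_mul, map_mul, hp, rename_X]
      have : e (X i.succ) = Polynomial.C (X i) := finSuccEquiv_X_succ
      rw [this, ← map_mul]
  obtain ⟨G, h1, h2, h3⟩ := ker_poly (ψ.comp (e.symm : _ →+* _)) (fun a ha => by
    apply hinj
    have := hC a
    rw [← ha]
    simp [← this]) (e R) (by simpa using hR) (by simpa using hR0)
  refine ⟨e.symm G, h1, by simpa using h2, fun R hR => ?_⟩
  have := h3 (e R) (by simpa using hR)
  obtain ⟨Q, hQ⟩ := this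
  exact ⟨e.symm Q, by rw [← map_mul, ← hQ]; simp⟩

section
variable {k K E : Type} [Field k] [IsAlgClosed k] [CharZero k] [Field K] [Algebra k K] [Field E] [Algebra k E]
  {Z : Set (Fin 3 → k)} {ξ : Fin 3 → K} {ia ib : K →ₐ[k] E} {τ : E →ₐ[k] E} {D : Derivation k K K}
    {Da Db : Derivation k E E}

/-- coefficients to the function field -/
def Psi (ξ : Fin 3 → K) : MvPolynomial (Fin 3 ⊕ Fin 2) k →ₐ[k] MvPolynomial (Fin 2) K :=
  aeval (Sum.elim (fun i => C (ξ i)) X)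

theorem Psi_inl (F : MvPolynomial (Fin 3) k) : Psi ξ (rename Sum.inl F) = C (aeval ξ F) := by
  unfold Psi
  rw [aeval_rename]
  change aeval (fun i => C (ξ i)) F = algebraMap K (MvPolynomial (Fin 2) K) _
  rw [← MvPolynomial.aeval_algebraMap_apply]
  rfl

theorem Psi_eval (hg : Gen Z ξ) {F : MvPolynomial (Fin 3 ⊕ Fin 2) k} (h : Psi ξ F = 0)
    {c : Fin 3 → k} (hc : c ∈ Z) (u : Fin 2 → k) : eval (Sum.elim c u) F = 0 := by
  rw [← eval_pevR]
  refine (hg.rel _).1 ?_ c hc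
  rw [aeval_pevR]
  have := congrArg (eval₂Hom (RingHom.id K) (fun i => algebraMap k K (u i))) h
  rw [map_zero] at this
  rw [← this]
  change (aeval _ : _ →ₐ[k] K).toRingHom F = ((eval₂Hom (RingHom.id K) (fun i => algebraMap k K (u i))).comp (Psi ξ).toRingHom) F
  congr 1
  ext i
  · simp [MvPolynomial.algebraMap_eq, IsScalarTower.algebraMap_apply k K (MvPolynomial (Fin 2) K)]
  · rcases i with i | i <;> simp [Psi]

theorem clr (hg : Gen Z ξ) (R : MvPolynomial (Fin 2) K) : ∃ e : MvPolynomial (Fin 3) k, aeval ξ e ≠ 0 ∧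
    ∃ R' : MvPolynomial (Fin 3 ⊕ Fin 2) k, Psi ξ R' = C (aeval ξ e) * R := by
  induction R using MvPolynomial.induction_on with
  | C a =>
    obtain ⟨F, G, hG, rfl⟩ := hg.gen a
    refine ⟨G, hG, rename Sum.inl F, ?_⟩
    rw [Psi_inl, ← C_mul, mul_div_cancel₀ _ hG]
  | add p q hp hq =>
    obtain ⟨e, he, R, hR⟩ := hp
    obtain ⟨e', he', R', hR'⟩ := hq
    refine ⟨e * e', by rw [map_mul]; exact mul_ne_zero he he', rename Sum.inl e' * R + rename Sum.inl e * R', ?_⟩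
    rw [map_add, map_mul, map_mul, hR, hR', Psi_inl, Psi_inl, map_mul, C_mul]; ring
  | mul_X p i hp =>
    obtain ⟨e, he, R, hR⟩ := hp
    refine ⟨e, he, R * X (Sum.inr i), ?_⟩
    rw [map_mul, hR, mul_assoc]
    congr 2
    simp [Psi]

/-- the generic tuple `(a, s, t)` -/
def TA (ξ : Fin 3 → K) (ia ib : K →ₐ[k] E) : Fin 3 ⊕ Fin 2 → E :=
  Sum.elim (fun i => ia (ξ i)) ![SS ξ ia ib 1, SS ξ ia ib 2]

/-- derivation clearing denominators -/
def ddv (n : Fin 3 → MvPolynomial (Fin 3) k) : Derivation k (MvPolynomial (Fin 3 ⊕ Fin 2) k) (MvPolynomial (Fin 3 ⊕ Fin 2) k) :=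
  mkDerivation k (Sum.elim (fun i => rename Sum.inl (n i)) 0)

theorem ddv_coeff {d : MvPolynomial (Fin 3) k} {n : Fin 3 → MvPolynomial (Fin 3) k}
    (hn : ∀ i, aeval ξ d * D (ξ i) = aeval ξ (n i)) (F : MvPolynomial (Fin 3 ⊕ Fin 2) k) (m : Fin 2 →₀ ℕ) :
    coeff m (Psi ξ (ddv n F)) = aeval ξ d * D (coeff m (Psi ξ F)) := by
  classical
  induction F using MvPolynomial.induction_on generalizing m with
  | C a =>
    have h1 : Psi ξ (C a : MvPolynomial (Fin 3 ⊕ Fin 2) k) = C (algebraMap k K a) := by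
      simp [Psi, IsScalarTower.algebraMap_apply k K (MvPolynomial (Fin 2) K)]
    rw [h1, derivation_C, coeff_C, map_zero, coeff_zero]
    split_ifs <;> simp
  | add p q hp hq => simp [hp, hq, mul_add]
  | mul_X p j hp =>
    rw [Derivation.leibniz, smul_eq_mul, smul_eq_mul, map_add, map_mul, map_mul, coeff_add]
    have hj : ddv n (X j) = (Sum.elim (fun i => rename Sum.inl (n i)) 0 : Fin 3 ⊕ Fin 2 → MvPolynomial (Fin 3 ⊕ Fin 2) k) j := mkDerivation_X _ _ _
    rcases j with i | i
    · rw [hj, map_mul]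
      have e1 : Psi ξ (X (Sum.inl i) : MvPolynomial (Fin 3 ⊕ Fin 2) k) = C (ξ i) := by simp [Psi]
      have e2 : Psi ξ ((Sum.elim (fun i => rename Sum.inl (n i)) 0 : Fin 3 ⊕ Fin 2 → MvPolynomial (Fin 3 ⊕ Fin 2) k) (Sum.inl i)) = C (aeval ξ (n i)) := Psi_inl _
      rw [e1, e2, mul_comm _ (C (aeval ξ (n i))), coeff_C_mul, coeff_C_mul, hp, mul_comm _ (C (ξ i)), coeff_C_mul,
        Derivation.leib', ← hn]
      ring
    · rw [hj, map_mul]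
      have e1 : Psi ξ (X (Sum.inr i) : MvPolynomial (Fin 3 ⊕ Fin 2) k) = X i := by simp [Psi]
      have e2 : Psi ξ ((Sum.elim (fun i => rename Sum.inl (n i)) 0 : Fin 3 ⊕ Fin 2 → MvPolynomial (Fin 3 ⊕ Fin 2) k) (Sum.inr i)) = 0 := map_zero _
      rw [e1, e2, mul_zero, coeff_zero, zero_add, mul_comm (X i), coeff_mul_X', coeff_mul_X']
      split_ifs
      · exact hp _
      · simp

theorem Pair.tK (h : Pair Z ξ ia ib τ D Da Db) (F : Polynomial K) (hF : F ≠ 0) :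
    F.eval₂ (ia : K →+* E) (SS ξ ia ib 2) ≠ 0 := by
  intro h0
  have : CharZero K := charZero_of_injective_algebraMap (algebraMap k K).injective
  have := D_zero_alg (ia : K →+* E) ia.injective (RingHom.id E) (Db : E →ₗ[k] E).toAddMonoidHom
    (fun a b => Derivation.leib' Db a b) (fun c => h.Dba c) _ F hF h0
  have h1 : Db (SS ξ ia ib 2) = 0 := this
  have h2 := congrArg Db (h.ss 2)
  rw [Derivation.leib', map_sub, map_sub, h1, h.Dba, h.Dbb, h.Dba, h.Dbb, h.D0] at h2
  apply h.Une' 2 h.z2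
  rw [map_one] at h2
  linear_combination h2

theorem Pair.key (h : Pair Z ξ ia ib τ D Da Db) {d : MvPolynomial (Fin 3) k} {n : Fin 3 → MvPolynomial (Fin 3) k}
    (hd : aeval ξ d ≠ 0)
    (hn : ∀ i, aeval ξ d * D (ξ i) = aeval ξ (n i)) (R0 : MvPolynomial (Fin 3 ⊕ Fin 2) k) (hR0 : Psi ξ R0 ≠ 0)
    (hR00 : aeval (TA ξ ia ib) R0 = 0) : ∃ G : MvPolynomial (Fin 3 ⊕ Fin 2) k, aeval (TA ξ ia ib) G = 0 ∧ Psi ξ G ≠ 0 ∧ aeval (TA ξ ia ib) (ddv n G) ≠ 0 ∧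
      ∀ R : MvPolynomial (Fin 3 ⊕ Fin 2) k, aeval (TA ξ ia ib) R = 0 → ∃ e : MvPolynomial (Fin 3) k, aeval ξ e ≠ 0 ∧ 
        ∃ R' : MvPolynomial (Fin 3 ⊕ Fin 2) k, Psi ξ (rename Sum.inl e * R - G * R') = 0 := by
  let ψ : MvPolynomial (Fin 2) K →+* E := eval₂Hom (ia : K →+* E) ![SS ξ ia ib 1, SS ξ ia ib 2]
  have hψ : ∀ F : MvPolynomial (Fin 3 ⊕ Fin 2) k, ψ (Psi ξ F) = aeval (TA ξ ia ib) F := by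
    intro F
    change (ψ.comp (Psi ξ).toRingHom) F = (aeval (TA ξ ia ib) : _ →ₐ[k] E).toRingHom F
    congr 1
    ext i
    · simp [ψ, IsScalarTower.algebraMap_apply k K (MvPolynomial (Fin 2) K)]
    · rcases i with i | i <;> simp [Psi, ψ, TA]
  obtain ⟨G0, hG0, hG0n, hG0d⟩ := ker_mv ψ (fun p hp => by
    let : Algebra K E := (ia : K →+* E).toAlgebra
    have h1 : AlgebraicIndependent K (fun _ : Fin 1 => SS ξ ia ib 2) := by
      rw [algebraicIndependent_unique_type_iff]
      rintro ⟨F, hF, hF0⟩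
      exact h.tK F hF hF0
    rw [algebraicIndependent_iff] at h1
    apply h1
    simp only [ψ, coe_eval₂Hom, eval₂_rename] at hp
    rw [← hp, aeval_def]
    congr 1
    funext i; fin_cases i; rfl) (Psi ξ R0) hR0 (by rw [hψ, hR00])
  obtain ⟨e0, he0, G, hG⟩ := clr h.hg G0
  have hCe : ∀ e : K, e ≠ 0 → IsUnit (C e : MvPolynomial (Fin 2) K) := fun e he => (IsUnit.mk0 e he).map C
  have hGn : Psi ξ G ≠ 0 := by
    rw [hG]; exact mul_ne_zero (hCe _ he0).ne_zero hG0n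
  have hGd : ∀ R, ψ R = 0 → Psi ξ G ∣ R := by
    intro R hR
    rw [hG, (hCe _ he0).mul_left_dvd]
    exact hG0d R hR
  have hG00 : ψ (Psi ξ G) = 0 := by rw [hG, map_mul, hG0, mul_zero]
  refine ⟨G, by rw [← hψ, hG00], hGn, ?_, ?_⟩
  · intro hcon
    rw [← hψ] at hcon
    obtain ⟨H, hH⟩ := hGd _ hcon
    have hHl : ∃ l : K, H = C l := by
      by_cases hH0 : H = 0
      · exact ⟨0, by rw [hH0, map_zero]⟩
      · have h1 : (Psi ξ (ddv n G)).totalDegree ≤ (Psi ξ G).totalDegree := by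
          apply Finset.sup_mono
          intro m hm
          rw [mem_support_iff] at *
          intro h0
          rw [ddv_coeff hn, h0] at hm
          simp at hm
        rw [hH, totalDegree_mul_of_isDomain hGn hH0] at h1
        have h2 : H.totalDegree = 0 := by omega
        exact ⟨_, totalDegree_eq_zero_iff_eq_C.1 h2⟩
    obtain ⟨l, rfl⟩ := hHl
    have hc : ∀ m, aeval ξ d * D (coeff m (Psi ξ G)) = l * coeff m (Psi ξ G) := by
      intro m
      rw [← ddv_coeff hn, hH, mul_comm, coeff_C_mul]
    obtain ⟨m0, hm0⟩ := MvPolynomial.ne_zero_iff.1 hGn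
    have hk : ∀ m, ∃ c : k, coeff m (Psi ξ G) = algebraMap k K c * coeff m0 (Psi ξ G) := by
      intro m
      obtain ⟨c, hc'⟩ := h.Dker (coeff m (Psi ξ G) / coeff m0 (Psi ξ G)) (by
        set A := coeff m (Psi ξ G)
        set B := coeff m0 (Psi ξ G)
        have e1 : A / B * B = A := div_mul_cancel₀ _ hm0
        have e2 := congrArg D e1
        rw [Derivation.leib'] at e2
        have e3 : aeval ξ d * B * D (A / B) = 0 := by
          linear_combination aeval ξ d * e2 + hc m - A / B * hc m0 - l * e1
        exact (mul_eq_zero.1 e3).resolve_left (mul_ne_zero hd hm0))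
      exact ⟨c, by rw [← hc', div_mul_cancel₀ _ hm0]⟩
    choose c hc' using hk
    let N : MvPolynomial (Fin 2) k := ∑ m ∈ (Psi ξ G).support, monomial m (c m)
    have hN : Psi ξ G = C (coeff m0 (Psi ξ G)) * N.map (algebraMap k K) := by
      conv_lhs => rw [(Psi ξ G).as_sum]
      simp only [N, map_sum, map_monomial, Finset.mul_sum, C_mul_monomial]
      refine Finset.sum_congr rfl fun m _ => ?_
      rw [hc' m, mul_comm]
    have hN0 : N ≠ 0 := by
      rintro h0
      rw [h0] at hN
      exact hGn (by simpa using hN)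
    rw [hN, map_mul] at hG00
    have h3 : ψ (N.map (algebraMap k K)) = aeval ![SS ξ ia ib 1, SS ξ ia ib 2] N := by
      simp only [ψ, coe_eval₂Hom, eval₂_map, aeval_def]
      congr 1
      ext x; simp
    rw [h3] at hG00
    rcases mul_eq_zero.1 hG00 with h4 | h4
    · simp [ψ] at h4
      exact hm0 h4
    · exact hN0 (algebraicIndependent_iff.1 h.A0 _ h4)
  · intro R hR
    obtain ⟨Q, hQ⟩ := hGd (Psi ξ R) (by rw [hψ, hR])
    obtain ⟨e, he, Q', hQ'⟩ := clr h.hg Q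
    refine ⟨e, he, Q', ?_⟩
    rw [map_sub, map_mul, map_mul, Psi_inl, hQ', hQ]; ring

end
end S19

namespace S19
set_option linter.unusedSectionVars false

section
variable {k K : Type} [Field k] [IsAlgClosed k] [CharZero k] [Field K] [Algebra k K] 
  {Z : Set (Fin 3 → k)} {ξ : Fin 3 → K}

/-- points where the first coordinate is a local parameter -/
def GoodPt (ξ : Fin 3 → K) (c : Fin 3 → k) : Prop :=
  ∀ i, ∃ e r : MvPolynomial (Fin 3) k, eval c e ≠ 0 ∧
    aeval ξ e * (ξ i - algebraMap k K (c i)) = (ξ 0 - algebraMap k K (c 0)) * aeval ξ r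

/-- bivariate polynomials in coordinates `0, i` -/
def bi (i : Fin 3) : Polynomial (Polynomial k) →+* MvPolynomial (Fin 3) k :=
  Polynomial.eval₂RingHom (Polynomial.aeval (X 0) : Polynomial k →ₐ[k] MvPolynomial (Fin 3) k).toRingHom (X i)

theorem bi_X (i : Fin 3) : bi i (Polynomial.X : Polynomial (Polynomial k)) = X i := by simp [bi]
theorem bi_C (i : Fin 3) (p : Polynomial k) : bi i (Polynomial.C p) = Polynomial.aeval (X 0) p := by simp [bi]
theorem aeval_bi (i : Fin 3) (F : Polynomial (Polynomial k)) : aeval ξ (bi i F) = ev2 (ξ 0) (ξ i) F := by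
  induction F using Polynomial.induction_on' with
  | add p q hp hq => rw [map_add, map_add, hp, hq]; simp [ev2, Polynomial.eval₂_add]
  | monomial n a =>
    rw [← Polynomial.C_mul_X_pow_eq_monomial, map_mul, map_pow, bi_X, bi_C, map_mul, map_pow, aeval_X, 
      ← Polynomial.aeval_algHom_apply, aeval_X]
    simp [ev2]

theorem good_i (hZ : AffCurve Z) (hg : Gen Z ξ) (i : Fin 3) : ∃ Θ : MvPolynomial (Fin 3) k, aeval ξ Θ ≠ 0 ∧
    ∀ c ∈ Z, eval c Θ ≠ 0 → ∃ e r : MvPolynomial (Fin 3) k, eval c e ≠ 0 ∧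
    aeval ξ e * (ξ i - algebraMap k K (c i)) = (ξ 0 - algebraMap k K (c 0)) * aeval ξ r := by
  classical
  have hex : ∃ n, ∃ F : Polynomial (Polynomial k), F ≠ 0 ∧ ev2 (ξ 0) (ξ i) F = 0 ∧ F.natDegree = n := by
    obtain ⟨F, h1, h2⟩ := hZ.td1 hg (ξ 0) (ξ i)
    exact ⟨_, F, h1, h2, rfl⟩
  obtain ⟨F, hF, hF0, hFn⟩ := Nat.find_spec hex
  have hmin := fun m => Nat.find_min hex (m := m)
  rw [← hFn] at hmin
  have hdeg : F.natDegree ≠ 0 := by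
    intro h0
    obtain ⟨p, hp⟩ := Polynomial.natDegree_eq_zero.1 h0
    rw [← hp] at hF0
    have : Polynomial.aeval (ξ 0) p = 0 := by simpa [ev2] using hF0
    have := (transcendental_iff.1 (transc (hZ.nc0 hg))) p this
    exact hF (by rw [← hp, this, map_zero])
  refine ⟨bi i F.derivative, ?_, ?_⟩
  · rw [aeval_bi]
    intro h0
    refine hmin F.derivative.natDegree (Polynomial.natDegree_derivative_lt hdeg) ⟨F.derivative, ?_, h0, rfl⟩
    intro h; exact hdeg (Polynomial.derivative_eq_zero.1 h)
  · intro c hc hΘ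
    let y : Polynomial k := Polynomial.C (c i)
    obtain ⟨Q, hQ⟩ := Polynomial.X_sub_C_dvd_sub_C_eval (a := y) (p := F)
    set p := Polynomial.eval y F
    have hFc : eval c (bi i F) = 0 := (hg.rel _).1 (by rw [aeval_bi, hF0]) c hc
    have hF' : F = (Polynomial.X - Polynomial.C y) * Q + Polynomial.C p := by rw [← hQ]; ring
    have hby : bi i (Polynomial.C y) = C (c i) := by
      rw [bi_C]; simp [y, MvPolynomial.algebraMap_eq]
    have hp : Polynomial.eval (c 0) p = 0 := by
      rw [hF', map_add, map_mul, map_sub, hby, bi_X, bi_C] at hFc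
      simp only [map_add, map_mul, map_sub, eval_X, eval_C, sub_self, zero_mul, zero_add] at hFc
      have := Polynomial.aeval_algHom_apply (aeval c : MvPolynomial (Fin 3) k →ₐ[k] k) (X 0) p
      rw [aeval_X, aeval_eq_eval] at this
      change Polynomial.aeval (c 0) p = eval c (Polynomial.aeval (X 0) p) at this
      rw [hFc] at this
      simpa using this
    obtain ⟨p', hp'⟩ := Polynomial.dvd_iff_isRoot.2 hp
    refine ⟨bi i Q, -(Polynomial.aeval (X 0) p'), ?_, ?_⟩
    · rw [hF'] at hΘ
      have : eval c (bi i ((Polynomial.X - Polynomial.C y) * Q + Polynomial.C p).derivative) = eval c (bi i Q) := by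
        simp [Polynomial.derivative_mul, hby, bi_X]
      rwa [this] at hΘ
    · have h1 : aeval ξ (bi i F) = 0 := by rw [aeval_bi, hF0]
      rw [hF', map_add, map_mul, map_sub, hby, bi_X, bi_C, map_add, map_mul, map_sub, hp'] at h1
      simp only [aeval_X, aeval_C, map_mul, map_sub, Polynomial.aeval_X, Polynomial.aeval_C, MvPolynomial.algebraMap_eq] at h1
      rw [map_neg]
      linear_combination h1

theorem good_ex (hZ : AffCurve Z) (hg : Gen Z ξ) : ∃ Θ : MvPolynomial (Fin 3) k, aeval ξ Θ ≠ 0 ∧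
    ∀ c ∈ Z, eval c Θ ≠ 0 → GoodPt ξ c := by
  choose Θ h1 h2 using good_i hZ hg
  refine ⟨∏ i, Θ i, ?_, fun c hc h i => h2 i c hc ?_⟩
  · rw [map_prod]; exact Finset.prod_ne_zero_iff.2 fun i _ => h1 i
  · rw [map_prod] at h; exact Finset.prod_ne_zero_iff.1 h i (Finset.mem_univ i)

theorem Gen.ne_of (hg : Gen Z ξ) {c : Fin 3 → k} (hc : c ∈ Z) {e : MvPolynomial (Fin 3) k} (he : eval c e ≠ 0) : aeval ξ e ≠ 0 :=
  fun h => he ((hg.rel e).1 h c hc)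

theorem GP1 {c : Fin 3 → k} (h : GoodPt ξ c) (F : MvPolynomial (Fin 3) k) :
    ∃ e F' : MvPolynomial (Fin 3) k, eval c e ≠ 0 ∧
      aeval ξ e * (aeval ξ F - algebraMap k K (eval c F)) = (ξ 0 - algebraMap k K (c 0)) * aeval ξ F' := by
  induction F using MvPolynomial.induction_on with
  | C a => exact ⟨1, 0, by simp, by simp⟩
  | add p q hp hq =>
    obtain ⟨e, F, he, hF⟩ := hp
    obtain ⟨e', F', he', hF'⟩ := hq
    refine ⟨e * e', e' * F + e * F', by rw [map_mul]; exact mul_ne_zero he he', ?_⟩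
    simp only [map_add, map_mul]
    linear_combination aeval ξ e' * hF + aeval ξ e * hF'
  | mul_X p i hp =>
    obtain ⟨e, F, he, hF⟩ := hp
    obtain ⟨e', F', he', hF'⟩ := h i
    refine ⟨e * e', e' * F * X i + e * F' * C (eval c p), by rw [map_mul]; exact mul_ne_zero he he', ?_⟩
    simp only [map_add, map_mul, aeval_X, eval_X, aeval_C]
    linear_combination aeval ξ e' * ξ i * hF + aeval ξ e * algebraMap k K (eval c p) * hF'

theorem GP2 (hZ : AffCurve Z) (hg : Gen Z ξ) {c : Fin 3 → k} (hc : c ∈ Z) (h : GoodPt ξ c) (F : MvPolynomial (Fin 3) k)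
    (hF : aeval ξ F ≠ 0) :
    ∃ (n : ℕ) (e F' : MvPolynomial (Fin 3) k), eval c e ≠ 0 ∧ eval c F' ≠ 0 ∧ 
      aeval ξ e * aeval ξ F = (ξ 0 - algebraMap k K (c 0)) ^ n * aeval ξ F' := by
  by_contra hcon
  push Not at hcon
  have hX : ξ 0 - algebraMap k K (c 0) ≠ 0 := sub_ne_zero.2 (hZ.nc0 hg _)
  have hstep : ∀ N : ℕ, ∃ e F' : MvPolynomial (Fin 3) k, eval c e ≠ 0 ∧ 
      aeval ξ e * aeval ξ F = (ξ 0 - algebraMap k K (c 0)) ^ N * aeval ξ F' := by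
    intro N
    induction N with
    | zero => exact ⟨1, F, by simp, by simp⟩
    | succ N ih =>
      obtain ⟨e, F', he, hF'⟩ := ih
      have h0 : eval c F' = 0 := by
        by_contra h0
        exact hcon N e F' he h0 hF'
      obtain ⟨e', F'', he', hF''⟩ := GP1 h F'
      rw [h0, map_zero, sub_zero] at hF''
      refine ⟨e * e', F'', by rw [map_mul]; exact mul_ne_zero he he', ?_⟩
      rw [map_mul]
      linear_combination aeval ξ e' * hF' + (ξ 0 - algebraMap k K (c 0)) ^ N * hF''
  -- relation
  have hex : ∃ n, ∃ P : Polynomial (Polynomial k), P ≠ 0 ∧ ev2 (ξ 0) (aeval ξ F) P = 0 ∧ P.natDegree = n := by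
    obtain ⟨P, h1, h2⟩ := hZ.td1 hg (ξ 0) (aeval ξ F)
    exact ⟨_, P, h1, h2, rfl⟩
  classical
  obtain ⟨P, hP, hP0, hPn⟩ := Nat.find_spec hex
  have hmin := fun m => Nat.find_min hex (m := m)
  rw [← hPn] at hmin
  have hdecomp := Polynomial.divX_mul_X_add P
  have hP0' : ev2 (ξ 0) (aeval ξ F) P.divX * aeval ξ F + Polynomial.aeval (ξ 0) (P.coeff 0) = 0 := by
    rw [← hP0]
    conv_rhs => rw [← hdecomp]
    simp [ev2, Polynomial.eval₂_add, Polynomial.eval₂_mul]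
  have hc0 : P.coeff 0 ≠ 0 := by
    intro h0
    rw [h0, map_zero, add_zero] at hP0'
    have h1 := (mul_eq_zero.1 hP0').resolve_right hF
    rw [h0, map_zero, add_zero] at hdecomp
    have h2 : P.divX ≠ 0 := by
      intro h; rw [h, zero_mul] at hdecomp; exact hP hdecomp.symm
    refine hmin _ ?_ ⟨_, h2, h1, rfl⟩
    have := congrArg Polynomial.natDegree hdecomp
    rw [Polynomial.natDegree_mul h2 Polynomial.X_ne_zero, Polynomial.natDegree_X] at this
    omega
  obtain ⟨p1, hp1, hnd⟩ := Polynomial.exists_eq_pow_rootMultiplicity_mul_and_not_dvd _ hc0 (c 0)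
  set n := (P.coeff 0).rootMultiplicity (c 0)
  have hp1c : Polynomial.eval (c 0) p1 ≠ 0 := fun h0 => hnd (Polynomial.dvd_iff_isRoot.2 h0)
  obtain ⟨e, F', he, hF'⟩ := hstep (n + 1)
  -- ev2 of a polynomial as a polynomial in ξ
  have hW : ∃ W : MvPolynomial (Fin 3) k, aeval ξ W = ev2 (ξ 0) (aeval ξ F) P.divX := by
    generalize P.divX = Q
    induction Q using Polynomial.induction_on' with
    | add p q hp hq =>
      obtain ⟨a, ha⟩ := hp
      obtain ⟨b, hb⟩ := hq
      exact ⟨a + b, by rw [map_add, ha, hb]; simp [ev2, Polynomial.eval₂_add]⟩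
    | monomial m a =>
      refine ⟨Polynomial.aeval (X 0) a * F ^ m, ?_⟩
      rw [map_mul, map_pow, ← Polynomial.aeval_algHom_apply, aeval_X]
      simp [ev2]
  obtain ⟨W, hW⟩ := hW
  rw [← hW, hp1] at hP0'
  simp only [map_mul, map_pow, map_sub, Polynomial.aeval_X, Polynomial.aeval_C] at hP0'
  have h3 : (ξ 0 - algebraMap k K (c 0)) ^ n * (aeval ξ e * Polynomial.aeval (ξ 0) p1 + 
      aeval ξ W * ((ξ 0 - algebraMap k K (c 0)) * aeval ξ F')) = 0 := by
    linear_combination aeval ξ e * hP0' - aeval ξ W * hF'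
  have h4 := (mul_eq_zero.1 h3).resolve_left (pow_ne_zero _ hX)
  have h5 : aeval ξ (e * Polynomial.aeval (X 0) p1 + W * ((X 0 - C (c 0)) * F')) = 0 := by
    simp only [map_add, map_mul, map_sub, aeval_X, aeval_C, ← Polynomial.aeval_algHom_apply]
    exact h4
  have h6 := (hg.rel _).1 h5 c hc
  have h7 : eval c (Polynomial.aeval (X 0 : MvPolynomial (Fin 3) k) p1) = Polynomial.eval (c 0) p1 := by
    have := Polynomial.aeval_algHom_apply (aeval c : MvPolynomial (Fin 3) k →ₐ[k] k) (X 0) p1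
    rw [aeval_X, aeval_eq_eval] at this
    change Polynomial.aeval (c 0) p1 = eval c (Polynomial.aeval (X 0) p1) at this
    rw [← this]; simp
  simp only [map_add, map_mul, map_sub, eval_X, eval_C, sub_self, zero_mul, mul_zero, add_zero, h7] at h6
  rcases mul_eq_zero.1 h6 with h | h
  · exact he h
  · exact hp1c h

theorem GP3 (hZ : AffCurve Z) (hg : Gen Z ξ) {c : Fin 3 → k} (hc : c ∈ Z) (h : GoodPt ξ c) (r : K)
    (hr : r ≠ 0) : ∃ n : ℤ, ∀ V : ValuationSubring K, Over k V → (∀ i, Cong V (ξ i) (c i)) →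
      V.valuation r = V.valuation (ξ 0 - algebraMap k K (c 0)) ^ n := by
  obtain ⟨F, G, hG, rfl⟩ := hg.gen r
  have hF : aeval ξ F ≠ 0 := by rintro h0; rw [h0, zero_div] at hr; exact hr rfl
  obtain ⟨n, e, F', he, hF', h1⟩ := GP2 hZ hg hc h F hF
  obtain ⟨m, e', G', he', hG', h2⟩ := GP2 hZ hg hc h G hG
  refine ⟨n - m, fun V hV hVc => ?_⟩
  have hu : ∀ f : MvPolynomial (Fin 3) k, eval c f ≠ 0 → V.valuation (aeval ξ f) = 1 := fun f hf =>
    (Cong.aeval hV hVc f).val_eq_one hV hf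
  have h1' := congrArg V.valuation h1
  have h2' := congrArg V.valuation h2
  rw [map_mul, map_mul, map_pow, hu _ he, hu _ hF', one_mul, mul_one] at h1'
  rw [map_mul, map_mul, map_pow, hu _ he', hu _ hG', one_mul, mul_one] at h2'
  have hX : ξ 0 - algebraMap k K (c 0) ≠ 0 := sub_ne_zero.2 (hZ.nc0 hg _)
  rw [map_div₀, h1', h2', zpow_sub₀ (by simpa using hX), zpow_natCast, zpow_natCast]

theorem GP_unique (hZ : AffCurve Z) (hg : Gen Z ξ) {c : Fin 3 → k} (hc : c ∈ Z) (h : GoodPt ξ c) 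
    {V V' : ValuationSubring K} (hV : Over k V) (hVc : ∀ i, Cong V (ξ i) (c i))
    (hV' : Over k V') (hVc' : ∀ i, Cong V' (ξ i) (c i)) : V = V' := by
  have hX : ξ 0 - algebraMap k K (c 0) ≠ 0 := sub_ne_zero.2 (hZ.nc0 hg _)
  ext r
  by_cases hr : r = 0
  · rw [hr]; simp [zero_mem]
  obtain ⟨n, hn⟩ := GP3 hZ hg hc h r hr
  have key : ∀ V : ValuationSubring K, Over k V → (∀ i, Cong V (ξ i) (c i)) → (r ∈ V ↔ 0 ≤ n) := by
    intro V hV hVc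
    rw [← V.valuation_le_one_iff, hn V hV hVc]
    exact zpow_le_one_iff_right_of_lt_one₀ (by rw [zero_lt_iff]; simpa using hX) (hVc 0)
  rw [key V hV hVc, key V' hV' hVc']

theorem GP_max (hZ : AffCurve Z) (hg : Gen Z ξ) {c : Fin 3 → k} (hc : c ∈ Z) (h : GoodPt ξ c) 
    {V : ValuationSubring K} (hV : Over k V) (hVc : ∀ i, Cong V (ξ i) (c i)) (r : K) (hr : V.valuation r < 1) :
    V.valuation r ≤ V.valuation (ξ 0 - algebraMap k K (c 0)) := by
  have hX : ξ 0 - algebraMap k K (c 0) ≠ 0 := sub_ne_zero.2 (hZ.nc0 hg _)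
  have hX' : 0 < V.valuation (ξ 0 - algebraMap k K (c 0)) := by rw [zero_lt_iff]; simpa using hX
  by_cases hr0 : r = 0
  · simp [hr0]
  obtain ⟨n, hn⟩ := GP3 hZ hg hc h r hr0
  rw [hn V hV hVc] at hr ⊢
  rw [zpow_lt_one_iff_right_of_lt_one₀ hX' (hVc 0)] at hr
  have := (zpow_le_zpow_iff_right_of_lt_one₀ hX' (hVc 0) (n := 1) (m := n)).2 (by omega)
  simpa using this

/-- simple zeros -/
theorem GP_simple (hg : Gen Z ξ) {D : Derivation k K K} {d : MvPolynomial (Fin 3) k} {n : Fin 3 → MvPolynomial (Fin 3) k}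
    (hn : ∀ i, aeval ξ d * D (ξ i) = aeval ξ (n i))
    {c : Fin 3 → k} (hc : c ∈ Z) (h : GoodPt ξ c) (F : MvPolynomial (Fin 3) k) (hF : eval c F = 0)
    (hF' : eval c (mkDerivation k n F) ≠ 0) {V : ValuationSubring K} (hV : Over k V) (hVc : ∀ i, Cong V (ξ i) (c i)) :
    V.valuation (aeval ξ F) = V.valuation (ξ 0 - algebraMap k K (c 0)) := by
  obtain ⟨e, F', he, h1⟩ := GP1 h F
  rw [hF, map_zero, sub_zero] at h1
  have hdn : ∀ F, aeval ξ (mkDerivation k n F) = aeval ξ d * D (aeval ξ F) := by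
    intro F
    induction F using MvPolynomial.induction_on with
    | C a => rw [derivation_C, map_zero, aeval_C, D.map_algebraMap, mul_zero]
    | add p q hp hq => simp only [map_add, hp, hq]; ring
    | mul_X p i hp =>
      rw [Derivation.leibniz, mkDerivation_X, map_add, map_mul (aeval ξ) p, Derivation.leib', smul_eq_mul, smul_eq_mul, 
        map_mul, map_mul, hp, aeval_X]
      linear_combination - aeval ξ p * hn i
  have h2 : aeval ξ (e * F - (X 0 - C (c 0)) * F') = 0 := by
    simp only [map_mul, map_sub, aeval_X, aeval_C, h1, sub_self]
  have h3 : aeval ξ (mkDerivation k n (e * F - (X 0 - C (c 0)) * F')) = 0 := by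
    rw [hdn, h2, map_zero, mul_zero]
  have h4 := (hg.rel _).1 h3 c hc
  rw [map_sub (mkDerivation k n), Derivation.leibniz, Derivation.leibniz, map_sub (mkDerivation k n), mkDerivation_X, derivation_C] at h4
  simp only [smul_eq_mul, map_sub, map_add, map_mul, hF, eval_X, eval_C, sub_self, zero_mul, map_zero, sub_zero, add_zero, zero_add] at h4
  have h5 : eval c F' ≠ 0 := by
    intro h0
    rw [h0, zero_mul, sub_zero] at h4
    exact mul_ne_zero he hF' h4
  have h1' := congrArg V.valuation h1
  rwa [map_mul, map_mul, (Cong.aeval hV hVc e).val_eq_one hV he, (Cong.aeval hV hVc F').val_eq_one hV h5, one_mul, mul_one] at h1'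

end
end S19

namespace S19
set_option linter.unusedSectionVars false

section
variable {k K E : Type} [Field k] [IsAlgClosed k] [CharZero k] [Field K] [Algebra k K] [Field E] [Algebra k E]
  {Z : Set (Fin 3 → k)} {ξ : Fin 3 → K} {ia ib : K →ₐ[k] E} {τ : E →ₐ[k] E} {D : Derivation k K K}
    {Da Db : Derivation k E E}

theorem th_eta (a b : Fin 3 → k) (s t : k) : th a b s t = Sum.elim (Sum.elim a b) ![s, t] := rfl

theorem Slp.symm {a b : Fin 3 → k} {s t : k} (h : Slp a b s t) : Slp b a s t :=
  ⟨h.1.symm, by linear_combination - h.2.1, by linear_combination - h.2.2⟩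

theorem Pair.aeval_inr (F : MvPolynomial (Fin 2) k) :
    aeval (TH ξ ia ib) (rename Sum.inr F) = aeval ![SS ξ ia ib 1, SS ξ ia ib 2] F := by
  rw [aeval_rename]; rfl

theorem Pair.aevalTA_inr (F : MvPolynomial (Fin 2) k) :
    aeval (TA ξ ia ib) (rename Sum.inr F) = aeval ![SS ξ ia ib 1, SS ξ ia ib 2] F := by
  rw [aeval_rename]; rfl

theorem Pair.pick (h : Pair Z ξ ia ib τ D Da Db) (θ : MvPolynomial ((Fin 3 ⊕ Fin 3) ⊕ Fin 2) k)
    (hθ : aeval (TH ξ ia ib) θ ≠ 0) : ∃ a ∈ Z, ∃ b ∈ Z, ∃ s t : k, Slp a b s t ∧ eval (th a b s t) θ ≠ 0 := by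
  obtain ⟨c, hc, hcθ⟩ := NS (TH ξ ia ib) (θ * (X (.inl (.inl 0)) - X (.inl (.inr 0)))) (by
    rw [map_mul]
    refine mul_ne_zero hθ ?_
    rw [map_sub, aeval_X, aeval_X]
    exact h.Xne)
  rw [map_mul, map_sub, eval_X, eval_X] at hcθ
  obtain ⟨h1, h2, h3, h4⟩ := h.unspec c hc (sub_ne_zero.1 (right_ne_zero_of_mul hcθ))
  refine ⟨_, h1, _, h2, _, _, h3, ?_⟩
  rw [← h4]
  exact left_ne_zero_of_mul hcθ

theorem Pair.RR (h : Pair Z ξ ia ib τ D Da Db) (ℓ g : Fin 4 → MvPolynomial (Fin 2) k) (hℓ : ∀ j, ℓ j ≠ 0)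
    (hlg : ∀ j, aeval ![SS ξ ia ib 1, SS ξ ia ib 2] (ℓ j) * aeval (TH ξ ia ib) (Yp k j) =
      aeval ![SS ξ ia ib 1, SS ξ ia ib 2] (g j)) :
    ∃ (L : MvPolynomial (Fin 2) k) (R : Fin 3 → MvPolynomial (Fin 3 ⊕ Fin 2) k), L ≠ 0 ∧
      (∀ i, aeval (TA ξ ia ib) (R i) = 0) ∧ Psi ξ (R 0) ≠ 0 ∧
      ∀ a ∈ Z, ∀ b ∈ Z, ∀ s t : k, Slp a b s t → ∀ c : Fin 3 → k,
        eval (Sum.elim c ![s, t]) (R 0) = eval ![s, t] L * ((c 0 - a 0) * (c 0 - b 0)) ∧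
        eval (Sum.elim c ![s, t]) (R 1) = eval ![s, t] L * ((c 1 - a 1) - s * (c 0 - a 0)) ∧
        eval (Sum.elim c ![s, t]) (R 2) = eval ![s, t] L * ((c 2 - a 2) - t * (c 0 - a 0)) := by
  classical
  let L := ∏ j, ℓ j
  let g' := fun j => (∏ i ∈ Finset.univ.erase j, ℓ i) * g j
  have hL0 : L ≠ 0 := Finset.prod_ne_zero_iff.2 fun j _ => hℓ j
  have hL : ∀ j, aeval ![SS ξ ia ib 1, SS ξ ia ib 2] L * aeval (TH ξ ia ib) (Yp k j) =
      aeval ![SS ξ ia ib 1, SS ξ ia ib 2] (g' j) := by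
    intro j
    simp only [L, g']
    rw [← Finset.prod_erase_mul _ _ (Finset.mem_univ j), map_mul, map_mul, mul_assoc, hlg]
  clear_value L g'
  have hs : ∀ a ∈ Z, ∀ b ∈ Z, ∀ s t : k, Slp a b s t → ∀ j, eval ![s, t] L * eval (th a b s t) (Yp k j) = eval ![s, t] (g' j) := by
    intro a ha b hb s t hst j
    have := h.spec ha hb hst (rename Sum.inr L * Yp k j - rename Sum.inr (g' j)) (by
      rw [map_sub, map_mul, Pair.aeval_inr, Pair.aeval_inr, hL, sub_self])
    rw [map_sub, map_mul, eval_rename, eval_rename, sub_eq_zero] at this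
    exact this
  let R : Fin 3 → MvPolynomial (Fin 3 ⊕ Fin 2) k :=
    ![rename Sum.inr L * X (.inl 0) ^ 2 - rename Sum.inr (g' 0) * X (.inl 0) + rename Sum.inr (g' 1),
      rename Sum.inr L * (X (.inl 1) - X (.inr 0) * X (.inl 0)) - rename Sum.inr (g' 2),
      rename Sum.inr L * (X (.inl 2) - X (.inr 1) * X (.inl 0)) - rename Sum.inr (g' 3)]
  have hform : ∀ a ∈ Z, ∀ b ∈ Z, ∀ s t : k, Slp a b s t → ∀ c : Fin 3 → k,
        eval (Sum.elim c ![s, t]) (R 0) = eval ![s, t] L * ((c 0 - a 0) * (c 0 - b 0)) ∧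
        eval (Sum.elim c ![s, t]) (R 1) = eval ![s, t] L * ((c 1 - a 1) - s * (c 0 - a 0)) ∧
        eval (Sum.elim c ![s, t]) (R 2) = eval ![s, t] L * ((c 2 - a 2) - t * (c 0 - a 0)) := by
    intro a ha b hb s t hst c
    have e0 := hs a ha b hb s t hst 0
    have e1 := hs a ha b hb s t hst 1
    have e2 := hs a ha b hb s t hst 2
    have e3 := hs a ha b hb s t hst 3
    simp [Yp, th] at e0 e1 e2 e3
    refine ⟨?_, ?_, ?_⟩ <;> simp [R, eval_rename]
    · linear_combination c 0 * e0 - e1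
    · linear_combination e2
    · linear_combination e3
  refine ⟨L, R, hL0, ?_, ?_, hform⟩
  · have e0 := hL 0
    have e1 := hL 1
    have e2 := hL 2
    have e3 := hL 3
    simp only [Yp, TH, Matrix.cons_val, map_add, map_mul, map_sub, aeval_X, Sum.elim_inl, Sum.elim_inr] at e0 e1 e2 e3
    intro i
    fin_cases i <;> simp [R, Pair.aevalTA_inr] <;> simp only [TA, Sum.elim_inl, Sum.elim_inr, Matrix.cons_val]
    · linear_combination ia (ξ 0) * e0 - e1
    · linear_combination e2
    · linear_combination e3
  · intro h0
    obtain ⟨a, ha, b, hb, s, t, hst, hθ⟩ := h.pick (rename Sum.inr L) (by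
      rw [Pair.aeval_inr]
      exact fun h0 => hL0 (algebraicIndependent_iff.1 h.A0 _ h0))
    rw [eval_rename] at hθ
    have hθ' : eval ![s, t] L ≠ 0 := hθ
    have h1 : aeval ξ ((X 0 - C (a 0)) * (X 0 - C (b 0))) = 0 := by
      rw [h.hg.rel]
      intro c hc
      have := Psi_eval h.hg h0 hc ![s, t]
      rw [(hform a ha b hb s t hst c).1] at this
      simpa using (mul_eq_zero.1 this).resolve_left hθ'
    rw [map_mul, map_sub, map_sub, aeval_X, aeval_C, aeval_C] at h1
    rcases mul_eq_zero.1 h1 with h2 | h2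
    · exact h.hZ.nc0 h.hg _ (sub_eq_zero.1 h2)
    · exact h.hZ.nc0 h.hg _ (sub_eq_zero.1 h2)

/-- the third point -/
theorem Pair.third (h : Pair Z ξ ia ib τ D Da Db) (L : MvPolynomial (Fin 2) k) {a b : Fin 3 → k} (hb : b ∈ Z)
    {s t : k} (hst : Slp a b s t) (hL : eval ![s, t] L ≠ 0) :
    ∃ b1 ∈ Z, ∃ s1 t1 : k, Slp a b1 s1 t1 ∧ b1 0 ≠ b 0 ∧ eval ![s1, t1] L ≠ 0 := by
  have hX : ξ 0 - algebraMap k K (a 0) ≠ 0 := sub_ne_zero.2 (h.hZ.nc0 h.hg _)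
  have hXb : ξ 0 - algebraMap k K (b 0) ≠ 0 := sub_ne_zero.2 (h.hZ.nc0 h.hg _)
  let sl : Fin 2 → K := ![(ξ 1 - algebraMap k K (a 1)) / (ξ 0 - algebraMap k K (a 0)), 
    (ξ 2 - algebraMap k K (a 2)) / (ξ 0 - algebraMap k K (a 0))]
  obtain ⟨V, hV, hVc⟩ := exists_V (k := k) ξ b (fun F hF => (h.hg.rel F).1 hF b hb)
  have hu : V.valuation (ξ 0 - algebraMap k K (a 0)) = 1 := 
    ((hVc 0).sub (Cong.const (a 0))).val_eq_one hV (sub_ne_zero.2 hst.1.symm)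
  have hdiv : ∀ (r : K) (q : k), r - algebraMap k K q * (ξ 0 - algebraMap k K (a 0)) = 
      (r / (ξ 0 - algebraMap k K (a 0)) - algebraMap k K q) * (ξ 0 - algebraMap k K (a 0)) := by
    intro r q; field_simp
  have hcs : ∀ i (q : k), b i - a i = q * (b 0 - a 0) → 
      Cong V ((ξ i - algebraMap k K (a i)) / (ξ 0 - algebraMap k K (a 0))) q := by
    intro i q hq
    have h1 : Cong V ((ξ i - algebraMap k K (a i)) - algebraMap k K q * (ξ 0 - algebraMap k K (a 0))) (0 : k) := by
      have := ((hVc i).sub (Cong.const (a i))).sub ((Cong.const q).mul hV ((hVc 0).sub (Cong.const (a 0))))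
      rwa [hq, sub_self] at this
    rw [cong_zero, hdiv, map_mul, hu, mul_one] at h1
    exact h1
  have hsl : ∀ i, Cong V (sl i) (![s, t] i) := by
    intro i
    fin_cases i
    · exact hcs 1 s (by linear_combination - hst.2.1)
    · exact hcs 2 t (by linear_combination - hst.2.2)
  have hLn : aeval sl L ≠ 0 := by
    intro h0
    exact hL (Cong.rel hV hsl h0)
  obtain ⟨c, hc, hcn⟩ := NS (Sum.elim ξ sl) (rename Sum.inr L * ((X (.inl 0) - C (a 0)) * (X (.inl 0) - C (b 0)))) (by
    simp only [map_mul, map_sub, aeval_X, aeval_C, aeval_rename, Sum.elim_comp_inr, Sum.elim_inl]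
    exact mul_ne_zero hLn (mul_ne_zero hX hXb))
  simp only [map_mul, map_sub, eval_X, eval_C, eval_rename] at hcn
  have hcc : c ∘ Sum.inr = ![c (.inr 0), c (.inr 1)] := by
    funext i; fin_cases i <;> rfl
  refine ⟨fun i => c (.inl i), ?_, c (.inr 0), c (.inr 1), ⟨?_, ?_, ?_⟩, ?_, ?_⟩
  · apply h.hZ.mem_of_rel h.hg
    intro F hF
    have := hc (rename Sum.inl F) (by rw [aeval_rename]; exact hF)
    rwa [eval_rename] at this
  · have := left_ne_zero_of_mul (right_ne_zero_of_mul hcn)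
    exact (sub_ne_zero.1 this).symm
  · have := hc (X (.inr 0) * (X (.inl 0) - C (a 0)) - (X (.inl 1) - C (a 1))) (by
      simp only [map_mul, map_sub, aeval_X, aeval_C, Sum.elim_inl, Sum.elim_inr, sl, Matrix.cons_val]
      rw [div_mul_cancel₀ _ hX, sub_self])
    simp only [map_mul, map_sub, eval_X, eval_C] at this
    linear_combination this
  · have := hc (X (.inr 1) * (X (.inl 0) - C (a 0)) - (X (.inl 2) - C (a 2))) (by
      simp only [map_mul, map_sub, aeval_X, aeval_C, Sum.elim_inl, Sum.elim_inr, sl, Matrix.cons_val]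
      rw [div_mul_cancel₀ _ hX, sub_self])
    simp only [map_mul, map_sub, eval_X, eval_C] at this
    linear_combination this
  · have := right_ne_zero_of_mul (right_ne_zero_of_mul hcn)
    exact sub_ne_zero.1 this
  · rw [← hcc]; exact left_ne_zero_of_mul hcn

/-- bad places -/
theorem bad (hT : TD1 k K) (G : MvPolynomial (Fin 2) K) (hG : G ≠ 0) {w : K} (hw : w ≠ 0) :
    ∃ N : MvPolynomial (Fin 2) k, N ≠ 0 ∧ ∀ V : ValuationSubring K, Over k V → V.valuation w < 1 →
      ∀ u0 u1 : Fin 2 → k, eval u0 N ≠ 0 → 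
      V.valuation (eval (fun i => algebraMap k K (u1 i)) G / eval (fun i => algebraMap k K (u0 i)) G) ≤ 1 := by
  classical
  obtain ⟨Φ, hΦ, hΦ0, hΦV⟩ := finRed hT hw (fun m : G.support => coeff m.1 G) (by
    intro h0
    apply hG
    ext m
    by_cases hm : m ∈ G.support
    · exact congrFun h0 ⟨m, hm⟩
    · simpa using hm)
  let q : (G.support → k) → MvPolynomial (Fin 2) k := fun φ => ∑ m : G.support, monomial m.1 (φ m)
  have hq : ∀ φ, φ ≠ 0 → q φ ≠ 0 := by
    intro φ hφ h0
    apply hφ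
    funext m
    have := congrArg (coeff m.1) h0
    simp only [q, coeff_sum, coeff_monomial, coeff_zero] at this
    rw [Finset.sum_eq_single m] at this
    · simpa using this
    · intro b _ hb
      rw [if_neg]
      exact fun h => hb (Subtype.ext h)
    · simp
  refine ⟨∏ φ ∈ hΦ.toFinset, q φ, Finset.prod_ne_zero_iff.2 fun φ hφ => hq φ (hΦ0 φ (by simpa using hφ)), ?_⟩
  intro V hV hVw u0 u1 hu0
  obtain ⟨φ, hφ, a, ha, hc⟩ := hΦV V hV hVw
  have hev : ∀ u : Fin 2 → k, Cong V (a * eval (fun i => algebraMap k K (u i)) G) (eval u (q φ)) := by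
    intro u
    have e1 : eval (fun i => algebraMap k K (u i)) G = ∑ m : G.support, coeff m.1 G * algebraMap k K (∏ i, u i ^ m.1 i) := by
      rw [eval_eq', ← Finset.sum_coe_sort]
      simp
    have e2 : eval u (q φ) = ∑ m : G.support, φ m * ∏ i, u i ^ m.1 i := by
      simp [q, eval_monomial, Finsupp.prod_fintype]
    rw [e1, e2, Finset.mul_sum]
    generalize (Finset.univ : Finset G.support) = S
    induction S using Finset.induction_on with
    | empty => simp only [Finset.sum_empty]; exact cong_zero.2 (by simp)
    | insert m S hm ih =>
      rw [Finset.sum_insert hm, Finset.sum_insert hm]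
      refine Cong.add ?_ ih
      rw [← mul_assoc]
      exact (hc m).mul hV (Cong.const _)
  have h0 : eval u0 (q φ) ≠ 0 := by
    rw [map_prod] at hu0
    exact Finset.prod_ne_zero_iff.1 hu0 φ (by simpa using hφ)
  rw [← mul_div_mul_left _ _ ha, map_div₀, (hev u0).val_eq_one hV h0, div_one]
  exact (hev u1).le_one hV

end
end S19

namespace S19
set_option linter.unusedSectionVars false

section
variable {k K E : Type} [Field k] [IsAlgClosed k] [CharZero k] [Field K] [Algebra k K] [Field E] [Algebra k E]
  {Z : Set (Fin 3 → k)} {ξ : Fin 3 → K} {ia ib : K →ₐ[k] E} {τ : E →ₐ[k] E} {D : Derivation k K K}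
    {Da Db : Derivation k E E}

theorem ddv_pevR (n : Fin 3 → MvPolynomial (Fin 3) k) (u : Fin 2 → k) (F : MvPolynomial (Fin 3 ⊕ Fin 2) k) :
    mkDerivation k n (pevR u F) = pevR u (ddv n F) := by
  have hadd : ∀ p q : MvPolynomial (Fin 3 ⊕ Fin 2) k, pevR u (p + q) = pevR u p + pevR u q := fun p q => by simp [pevR]
  have hmul : ∀ p q : MvPolynomial (Fin 3 ⊕ Fin 2) k, pevR u (p * q) = pevR u p * pevR u q := fun p q => by simp [pevR]
  induction F using MvPolynomial.induction_on with
  | C a =>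
    rw [derivation_C]
    have : pevR u (C a : MvPolynomial (Fin 3 ⊕ Fin 2) k) = C a := by simp [pevR]
    rw [this, derivation_C]; simp [pevR]
  | add p q hp hq => rw [hadd, map_add, map_add, hadd, hp, hq]
  | mul_X p j hp =>
    rw [hmul, Derivation.leibniz, Derivation.leibniz, hp, smul_eq_mul, smul_eq_mul, smul_eq_mul, smul_eq_mul, hadd, hmul, hmul]
    congr 2
    have hj : ddv n (X j) = (Sum.elim (fun i => rename Sum.inl (n i)) 0 : Fin 3 ⊕ Fin 2 → MvPolynomial (Fin 3 ⊕ Fin 2) k) j := mkDerivation_X _ _ _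
    rw [hj]
    rcases j with i | i
    · have : pevR u (X (Sum.inl i) : MvPolynomial (Fin 3 ⊕ Fin 2) k) = X i := by simp [pevR]
      rw [this, mkDerivation_X]
      simp only [pevR, Sum.elim_inl, aeval_rename, Sum.elim_comp_inl]
      exact (aeval_X_left_apply _).symm
    · have : pevR u (X (Sum.inr i) : MvPolynomial (Fin 3 ⊕ Fin 2) k) = C (u i) := by simp [pevR]
      rw [this, derivation_C]
      simp [pevR]

theorem Psi_pevR (u : Fin 2 → k) (F : MvPolynomial (Fin 3 ⊕ Fin 2) k) :
    eval (fun i => algebraMap k K (u i)) (Psi ξ F) = aeval ξ (pevR u F) := by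
  rw [aeval_pevR]
  change ((eval (fun i => algebraMap k K (u i))).comp (Psi ξ).toRingHom) F = (aeval _ : _ →ₐ[k] K).toRingHom F 
  congr 1
  ext i
  · simp [IsScalarTower.algebraMap_apply k K (MvPolynomial (Fin 2) K)]
  · rcases i with i | i <;> simp [Psi]

theorem Pair.den (h : Pair Z ξ ia ib τ D Da Db) : ∃ (d : MvPolynomial (Fin 3) k) (n : Fin 3 → MvPolynomial (Fin 3) k),
    aeval ξ d ≠ 0 ∧ ∀ i, aeval ξ d * D (ξ i) = aeval ξ (n i) := by
  classical
  choose F G hG hFG using fun i => h.hg.gen (D (ξ i))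
  refine ⟨∏ i, G i, fun i => (∏ j ∈ Finset.univ.erase i, G j) * F i, ?_, fun i => ?_⟩
  · rw [map_prod]; exact Finset.prod_ne_zero_iff.2 fun i _ => hG i
  · rw [← Finset.prod_erase_mul _ _ (Finset.mem_univ i), map_mul, map_mul, mul_assoc, hFG i, mul_div_cancel₀ _ (hG i)]

theorem Pair.geo (h : Pair Z ξ ia ib τ D Da Db) (ℓ g : Fin 4 → MvPolynomial (Fin 2) k) (hℓ : ∀ j, ℓ j ≠ 0)
    (hlg : ∀ j, aeval ![SS ξ ia ib 1, SS ξ ia ib 2] (ℓ j) * aeval (TH ξ ia ib) (Yp k j) =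
      aeval ![SS ξ ia ib 1, SS ξ ia ib 2] (g j)) :
    ∃ f : K, ∀ y : K, ∃ p q : Polynomial k, Polynomial.aeval f q ≠ 0 ∧ y = Polynomial.aeval f p / Polynomial.aeval f q := by
  classical
  obtain ⟨L, R, hL0, hRTA, hR0, hform⟩ := h.RR ℓ g hℓ hlg
  obtain ⟨d, n, hd, hn⟩ := h.den
  obtain ⟨G, hG, hGn, hGd, hGR⟩ := h.key hd hn (R 0) hR0 (hRTA 0)
  choose e he R' hR' using fun i => hGR (R i) (hRTA i)
  obtain ⟨Θ, hΘ, hΘg⟩ := good_ex h.hZ h.hg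
  have hT := h.hZ.td1 h.hg
  let δ := Θ * ∏ i, e i
  have hδ : aeval ξ δ ≠ 0 := by
    simp only [δ, map_mul, map_prod]
    exact mul_ne_zero hΘ (Finset.prod_ne_zero_iff.2 fun i _ => he i)
  have hδΘ : ∀ c, eval c δ ≠ 0 → eval c Θ ≠ 0 ∧ ∀ i, eval c (e i) ≠ 0 := by
    intro c hc
    simp only [δ, map_mul, map_prod] at hc
    exact ⟨left_ne_zero_of_mul hc, fun i => Finset.prod_ne_zero_iff.1 (right_ne_zero_of_mul hc) i (Finset.mem_univ i)⟩
  clear_value δ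
  obtain ⟨N0, hN0, hN0V⟩ := bad hT _ hGn hδ
  choose N1 hN1 hN1V using fun i => bad hT _ hGn (inv_ne_zero (show ξ i ≠ 0 by simpa using h.hZ.nc h.hg i 0))
  have hind : ∀ F : MvPolynomial (Fin 2) k, F ≠ 0 → aeval (TH ξ ia ib) (rename Sum.inr F) ≠ 0 := by
    intro F hF
    rw [Pair.aeval_inr]
    exact fun h0 => hF (algebraicIndependent_iff.1 h.A0 _ h0)
  have hTA : ∀ F : MvPolynomial (Fin 3 ⊕ Fin 2) k, aeval (TH ξ ia ib) (rename (Sum.map Sum.inl id) F) = aeval (TA ξ ia ib) F := by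
    intro F
    rw [aeval_rename]
    congr 2
    funext i; rcases i with i | i <;> rfl
  have hτS : ∀ i, τ (SS ξ ia ib i) = SS ξ ia ib i := by
    intro i
    simp only [SS, map_div₀, map_sub, h.τa, h.τb]
    rw [← neg_sub, ← neg_sub (ia (ξ 0)), neg_div_neg_eq]
  have hTB : ∀ F : MvPolynomial (Fin 3 ⊕ Fin 2) k, aeval (TH ξ ia ib) (rename (Sum.map Sum.inr id) F) = τ (aeval (TA ξ ia ib) F) := by
    intro F
    rw [aeval_rename, ← AlgHom.comp_apply, comp_aeval]
    congr 2
    funext i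
    rcases i with i | i
    · exact (h.τa _).symm
    · fin_cases i
      · exact (hτS 1).symm
      · exact (hτS 2).symm
  obtain ⟨a, ha, b, hb, s, t, hst, hθ⟩ := h.pick (rename Sum.inr (L * N0 * ∏ i, N1 i) * 
    (rename (fun i => Sum.inl (Sum.inl i)) δ * rename (fun i => Sum.inl (Sum.inr i)) δ) *
    (rename (Sum.map Sum.inl id) (ddv n G) * rename (Sum.map Sum.inr id) (ddv n G))) (by
    rw [map_mul, map_mul, map_mul (aeval (TH ξ ia ib)) (rename _ δ), map_mul (aeval (TH ξ ia ib)) (rename _ (ddv n G)), hTA, hTB]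
    refine mul_ne_zero (mul_ne_zero (hind _ (mul_ne_zero (mul_ne_zero hL0 hN0) (Finset.prod_ne_zero_iff.2 fun i _ => hN1 i))) 
      (mul_ne_zero ?_ ?_)) (mul_ne_zero hGd ((map_ne_zero τ).2 hGd))
    · rw [aeval_rename]
      change aeval (fun i => ia (ξ i)) δ ≠ 0
      have := comp_aeval ξ ia
      have := congrArg (fun f => f δ) this
      rw [← this]
      exact (map_ne_zero ia).2 hδ
    · rw [aeval_rename]
      change aeval (fun i => ib (ξ i)) δ ≠ 0
      have := comp_aeval ξ ib
      have := congrArg (fun f => f δ) this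
      rw [← this]
      exact (map_ne_zero ib).2 hδ)
  have hca : th a b s t ∘ Sum.map Sum.inl id = Sum.elim a ![s, t] := by
    funext i; rcases i with i | i <;> rfl
  have hcb : th a b s t ∘ Sum.map Sum.inr id = Sum.elim b ![s, t] := by
    funext i; rcases i with i | i <;> rfl
  simp only [map_mul, eval_rename, map_prod, hca, hcb] at hθ
  have hcs : th a b s t ∘ Sum.inr = ![s, t] := rfl
  have hc1 : th a b s t ∘ (fun i => Sum.inl (Sum.inl i)) = a := rfl
  have hc2 : th a b s t ∘ (fun i => Sum.inl (Sum.inr i)) = b := rfl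
  rw [hcs, hc1, hc2] at hθ
  simp only [mul_ne_zero_iff, Finset.prod_ne_zero_iff] at hθ
  obtain ⟨⟨⟨⟨hLs, hN0s⟩, hN1s⟩, hδa, hδb⟩, hda, hdb⟩ := hθ
  obtain ⟨b1, hb1, s1, t1, hst1, hb10, hLs1⟩ := h.third L hb hst hLs
  have hGz : ∀ a ∈ Z, ∀ b ∈ Z, ∀ s t : k, Slp a b s t → eval (Sum.elim a ![s, t]) G = 0 := by
    intro a ha b hb s t hst
    have := h.spec ha hb hst (rename (Sum.map Sum.inl id) G) (by rw [hTA, hG])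
    rw [eval_rename] at this
    convert this
    funext i; rcases i with i | i <;> rfl
  have hRz : ∀ c ∈ Z, eval c δ ≠ 0 → ∀ u, eval (Sum.elim c u) G = 0 → ∀ i, eval (Sum.elim c u) (R i) = 0 := by
    intro c hc hcδ u hcu i
    have := Psi_eval h.hg (hR' i) hc u
    rw [map_sub, map_mul, map_mul, hcu, zero_mul, sub_zero, eval_rename] at this
    exact (mul_eq_zero.1 this).resolve_left ((hδΘ c hcδ).2 i)
  let g0 := pevR ![s, t] G
  let g1 := pevR ![s1, t1] G
  have hg0a : eval a g0 = 0 := by rw [eval_pevR]; exact hGz a ha b hb s t hst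
  have hg0b : eval b g0 = 0 := by rw [eval_pevR]; exact hGz b hb a ha s t hst.symm
  have hg1a : eval a g1 = 0 := by rw [eval_pevR]; exact hGz a ha b1 hb1 s1 t1 hst1
  have hg1b : eval b g1 ≠ 0 := by
    rw [eval_pevR]
    intro h0
    have := hRz b hb hδb _ h0 0
    rw [(hform a ha b1 hb1 s1 t1 hst1 b).1] at this
    refine mul_ne_zero hLs1 (mul_ne_zero (sub_ne_zero.2 hst.1.symm) (sub_ne_zero.2 hb10.symm)) this
  have hd0 : ∀ c, eval (Sum.elim c ![s, t]) (ddv n G) = eval c (mkDerivation k n g0) := by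
    intro c; rw [ddv_pevR, eval_pevR]
  rw [hd0] at hda hdb
  have hXne : ∀ c : k, ξ 0 - algebraMap k K c ≠ 0 := fun c => sub_ne_zero.2 (h.hZ.nc0 h.hg c)
  have hvpos : ∀ (V : ValuationSubring K) (r : K), r ≠ 0 → 0 < V.valuation r := by
    intro V r hr; rw [zero_lt_iff]; simpa using hr
  -- the function
  obtain ⟨V0, hV0, hV0c⟩ := exists_V (k := k) ξ b (fun F hF => (h.hg.rel F).1 hF b hb)
  have hgb := hΘg b hb (hδΘ b hδb).1
  have hga := hΘg a ha (hδΘ a hδa).1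
  have hv0 : V0.valuation (aeval ξ g1 / aeval ξ g0) = (V0.valuation (ξ 0 - algebraMap k K (b 0)))⁻¹ := by
    rw [map_div₀, GP_simple h.hg hn hb hgb g0 hg0b hdb hV0 hV0c, (Cong.aeval hV0 hV0c g1).val_eq_one hV0 hg1b, one_div]
  refine ⟨aeval ξ g1 / aeval ξ g0, SP hT hV0 ?_ ?_ ?_⟩
  · rw [hv0, not_le]
    exact (one_lt_inv₀ (hvpos _ _ (hXne _))).2 (hV0c 0)
  · intro V hV hVne
    have hbad : ∀ N : MvPolynomial (Fin 2) k, eval ![s, t] N ≠ 0 → (∀ u0 u1 : Fin 2 → k, eval u0 N ≠ 0 → 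
      V.valuation (eval (fun i => algebraMap k K (u1 i)) (Psi ξ G) / eval (fun i => algebraMap k K (u0 i)) (Psi ξ G)) ≤ 1) →
        V.valuation (aeval ξ g1 / aeval ξ g0) ≤ 1 := by
      intro N hN h1
      have := h1 ![s, t] ![s1, t1] hN
      rwa [Psi_pevR, Psi_pevR] at this
    by_cases hξV : ∀ i, V.valuation (ξ i) ≤ 1
    · by_cases hδV : V.valuation (aeval ξ δ) < 1
      · exact hbad N0 hN0s (hN0V V hV hδV)
      · by_contra hcon
        choose c hc using fun i => res hT hV hcon (hξV i)
        have hcZ : c ∈ Z := h.hZ.mem_of_rel h.hg c fun F hF => Cong.rel hV hc hF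
        have hcδ : eval c δ ≠ 0 := by
          intro h0
          have := Cong.aeval hV hc δ
          rw [h0, cong_zero] at this
          exact hδV this
        apply hcon
        by_cases hcG : eval c g0 = 0
        · have hR := hRz c hcZ hcδ _ (by rw [← eval_pevR]; exact hcG)
          obtain ⟨f0, f1, f2⟩ := hform a ha b hb s t hst c
          rw [hR] at f0 f1 f2
          have k0 := (mul_eq_zero.1 f0.symm).resolve_left hLs
          have k1 := (mul_eq_zero.1 f1.symm).resolve_left hLs
          have k2 := (mul_eq_zero.1 f2.symm).resolve_left hLs
          rcases mul_eq_zero.1 k0 with k0 | k0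
          · have hca : c = a := by
              funext i
              fin_cases i
              · exact sub_eq_zero.1 k0
              · change c 1 = a 1
                linear_combination k1 + s * k0
              · change c 2 = a 2
                linear_combination k2 + t * k0
            rw [hca] at hc
            rw [map_div₀, GP_simple h.hg hn ha hga g0 hg0a hda hV hc]
            refine (div_le_one₀ (hvpos _ _ (hXne _))).2 ?_
            refine GP_max h.hZ h.hg ha hga hV hc _ ?_
            have := Cong.aeval hV hc g1
            rwa [hg1a, cong_zero] at this
          · exfalso
            have hcb : c = b := by
              funext i
              fin_cases i
              · exact sub_eq_zero.1 k0
              · change c 1 = b 1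
                linear_combination k1 + s * k0 + hst.2.1
              · change c 2 = b 2
                linear_combination k2 + t * k0 + hst.2.2
            rw [hcb] at hc
            exact hVne (GP_unique h.hZ h.hg hb hgb hV hc hV0 hV0c)
        · rw [map_div₀, (Cong.aeval hV hc g0).val_eq_one hV hcG, div_one]
          exact (Cong.aeval hV hc g1).le_one hV
    · push Not at hξV
      obtain ⟨i, hi⟩ := hξV
      exact hbad (N1 i) (hN1s i (Finset.mem_univ i)) (hN1V i V hV (inv_lt hi.not_ge).2)
  · intro r hr
    have := GP_max h.hZ h.hg hb hgb hV0 hV0c r hr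
    rw [map_mul, hv0, ← div_eq_mul_inv]
    exact (div_le_one₀ (hvpos _ _ (hXne _))).2 this

end
end S19

namespace S19
set_option linter.unusedSectionVars false

section
variable {k K : Type} [Field k] [Field K] [Algebra k K] 

theorem hom_scale {σ A : Type} [Fintype σ] [CommRing A] [Algebra k A] {F : MvPolynomial σ k} {m : ℕ} (hF : F.IsHomogeneous m) (r : A) (v : σ → A) :
    aeval (fun i => r * v i) F = r ^ m * aeval v F := by
  rw [aeval_def, aeval_def, eval₂_eq', eval₂_eq', Finset.mul_sum]
  refine Finset.sum_congr rfl fun d hd => ?_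
  have h1 := hF (mem_support_iff.1 hd)
  have h2 : ∑ i, d i = m := by
    rw [← h1, Finsupp.weight_apply, Finsupp.sum_fintype] <;> simp
  simp only [mul_pow, Finset.prod_mul_distrib, Finset.prod_pow_eq_pow_sum, h2]
  ring

theorem hom_scale_eval {σ : Type} [Fintype σ] {F : MvPolynomial σ k} {m : ℕ} (hF : F.IsHomogeneous m) (r : k) (v : σ → k) :
    eval (fun i => r * v i) F = r ^ m * eval v F := by
  have := hom_scale (A := k) hF r v
  simpa [aeval_eq_eval] using this

theorem homog_at {σ : Type} [Fintype σ] (i : σ) (F : MvPolynomial σ k) : ∃ (m : ℕ) (H : MvPolynomial σ k), H.IsHomogeneous m ∧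
    ∀ (A : Type) [Field A] [Algebra k A] (ζ : σ → A), ζ i ≠ 0 → aeval ζ H = ζ i ^ m * aeval (fun j => ζ j / ζ i) F := by
  let m := F.totalDegree
  refine ⟨m, ∑ j ∈ Finset.range (m + 1), X i ^ (m - j) * homogeneousComponent j F, ?_, ?_⟩
  · refine IsHomogeneous.sum _ _ _ fun j hj => ?_
    have h1 : (X i ^ (m - j) : MvPolynomial σ k).IsHomogeneous (m - j) := by
      simpa using (isHomogeneous_X k i).pow (m - j)
    have := h1.mul (homogeneousComponent_isHomogeneous j F)
    rwa [Nat.sub_add_cancel (by simp at hj; omega)] at this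
  · intro A _ _ ζ hζ
    conv_rhs => rw [← sum_homogeneousComponent F]
    rw [map_sum, map_sum, Finset.mul_sum]
    refine Finset.sum_congr rfl fun j hj => ?_
    rw [map_mul, map_pow, aeval_X]
    have h1 := hom_scale (homogeneousComponent_isHomogeneous j F) (ζ i) (fun j => ζ j / ζ i)
    have h2 : (fun j => ζ i * (ζ j / ζ i)) = ζ := by
      funext j; rw [mul_div_cancel₀ _ hζ]
    rw [h2] at h1
    rw [h1, ← mul_assoc, ← pow_add, Nat.sub_add_cancel (by simp at hj; omega)]

/-- homogenization in two variables -/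
def hom2 (d : ℕ) (p : Polynomial k) : MvPolynomial (Fin 2) k :=
  ∑ j ∈ Finset.range (d + 1), C (p.coeff j) * (X 0 ^ j * X 1 ^ (d - j))

theorem hom2_hom (d : ℕ) (p : Polynomial k) : (hom2 d p).IsHomogeneous d := by
  refine IsHomogeneous.sum _ _ _ fun j hj => ?_
  have h1 : (X 0 ^ j : MvPolynomial (Fin 2) k).IsHomogeneous j := by
    simpa using (isHomogeneous_X k (0 : Fin 2)).pow j
  have h2 : (X 1 ^ (d - j) : MvPolynomial (Fin 2) k).IsHomogeneous (d - j) := by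
    simpa using (isHomogeneous_X k (1 : Fin 2)).pow (d - j)
  have := (isHomogeneous_C (Fin 2) (p.coeff j)).mul (h1.mul h2)
  rwa [zero_add, Nat.add_sub_cancel' (by simp at hj; omega)] at this

theorem hom2_aeval {d : ℕ} {p : Polynomial k} (hp : p.natDegree ≤ d) {A : Type} [Field A] [Algebra k A] (x y : A) (hy : y ≠ 0) :
    aeval ![x, y] (hom2 d p) = y ^ d * Polynomial.aeval (x / y) p := by
  rw [Polynomial.aeval_eq_sum_range' (n := d + 1) (by omega), hom2, map_sum, Finset.mul_sum]
  refine Finset.sum_congr rfl fun j hj => ?_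
  simp only [map_mul, map_pow, aeval_X, aeval_C, Matrix.cons_val, Algebra.smul_def]
  have : y ^ d = y ^ (d - j) * y ^ j := by rw [← pow_add, Nat.sub_add_cancel (by simp at hj; omega)]
  rw [this, div_pow]
  field_simp

theorem hom2_inf {d : ℕ} {p : Polynomial k} : eval ![1, 0] (hom2 d p) = p.coeff d := by
  rw [hom2, map_sum, Finset.sum_eq_single d]
  · simp
  · intro j hj hjd
    simp at hj
    have : d - j ≠ 0 := by omega
    simp [this]
  · simp

variable [IsAlgClosed k] 

theorem RP_num {f : K} (hgen : ∀ y : K, ∃ p q : Polynomial k, Polynomial.aeval f q ≠ 0 ∧ y = Polynomial.aeval f p / Polynomial.aeval f q)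
    (ζ : Fin 4 → K) (hζ : ζ ≠ 0) : ∃ (n : Fin 4 → Polynomial k) (ρ : K), ρ ≠ 0 ∧ (∀ i, ζ i = ρ * Polynomial.aeval f (n i)) ∧
      ∀ x : k, ∃ i, (n i).eval x ≠ 0 := by
  classical
  let : StrongNormalizationMonoid (Polynomial k) := UniqueFactorizationMonoid.strongNormalizationMonoid
  let : StrongNormalizedGCDMonoid (Polynomial k) := UniqueFactorizationMonoid.toStrongNormalizedGCDMonoid _
  choose p q hq hpq using fun i => hgen (ζ i)
  let N : Fin 4 → Polynomial k := fun i => (∏ j ∈ Finset.univ.erase i, q j) * p i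
  have hQ : Polynomial.aeval f (∏ j, q j) ≠ 0 := by
    rw [map_prod]; exact Finset.prod_ne_zero_iff.2 fun j _ => hq j
  have hN : ∀ i, ζ i * Polynomial.aeval f (∏ j, q j) = Polynomial.aeval f (N i) := by
    intro i
    rw [← Finset.prod_erase_mul _ _ (Finset.mem_univ i), map_mul, hpq i]
    simp only [N, map_mul]
    have := hq i
    field_simp
  obtain ⟨n, hn, hn1⟩ := Finset.extract_gcd N (Finset.univ_nonempty)
  refine ⟨n, Polynomial.aeval f (Finset.univ.gcd N) / Polynomial.aeval f (∏ j, q j), ?_, ?_, ?_⟩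
  · refine div_ne_zero ?_ hQ
    intro h0
    apply hζ
    funext i
    have := hN i
    rw [hn i (Finset.mem_univ i), map_mul, h0, zero_mul] at this
    exact (mul_eq_zero.1 this).resolve_right hQ
  · intro i
    rw [div_mul_eq_mul_div, ← map_mul, ← hn i (Finset.mem_univ i), ← hN, mul_div_cancel_right₀ _ hQ]
  · intro x
    by_contra hx
    push Not at hx
    have : (Polynomial.X - Polynomial.C x) ∣ Finset.univ.gcd n := Finset.dvd_gcd fun i _ => Polynomial.dvd_iff_isRoot.2 (hx i)
    rw [hn1] at this
    exact Polynomial.not_isUnit_X_sub_C x (isUnit_of_dvd_one this)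

theorem RP (hT : TD1 k K) {f : K} (hf : ∀ c : k, f ≠ algebraMap k K c)
    (hgen : ∀ y : K, ∃ p q : Polynomial k, Polynomial.aeval f q ≠ 0 ∧ y = Polynomial.aeval f p / Polynomial.aeval f q)
    (ζ : Fin 4 → K) (hζ : ζ ≠ 0) : ∃ (d : ℕ) (G : Fin 4 → MvPolynomial (Fin 2) k), (∀ i, (G i).IsHomogeneous d) ∧
      (∀ (F : MvPolynomial (Fin 4) k) (m : ℕ), F.IsHomogeneous m → aeval ζ F = 0 → ∀ v, eval (fun i => eval v (G i)) F = 0) ∧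
      ∀ w : Fin 4 → k, w ≠ 0 → (∀ (F : MvPolynomial (Fin 4) k) (m : ℕ), F.IsHomogeneous m → aeval ζ F = 0 → eval w F = 0) →
        ∃ (v : Fin 2 → k) (r : k), r ≠ 0 ∧ ∀ i, eval v (G i) = r * w i := by
  obtain ⟨n, ρ, hρ, hn, hcop⟩ := RP_num hgen ζ hζ
  have hft := transcendental_iff.1 (transc hf)
  have hinf : Infinite k := IsAlgClosed.instInfinite
  let d := Finset.univ.sup fun i => (n i).natDegree
  have hd : ∀ i, (n i).natDegree ≤ d := fun i => Finset.le_sup (f := fun i => (n i).natDegree) (Finset.mem_univ i)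
  have hev : ∀ (i) (v : Fin 2 → k), v 1 ≠ 0 → eval v (hom2 d (n i)) = v 1 ^ d * (n i).eval (v 0 / v 1) := by
    intro i v hv
    have := hom2_aeval (hd i) (v 0) (v 1) hv
    rw [aeval_eq_eval] at this
    have e : v = ![v 0, v 1] := by funext i; fin_cases i <;> rfl
    rw [e]
    simpa using this
  refine ⟨d, fun i => hom2 d (n i), fun i => hom2_hom d _, ?_, ?_⟩
  · intro F m hF hF0
    have h1 : aeval (fun i => Polynomial.aeval f (n i)) F = 0 := by
      have := hom_scale hF ρ (fun i => Polynomial.aeval f (n i))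
      rw [show (fun i => ρ * Polynomial.aeval f (n i)) = ζ from funext fun i => (hn i).symm, hF0] at this
      exact (mul_eq_zero.1 this.symm).resolve_left (pow_ne_zero _ hρ)
    have h2 : aeval n F = 0 := by
      apply hft
      rw [← AlgHom.comp_apply, comp_aeval]
      exact h1
    have h3 : ∀ x : k, eval (fun i => (n i).eval x) F = 0 := by
      intro x
      have := congrArg (Polynomial.aeval x) h2
      rw [map_zero, ← AlgHom.comp_apply, comp_aeval, aeval_eq_eval] at this
      simpa using this
    have h4 : aeval (fun i => hom2 d (n i)) F * X 1 = 0 := by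
      apply MvPolynomial.funext
      intro v
      rw [map_mul, eval_X, map_zero]
      by_cases hv : v 1 = 0
      · rw [hv, mul_zero]
      · have e1 : eval v (aeval (fun i => hom2 d (n i)) F) = eval (fun i => eval v (hom2 d (n i))) F := by
          have := congrArg (fun g => g F) (comp_aeval (fun i => hom2 d (n i)) (aeval v : MvPolynomial (Fin 2) k →ₐ[k] k))
          simpa [aeval_eq_eval] using this
        rw [e1]
        simp only [hev _ v hv]
        rw [hom_scale_eval hF, h3, mul_zero, zero_mul]
    have h5 := (mul_eq_zero.1 h4).resolve_right (X_ne_zero 1)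
    intro v
    have e1 : eval v (aeval (fun i => hom2 d (n i)) F) = eval (fun i => eval v (hom2 d (n i))) F := by
      have := congrArg (fun g => g F) (comp_aeval (fun i => hom2 d (n i)) (aeval v : MvPolynomial (Fin 2) k →ₐ[k] k))
      simpa [aeval_eq_eval] using this
    rw [← e1, h5, map_zero]
  · intro w hw hwF
    obtain ⟨i, hi⟩ := Function.ne_iff.1 hw
    have hi' : w i ≠ 0 := hi
    have hζi : ζ i ≠ 0 := by
      intro h0
      exact hi' (by simpa using hwF (X i) 1 (isHomogeneous_X k i) (by simpa using h0))
    obtain ⟨V, hV, hVc⟩ := exists_V (k := k) (fun j => ζ j / ζ i) (fun j => w j / w i) (by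
      intro F hF
      obtain ⟨m, H, hH, hHF⟩ := homog_at i F
      have h1 := hwF H m hH (by rw [hHF K ζ hζi, hF, mul_zero])
      have h2 := hHF k w hi'
      rw [aeval_eq_eval, aeval_eq_eval] at h2
      change eval w H = w i ^ m * eval _ F at h2
      rw [h1] at h2
      exact (mul_eq_zero.1 h2.symm).resolve_left (pow_ne_zero _ hi'))
    have hrel : ∀ j, Polynomial.aeval f (n j) = ζ j / ζ i * Polynomial.aeval f (n i) := by
      intro j
      have h1 : Polynomial.aeval f (n i) ≠ 0 := by
        intro h0; rw [hn i, h0, mul_zero] at hζi; exact hζi rfl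
      rw [hn i, hn j]
      field_simp
    -- it suffices to find v
    suffices ∃ v : Fin 2 → k, (∃ j, eval v (hom2 d (n j)) ≠ 0) ∧ ∀ j, eval v (hom2 d (n j)) = w j / w i * eval v (hom2 d (n i)) by
      obtain ⟨v, ⟨j, hj⟩, hv⟩ := this
      have h1 : eval v (hom2 d (n i)) ≠ 0 := by
        intro h0
        rw [hv j, h0, mul_zero] at hj
        exact hj rfl
      refine ⟨v, eval v (hom2 d (n i)) / w i, div_ne_zero h1 hi', fun j => ?_⟩
      rw [hv j]; ring
    have hone : ∀ x : k, (∀ j, (n j).eval x = w j / w i * (n i).eval x) → ∃ v : Fin 2 → k, (∃ j, eval v (hom2 d (n j)) ≠ 0) ∧ ∀ j, eval v (hom2 d (n j)) = w j / w i * eval v (hom2 d (n i)) := by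
      intro x hx
      have e : ∀ j, eval ![x, 1] (hom2 d (n j)) = (n j).eval x := by
        intro j
        rw [hev j _ (by simp)]; simp
      refine ⟨![x, 1], ?_, ?_⟩
      · simp only [e]; exact hcop x
      · simp only [e]; exact hx
    by_cases hfV : V.valuation f ≤ 1
    · by_cases htriv : ∃ z : K, ¬ V.valuation z ≤ 1
      · obtain ⟨z, hz⟩ := htriv
        obtain ⟨x, hx⟩ := res hT hV hz hfV
        refine hone x fun j => ?_
        have h1 := Cong.paeval hV hx (n j)
        have h2 := Cong.paeval hV hx (n i)
        have h3 := (hVc j).mul hV h2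
        rw [← hrel] at h3
        exact h1.unique hV h3
      · push Not at htriv
        have h0 : ∀ r : K, V.valuation r < 1 → r = 0 := by
          intro r hr
          by_contra hr0
          have := htriv r⁻¹
          rw [map_inv₀] at this
          have h2 := vml this hr
          rw [inv_mul_cancel₀ (by simpa using hr0)] at h2
          exact lt_irrefl _ h2
        have h1 : ∀ j, ζ j / ζ i = algebraMap k K (w j / w i) := fun j => sub_eq_zero.1 (h0 _ (hVc j))
        refine hone 0 fun j => ?_
        have h2 : n j = Polynomial.C (w j / w i) * n i := by
          rw [← sub_eq_zero]
          apply hft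
          rw [map_sub, map_mul, Polynomial.aeval_C, hrel j, h1, sub_self]
        rw [h2]; simp
    · obtain ⟨hf0, hfi⟩ := inv_lt hfV
      refine ⟨![1, 0], ?_, ?_⟩
      · simp only [hom2_inf]
        obtain ⟨j, -, hj⟩ := Finset.exists_mem_eq_sup (Finset.univ : Finset (Fin 4)) Finset.univ_nonempty fun i => (n i).natDegree
        by_cases hnj : n j = 0
        · have hd0 : d = 0 := by
            change Finset.univ.sup _ = 0
            rw [hj, hnj]; simp
          obtain ⟨l, hl⟩ := hcop 0
          refine ⟨l, ?_⟩
          rw [hd0]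
          rwa [Polynomial.coeff_zero_eq_eval_zero]
        · refine ⟨j, ?_⟩
          have hd0 : d = (n j).natDegree := hj
          rw [hd0]
          exact Polynomial.leadingCoeff_ne_zero.2 hnj
      · intro j
        have hc : ∀ l, Cong V ((f⁻¹) ^ d * Polynomial.aeval f (n l)) (eval ![1, 0] (hom2 d (n l))) := by
          intro l
          have h1 := hom2_aeval (hd l) 1 f⁻¹ (inv_ne_zero hf0)
          rw [one_div, inv_inv] at h1
          rw [← h1]
          refine Cong.aeval hV (fun i => ?_) _
          fin_cases i
          · have := Cong.const (V := V) (1 : k)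
            simpa using this
          · exact cong_zero.2 hfi
        have h3 := (hVc j).mul hV (hc i)
        have h4 := hc j
        rw [hrel] at h4
        refine h4.unique hV ?_
        convert h3 using 1
        ring

end
end S19

namespace S19
set_option linter.unusedSectionVars false

theorem irr_sub {X : Type} [TopologicalSpace X] {C T : Set X} (hTC : T ⊆ C) (hT : IsIrreducible T) :
    IsIrreducible ((Subtype.val : C → X) ⁻¹' T) := by
  obtain ⟨⟨x, hx⟩, hp⟩ := hT
  refine ⟨⟨⟨x, hTC hx⟩, hx⟩, ?_⟩
  rintro u v hu hv ⟨y, hyT, hyu⟩ ⟨z, hzT, hzv⟩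
  obtain ⟨u', hu', rfl⟩ := isOpen_induced_iff.1 hu
  obtain ⟨v', hv', rfl⟩ := isOpen_induced_iff.1 hv
  obtain ⟨w, hw, hw2⟩ := hp u' v' hu' hv' ⟨y, hyT, hyu⟩ ⟨z, hzT, hzv⟩
  exact ⟨⟨w, hTC hw⟩, hw, hw2⟩

theorem dim1_fin {X : Type} [TopologicalSpace X] [TopologicalSpace.NoetherianSpace X] [T1Space X] {C Y : Set X}
    (hC : IsClosed C) (hCi : IsIrreducible C) (hd : topologicalKrullDim C = 1) (hY : IsClosed Y) (hYC : Y ⊆ C) (hne : Y ≠ C) :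
    Y.Finite := by
  obtain ⟨S, hS, hSc, hSi, rfl⟩ := TopologicalSpace.NoetherianSpace.exists_finite_set_isClosed_irreducible hY
  refine Set.Finite.sUnion hS fun T hT => ?_
  have hTC : T ⊆ C := (Set.subset_sUnion_of_mem hT).trans hYC
  obtain ⟨x, hx⟩ := (hSi T hT).1
  by_contra hinf
  have hTx : T ≠ {x} := by rintro rfl; exact hinf (Set.finite_singleton x)
  let A0 : TopologicalSpace.IrreducibleCloseds C := ⟨Subtype.val ⁻¹' {x}, irr_sub (by simpa using hTC hx) isIrreducible_singleton,
    isClosed_singleton.preimage continuous_subtype_val⟩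
  let A1 : TopologicalSpace.IrreducibleCloseds C := ⟨Subtype.val ⁻¹' T, irr_sub hTC (hSi T hT),
    (hSc T hT).preimage continuous_subtype_val⟩
  let A2 : TopologicalSpace.IrreducibleCloseds C := ⟨Subtype.val ⁻¹' C, irr_sub subset_rfl hCi,
    hC.preimage continuous_subtype_val⟩
  have h01 : A0 < A1 := by
    rw [← SetLike.coe_ssubset_coe]
    refine ⟨fun y hy => ?_, fun h => hTx ?_⟩
    · have : y.1 = x := hy
      change y.1 ∈ T
      rwa [this]
    · refine Set.Subset.antisymm (fun y hy => ?_) (by simpa using hx)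
      exact h (show (⟨y, hTC hy⟩ : C) ∈ (A1 : Set C) from hy)
  have h12 : A1 < A2 := by
    rw [← SetLike.coe_ssubset_coe]
    refine ⟨fun y hy => y.2, fun h => hne ?_⟩
    refine Set.Subset.antisymm hYC fun y hy => ?_
    exact ⟨T, hT, h (show (⟨y, hy⟩ : C) ∈ (A2 : Set C) from hy)⟩
  let p : LTSeries (TopologicalSpace.IrreducibleCloseds C) :=
    { length := 2, toFun := ![A0, A1, A2], step := by intro i; fin_cases i <;> assumption }
  have := Order.LTSeries.length_le_krullDim p
  rw [show Order.krullDim (TopologicalSpace.IrreducibleCloseds C) = 1 from hd] at this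
  have h2 : ((2 : ℕ) : WithBot ℕ∞) ≤ 1 := this
  have h3 : ((2 : ℕ) : WithBot ℕ∞) ≤ ((1 : ℕ) : WithBot ℕ∞) := by simpa using h2
  have h4 := (Nat.cast_le (α := WithBot ℕ∞)).1 h3
  omega

theorem ev_mk {F : MvPolynomial (Fin 4) QBar} {m : ℕ} (hF : F.IsHomogeneous m) (w : Fin 4 → QBar) (hw : w ≠ 0) :
    eval (Projectivization.mk QBar w hw).rep F = 0 ↔ eval w F = 0 := by
  obtain ⟨a, ha⟩ := Projectivization.exists_smul_eq_mk_rep QBar w hw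
  rw [← ha]
  have := hom_scale_eval hF (a : QBar) w
  change eval (fun i => (a : QBar) * w i) F = 0 ↔ _
  rw [this]
  simp

theorem open_basic {U : Set P3Bar} (hU : @IsOpen _ zariskiP3 U) {x : P3Bar} (hx : x ∈ U) :
    ∃ (f : MvPolynomial (Fin 4) QBar) (d : ℕ), f.IsHomogeneous d ∧ eval x.rep f ≠ 0 ∧ ∀ y : P3Bar, eval y.rep f ≠ 0 → y ∈ U := by
  have hU' : TopologicalSpace.GenerateOpen {U | ∃ f : MvPolynomial (Fin 4) QBar, (∃ d, f.IsHomogeneous d) ∧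
      U = {x : P3Bar | eval x.rep f ≠ 0}} U := hU
  clear hU
  induction hU' with
  | basic s hs =>
    obtain ⟨f, ⟨d, hd⟩, rfl⟩ := hs
    exact ⟨f, d, hd, hx, fun y hy => hy⟩
  | univ => exact ⟨1, 0, isHomogeneous_one _ _, by simp, fun y _ => trivial⟩
  | inter s t _ _ ih1 ih2 =>
    obtain ⟨f, d, hf, hfx, hfU⟩ := ih1 hx.1
    obtain ⟨g, e, hg, hgx, hgU⟩ := ih2 hx.2
    refine ⟨f * g, d + e, hf.mul hg, by simpa using ⟨hfx, hgx⟩, fun y hy => ?_⟩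
    rw [map_mul] at hy
    exact ⟨hfU y (left_ne_zero_of_mul hy), hgU y (right_ne_zero_of_mul hy)⟩
  | sUnion S _ ih =>
    obtain ⟨s, hs, hxs⟩ := hx
    obtain ⟨f, d, hf, hfx, hfU⟩ := ih s hs hxs
    exact ⟨f, d, hf, hfx, fun y hy => ⟨s, hs, hfU y hy⟩⟩

theorem basic_open {f : MvPolynomial (Fin 4) QBar} {d : ℕ} (hf : f.IsHomogeneous d) :
    @IsOpen _ zariskiP3 {x : P3Bar | eval x.rep f ≠ 0} :=
  TopologicalSpace.GenerateOpen.basic _ ⟨f, ⟨d, hf⟩, rfl⟩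

theorem basic_closed {f : MvPolynomial (Fin 4) QBar} {d : ℕ} (hf : f.IsHomogeneous d) :
    @IsClosed _ zariskiP3 {x : P3Bar | eval x.rep f = 0} := by
  let _ := zariskiP3
  have : {x : P3Bar | eval x.rep f = 0} = {x : P3Bar | eval x.rep f ≠ 0}ᶜ := by ext; simp
  rw [this]
  exact (basic_open hf).isClosed_compl

theorem closed_sep {A : Set P3Bar} (hA : @IsClosed _ zariskiP3 A) {x : P3Bar} (hx : x ∉ A) :
    ∃ (f : MvPolynomial (Fin 4) QBar) (d : ℕ), f.IsHomogeneous d ∧ eval x.rep f ≠ 0 ∧ ∀ y ∈ A, eval y.rep f = 0 := by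
  obtain ⟨f, d, hf, hfx, h⟩ := open_basic (U := Aᶜ) (@IsClosed.isOpen_compl _ zariskiP3 A hA) hx
  refine ⟨f, d, hf, hfx, fun y hy => ?_⟩
  by_contra h0
  exact h y h0 hy

theorem noeth : @TopologicalSpace.NoetherianSpace P3Bar zariskiP3 := by
  let _ := zariskiP3
  refine ((TopologicalSpace.noetherianSpace_TFAE P3Bar).out 0 1).2 ?_
  let I : TopologicalSpace.Closeds P3Bar → Ideal (MvPolynomial (Fin 4) QBar) := fun A =>
    Ideal.span {f | ∃ d, f.IsHomogeneous d ∧ ∀ y ∈ A, eval y.rep f = 0}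
  have hI : StrictAnti I := by
    intro A B hAB
    refine lt_of_le_not_ge ?_ ?_
    · refine Ideal.span_mono ?_
      rintro f ⟨d, hf, h⟩
      exact ⟨d, hf, fun y hy => h y (hAB.le hy)⟩
    · intro hle
      obtain ⟨x, hxB, hxA⟩ := SetLike.exists_of_lt hAB
      obtain ⟨f, d, hf, hfx, hfA⟩ := closed_sep A.isClosed hxA
      have h1 : f ∈ I B := hle (Ideal.subset_span ⟨d, hf, hfA⟩)
      have h2 : I B ≤ RingHom.ker (eval x.rep) := by
        refine Ideal.span_le.2 ?_
        rintro g ⟨e, -, h⟩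
        exact h x hxB
      exact hfx (h2 h1)
  have : WellFoundedGT (Ideal (MvPolynomial (Fin 4) QBar)) := inferInstance
  exact ⟨(InvImage.wf I this.wf).mono fun A B h => hI h⟩

theorem t1 : @T1Space P3Bar zariskiP3 := by
  let _ := zariskiP3
  refine ⟨fun x => ?_⟩
  have : ({x} : Set P3Bar) = ⋂ i : Fin 4, ⋂ j : Fin 4, {y : P3Bar | eval y.rep (C (x.rep i) * X j - C (x.rep j) * X i) = 0} := by
    ext y
    simp only [Set.mem_singleton_iff, Set.mem_iInter, Set.mem_setOf_eq, map_sub, map_mul, eval_C, eval_X]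
    constructor
    · rintro rfl i j; ring
    · intro h
      obtain ⟨i, hi⟩ := Function.ne_iff.1 x.rep_nonzero
      have hi' : x.rep i ≠ 0 := hi
      rw [← y.mk_rep, ← x.mk_rep]
      rw [Projectivization.mk_eq_mk_iff']
      refine ⟨y.rep i / x.rep i, ?_⟩
      funext j
      have := h i j
      simp only [Pi.smul_apply, smul_eq_mul]
      field_simp
      linear_combination -this
  rw [this]
  refine isClosed_iInter fun i => isClosed_iInter fun j => basic_closed (d := 1) ?_
  refine IsHomogeneous.sub ?_ ?_
  · simpa using (isHomogeneous_C (Fin 4) (x.rep i)).mul (isHomogeneous_X QBar j)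
  · simpa using (isHomogeneous_C (Fin 4) (x.rep j)).mul (isHomogeneous_X QBar i)

end S19

namespace S19
set_option linter.unusedSectionVars false

/-- cone over a projective curve, with its properties -/
structure PC {k : Type} [Field k] (CC : Set (Fin 4 → k)) : Prop where
  nz : ∀ w ∈ CC, w ≠ 0
  sc : ∀ w ∈ CC, ∀ r : k, r ≠ 0 → (fun i => r * w i) ∈ CC
  irr : ∀ (F G : MvPolynomial (Fin 4) k) (m n : ℕ), F.IsHomogeneous m → G.IsHomogeneous n →
    (∀ w ∈ CC, eval w F * eval w G = 0) → (∀ w ∈ CC, eval w F = 0) ∨ (∀ w ∈ CC, eval w G = 0)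
  fin : ∀ (F : MvPolynomial (Fin 4) k) (m : ℕ), F.IsHomogeneous m → (∃ w ∈ CC, eval w F ≠ 0) →
    ∃ T : Finset (Fin 4 → k), ∀ w ∈ CC, eval w F = 0 → ∃ t ∈ T, ∃ r : k, r ≠ 0 ∧ w = fun i => r * t i
  closed : ∀ w : Fin 4 → k, w ≠ 0 → (∀ (F : MvPolynomial (Fin 4) k) (m : ℕ), F.IsHomogeneous m → 
    (∀ b ∈ CC, eval b F = 0) → eval w F = 0) → w ∈ CC
  npl : ∀ e : Fin 4 → k, (∀ w ∈ CC, ∑ i, e i * w i = 0) → e = 0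

section
variable {k : Type} [Field k] [CharZero k] (c : Fin 4 → ℚ) (i0 : Fin 4)

/-- the linear form -/
def Lf (w : Fin 4 → k) : k := ∑ i, (c i : k) * w i

/-- inverse coordinates -/
def vec (r : k) (v : Fin 3 → k) : Fin 4 → k :=
  i0.insertNth ((r - ∑ j, (c (i0.succAbove j) : k) * v j) / (c i0 : k)) v

theorem Lf_eq (w : Fin 4 → k) : Lf c w = (c i0 : k) * w i0 + ∑ j, (c (i0.succAbove j) : k) * w (i0.succAbove j) := by
  rw [Lf, Fin.sum_univ_succAbove _ i0]

variable {c i0} (hi : c i0 ≠ 0)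

theorem vec_succ (r : k) (v : Fin 3 → k) (j : Fin 3) : vec c i0 r v (i0.succAbove j) = v j := by
  simp [vec]

theorem vec_i0 (r : k) (v : Fin 3 → k) : vec c i0 r v i0 = (r - ∑ j, (c (i0.succAbove j) : k) * v j) / (c i0 : k) := by
  simp [vec]

theorem Lf_vec (hi : c i0 ≠ 0) (r : k) (v : Fin 3 → k) : Lf c (vec c i0 r v) = r := by
  have : (c i0 : k) ≠ 0 := by exact_mod_cast hi
  rw [Lf_eq c i0, vec_i0]
  simp only [vec_succ]
  field_simp
  ring

theorem eq_vec (hi : c i0 ≠ 0) (w : Fin 4 → k) : w = vec c i0 (Lf c w) fun j => w (i0.succAbove j) := by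
  have : (c i0 : k) ≠ 0 := by exact_mod_cast hi
  funext i
  rcases Fin.eq_self_or_eq_succAbove i0 i with rfl | ⟨j, rfl⟩
  · rw [vec_i0, Lf_eq c i]
    field_simp
    ring
  · rw [vec_succ]

theorem Lf_ext (hi : c i0 ≠ 0) {w w' : Fin 4 → k} (h1 : Lf c w = Lf c w') (h2 : ∀ j, w (i0.succAbove j) = w' (i0.succAbove j)) : w = w' := by
  rw [eq_vec hi w, eq_vec hi w', h1]
  simp only [h2]

theorem Lf_smul (r : k) (w : Fin 4 → k) : Lf c (fun i => r * w i) = r * Lf c w := by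
  rw [Lf, Lf, Finset.mul_sum]
  exact Finset.sum_congr rfl fun i _ => by ring

theorem Lf_lin (r r' : k) (w w' : Fin 4 → k) : Lf c (fun i => r * w i + r' * w' i) = r * Lf c w + r' * Lf c w' := by
  rw [Lf, Lf, Lf, Finset.mul_sum, Finset.mul_sum, ← Finset.sum_add_distrib]
  exact Finset.sum_congr rfl fun i _ => by ring

theorem vec_smul (hi : c i0 ≠ 0) (a r : k) (v : Fin 3 → k) : (fun i => a * vec c i0 r v i) = vec c i0 (a * r) (fun j => a * v j) := by
  apply Lf_ext hi
  · rw [Lf_smul, Lf_vec hi, Lf_vec hi]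
  · intro j; simp only [vec_succ]

variable (k c i0) in
/-- the linear form, as a polynomial -/
def Lp : MvPolynomial (Fin 4) k := ∑ i, C (c i : k) * X i

theorem Lp_eval (w : Fin 4 → k) : eval w (Lp k c) = Lf c w := by
  simp [Lp, Lf]

theorem lin_hom (e : Fin 4 → k) : (∑ i, C (e i) * X i : MvPolynomial (Fin 4) k).IsHomogeneous 1 := by
  refine IsHomogeneous.sum _ _ _ fun i _ => ?_
  simpa using (isHomogeneous_C (Fin 4) (e i)).mul (isHomogeneous_X k i)

theorem Lp_hom : (Lp k c).IsHomogeneous 1 := lin_hom _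

variable (k c i0) in
/-- affine chart as polynomials -/
def vecp (r : k) : Fin 4 → MvPolynomial (Fin 3) k :=
  i0.insertNth (C (c i0 : k)⁻¹ * (C r - ∑ j, C (c (i0.succAbove j) : k) * X j)) X

theorem vecp_eval (r : k) (v : Fin 3 → k) (i : Fin 4) : eval v (vecp k c i0 r i) = vec c i0 r v i := by
  rcases Fin.eq_self_or_eq_succAbove i0 i with rfl | ⟨j, rfl⟩
  · rw [vec_i0]
    simp [vecp, div_eq_inv_mul]
  · rw [vec_succ]
    simp [vecp]

/-- dehomogenization -/
theorem deh_eval (r : k) (F : MvPolynomial (Fin 4) k) (v : Fin 3 → k) : eval v (aeval (vecp k c i0 r) F) = eval (vec c i0 r v) F := by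
  have := congrArg (fun g => g F) (comp_aeval (vecp k c i0 r) (aeval v : MvPolynomial (Fin 3) k →ₐ[k] k))
  have h2 : (fun i => eval v (vecp k c i0 r i)) = vec c i0 r v := funext fun i => vecp_eval r v i
  rw [← h2]
  simpa [aeval_eq_eval] using this

theorem rehom (hi : c i0 ≠ 0) (F : MvPolynomial (Fin 3) k) : ∃ (m : ℕ) (H : MvPolynomial (Fin 4) k), H.IsHomogeneous m ∧
    ∀ (r : k) (v : Fin 3 → k), eval (vec c i0 r (fun j => r * v j)) H = r ^ m * eval v F := by
  let m := F.totalDegree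
  refine ⟨m, ∑ j ∈ Finset.range (m + 1), Lp k c ^ (m - j) * rename i0.succAbove (homogeneousComponent j F), ?_, ?_⟩
  · refine IsHomogeneous.sum _ _ _ fun j hj => ?_
    have h1 : (Lp k c ^ (m - j) : MvPolynomial (Fin 4) k).IsHomogeneous (m - j) := by
      simpa using Lp_hom.pow (m - j)
    have := h1.mul ((homogeneousComponent_isHomogeneous j F).rename_isHomogeneous (f := i0.succAbove))
    rwa [Nat.sub_add_cancel (by simp at hj; omega)] at this
  · intro r v
    conv_rhs => rw [← sum_homogeneousComponent F]
    rw [map_sum, map_sum, Finset.mul_sum]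
    refine Finset.sum_congr rfl fun j hj => ?_
    rw [map_mul, map_pow, Lp_eval, Lf_vec hi, eval_rename]
    have e : (vec c i0 r (fun j => r * v j)) ∘ i0.succAbove = fun j => r * v j := funext fun j => vec_succ _ _ _
    rw [e, hom_scale_eval (homogeneousComponent_isHomogeneous j F) r v]
    rw [← mul_assoc, ← pow_add, Nat.sub_add_cancel (by simp at hj; omega)]

variable {CC : Set (Fin 4 → k)} 

variable (c i0 CC) in
/-- affine part -/
def aff : Set (Fin 3 → k) := {v | vec c i0 1 v ∈ CC}

theorem PC.toaff (h : PC CC) (hi : c i0 ≠ 0) {w : Fin 4 → k} (hw : w ∈ CC) (hL : Lf c w ≠ 0) :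
    ∃ v ∈ aff c i0 CC, w = fun i => Lf c w * vec c i0 1 v i := by
  have e : w = fun i => Lf c w * vec c i0 1 (fun j => (Lf c w)⁻¹ * w (i0.succAbove j)) i := by
    rw [vec_smul hi]
    conv_lhs => rw [eq_vec hi w]
    congr 1
    · ring
    · funext j; field_simp
  refine ⟨_, ?_, e⟩
  have := h.sc w hw _ (inv_ne_zero hL)
  change vec c i0 1 (fun j => (Lf c w)⁻¹ * w (i0.succAbove j)) ∈ CC
  convert this using 1
  funext i
  conv_rhs => rw [congrFun e i]
  field_simp

theorem PC.exL (h : PC CC) (hi : c i0 ≠ 0) : ∃ w ∈ CC, Lf c w ≠ 0 := by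
  by_contra h0
  push Not at h0
  have := congrFun (h.npl (fun i => (c i : k)) h0) i0
  have h2 : (c i0 : k) = 0 := this
  exact hi (by exact_mod_cast h2)

/-- a form vanishing on the affine part vanishes on the cone -/
theorem PC.dense (h : PC CC) (hi : c i0 ≠ 0) {F : MvPolynomial (Fin 4) k} {m : ℕ} (hF : F.IsHomogeneous m)
    (h0 : ∀ v ∈ aff c i0 CC, eval (vec c i0 1 v) F = 0) : ∀ w ∈ CC, eval w F = 0 := by
  obtain ⟨w, hw, hL⟩ := h.exL hi
  refine (h.irr F (Lp k c) m 1 hF Lp_hom ?_).resolve_right ?_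
  · intro w hw
    rw [Lp_eval]
    by_cases hL : Lf c w = 0
    · rw [hL, mul_zero]
    · obtain ⟨v, hv, e⟩ := h.toaff hi hw hL
      rw [e, hom_scale_eval hF, h0 v hv, mul_zero, zero_mul]
  · intro h1
    have := h1 w hw
    rw [Lp_eval] at this
    exact hL this

theorem vec1_ne (hi : c i0 ≠ 0) (v : Fin 3 → k) : vec c i0 1 v ≠ 0 := by
  intro h
  have := Lf_vec hi 1 v
  rw [h] at this
  simp [Lf] at this

theorem PC.affCurve (h : PC CC) (hi : c i0 ≠ 0) : AffCurve (aff c i0 CC) where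
  ne := by
    obtain ⟨w, hw, hL⟩ := h.exL hi
    obtain ⟨v, hv, -⟩ := h.toaff hi hw hL
    exact ⟨v, hv⟩
  irr F G hFG := by
    obtain ⟨m, F', hF', hF⟩ := rehom hi F
    obtain ⟨n, G', hG', hG⟩ := rehom hi G
    have eF : ∀ v, eval (vec c i0 1 v) F' = eval v F := by intro v; simpa using hF 1 v
    have eG : ∀ v, eval (vec c i0 1 v) G' = eval v G := by intro v; simpa using hG 1 v
    have h1 := h.dense hi (hF'.mul hG') (by
      intro v hv
      rw [map_mul, eF, eG, ← map_mul]; exact hFG v hv)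
    rcases h.irr F' G' m n hF' hG' (by simpa using h1) with h2 | h2
    · left; intro v hv; rw [← eF]; exact h2 _ hv
    · right; intro v hv; rw [← eG]; exact h2 _ hv
  fin F hF := by
    obtain ⟨b, hb, hFb⟩ := hF
    obtain ⟨m, F', hF', hF⟩ := rehom hi F
    have eF : ∀ v, eval (vec c i0 1 v) F' = eval v F := by intro v; simpa using hF 1 v
    obtain ⟨T, hT⟩ := h.fin F' m hF' ⟨_, hb, by rwa [eF]⟩
    refine ((T : Set (Fin 4 → k)).toFinite.image fun t => fun j => t (i0.succAbove j) / Lf c t).subset ?_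
    rintro v ⟨hv, hFv⟩
    obtain ⟨t, ht, r, hr, e⟩ := hT _ hv (by rwa [eF])
    refine ⟨t, ht, ?_⟩
    have h1 : (1 : k) = r * Lf c t := by
      rw [← Lf_smul, ← e, Lf_vec hi]
    have h2 : Lf c t ≠ 0 := by intro h0; rw [h0] at h1; simp at h1
    funext j
    have h3 : v j = r * t (i0.succAbove j) := by
      rw [← vec_succ (c := c) (i0 := i0) 1 v j, e]
    simp only
    rw [h3, div_eq_iff h2]
    linear_combination t (i0.succAbove j) * h1
  closed v hv := by
    refine h.closed _ (vec1_ne hi v) fun F m hF hF0 => ?_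
    rw [← deh_eval]
    apply hv
    intro b hb
    rw [deh_eval]
    exact hF0 _ hb
  np e0 e1 e2 e3 he := by
    have hi' : (c i0 : k) ≠ 0 := by exact_mod_cast hi
    let e' : Fin 4 → k := fun i => e0 * c i + i0.insertNth (α := fun _ => k) (0 : k) ![e1, e2, e3] i
    have hv : ∀ w : Fin 4 → k, ∑ i, e' i * w i = e0 * Lf c w + (e1 * w (i0.succAbove 0) + e2 * w (i0.succAbove 1) + e3 * w (i0.succAbove 2)) := by
      intro w
      simp only [e', add_mul, Finset.sum_add_distrib]
      congr 1
      · rw [Lf, Finset.mul_sum]; exact Finset.sum_congr rfl fun i _ => by ring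
      · rw [Fin.sum_univ_succAbove _ i0, Fin.sum_univ_three]; simp
    have h1 := h.dense hi (lin_hom e') (by
      intro v hv'
      have := he v hv'
      simp only [map_sum, map_mul, eval_C, eval_X]
      rw [hv, Lf_vec hi]
      simp only [vec_succ]
      linear_combination this)
    have h2 := h.npl e' (by simpa using h1)
    have h3 : e0 = 0 := by
      have := congrFun h2 i0
      simp only [e', Fin.insertNth_apply_same, add_zero, Pi.zero_apply] at this
      exact (mul_eq_zero.1 this).resolve_right hi'
    have h4 : ∀ j, ![e1, e2, e3] j = 0 := by
      intro j
      have := congrFun h2 (i0.succAbove j)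
      simpa [e', h3] using this
    exact ⟨h4 0, h4 1, h4 2⟩

end
end S19

namespace S19
set_option linter.unusedSectionVars false

section
variable {k : Type} [Field k] [IsAlgClosed k] [CharZero k] {c : Fin 4 → ℚ} {i0 : Fin 4} {CC : Set (Fin 4 → k)} 

theorem PC.main (h : PC CC) (hi : c i0 ≠ 0)
    (hQ : ∀ c : k, ∃ p : Polynomial ℚ, p ≠ 0 ∧ p.eval₂ (Rat.castHom k) c = 0)
    (hnr : ¬ ∃ (d : ℕ) (G : Fin 4 → MvPolynomial (Fin 2) k), (∀ i, (G i).IsHomogeneous d) ∧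
      (∀ v, (fun i => eval v (G i)) ≠ 0 → (fun i => eval v (G i)) ∈ CC) ∧
      ∀ w ∈ CC, ∃ (v : Fin 2 → k) (r : k), r ≠ 0 ∧ ∀ i, eval v (G i) = r * w i) :
    ¬ (∀ᶠ s : ℚ in Filter.cofinite, ∀ᶠ t : ℚ in Filter.cofinite, ∃ a ∈ aff c i0 CC, ∃ b ∈ aff c i0 CC, Slp a b (s : k) (t : k) ∧ 
      ∃ y : Fin 4 → ℚ, ∀ j, eval (th a b (s : k) (t : k)) (Yp k j) = (y j : k)) := by
  intro hR
  obtain ⟨K, _, _, E, _, _, ξ, ia, ib, τ, D, Da, Db, hP⟩ := Pair.exists (h.affCurve hi)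
  obtain ⟨ℓ, g, hℓ, hlg⟩ := hP.hilb hQ hR
  obtain ⟨f, hf⟩ := hP.geo ℓ g hℓ hlg
  have hfc : ∀ c : k, f ≠ algebraMap k K c := by
    rintro c0 rfl
    obtain ⟨p, q, hq, e⟩ := hf (ξ 0)
    refine hP.hZ.nc0 hP.hg (p.eval c0 / q.eval c0) ?_
    rw [e, map_div₀, Polynomial.aeval_algebraMap_apply, Polynomial.aeval_algebraMap_apply]
    simp
  let ζ : Fin 4 → K := fun i => aeval ξ (vecp k c i0 1 i)
  have hζF : ∀ F : MvPolynomial (Fin 4) k, aeval ζ F = 0 ↔ ∀ v ∈ aff c i0 CC, eval (vec c i0 1 v) F = 0 := by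
    intro F
    have : aeval ζ F = aeval ξ (aeval (vecp k c i0 1) F) := by
      rw [← AlgHom.comp_apply, comp_aeval]
    rw [this, hP.hg.rel]
    simp only [deh_eval]
  have hζ : ζ ≠ 0 := by
    intro h0
    obtain ⟨v, hv⟩ := (h.affCurve hi).ne
    have h1 : ∀ i, vec c i0 1 v i = 0 := by
      intro i
      have := (hζF (X i)).1 (by simp [h0]) v hv
      simpa using this
    exact vec1_ne hi v (funext h1)
  obtain ⟨d, G, hG, hG1, hG2⟩ := RP (hP.hZ.td1 hP.hg) hfc hf ζ hζ
  refine hnr ⟨d, G, hG, ?_, ?_⟩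
  · intro v hv
    refine h.closed _ hv fun F m hF hF0 => ?_
    exact hG1 F m hF ((hζF F).2 fun v hv => hF0 _ hv) v
  · intro w hw
    refine hG2 w (h.nz w hw) fun F m hF hF0 => ?_
    exact h.dense hi hF ((hζF F).1 hF0) w hw

theorem normal3 (p q : Fin 3 → k) : ∃ n : Fin 3 → k, n ≠ 0 ∧ ∑ j, n j * p j = 0 ∧ ∑ j, n j * q j = 0 := by
  let φ : (Fin 3 → k) →ₗ[k] (Fin 2 → k) := LinearMap.pi ![Fintype.linearCombination k p, Fintype.linearCombination k q]
  have := LinearMap.ker_ne_bot_of_finrank_lt (f := φ) (by simp)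
  obtain ⟨n, hn, hn0⟩ := Submodule.exists_mem_ne_zero_of_ne_bot this
  have h1 : φ n = 0 := hn
  refine ⟨n, hn0, ?_, ?_⟩
  · have := congrFun h1 0
    simpa [φ, Fintype.linearCombination_apply] using this
  · have := congrFun h1 1
    simpa [φ, Fintype.linearCombination_apply] using this

theorem lin2_ne (n : Fin 3 → k) (hn : n ≠ 0) : (C (n 0) + C (n 1) * X 0 + C (n 2) * X 1 : MvPolynomial (Fin 2) k) ≠ 0 := by
  intro h0
  apply hn
  have e : ∀ x y : k, n 0 + n 1 * x + n 2 * y = 0 := by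
    intro x y
    have := congrArg (eval ![x, y]) h0
    simpa using this
  have e0 := e 0 0
  have e1 := e 1 0
  have e2 := e 0 1
  funext j
  fin_cases j
  · simpa using e0
  · change n 1 = 0
    linear_combination e1 - e0
  · change n 2 = 0
    linear_combination e2 - e0

/-- the point at infinity with direction `(1,s,t)` -/
def uv (c : Fin 4 → ℚ) (i0 : Fin 4) (s t : k) : Fin 4 → k := vec c i0 0 ![1, s, t]

theorem PC.gen (h : PC CC) (hi : c i0 ≠ 0) : ∀ᶠ s : ℚ in Filter.cofinite, ∀ᶠ t : ℚ in Filter.cofinite,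
    ∀ w ∈ CC, ∀ w' ∈ CC, ∀ x y : k, uv c i0 (s : k) (t : k) = (fun i => x * w i + y * w' i) →
      (∀ r : k, w' ≠ fun i => r * w i) → ∃ a ∈ aff c i0 CC, ∃ b ∈ aff c i0 CC, Lf c w ≠ 0 ∧ Lf c w' ≠ 0 ∧
        (w = fun i => Lf c w * vec c i0 1 a i) ∧ (w' = fun i => Lf c w' * vec c i0 1 b i) ∧ Slp a b (s : k) (t : k) := by
  obtain ⟨w0, hw0, hL0⟩ := h.exL hi
  obtain ⟨T, hT⟩ := h.fin (Lp k c) 1 Lp_hom ⟨w0, hw0, by rwa [Lp_eval]⟩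
  choose n hn hnp hnq using fun p q : Fin 4 → k => normal3 (fun j => p (i0.succAbove j)) (fun j => q (i0.succAbove j))
  have key := gen_ne (∏ p ∈ T, ∏ q ∈ T, (C (n p q 0) + C (n p q 1) * X 0 + C (n p q 2) * X 1 : MvPolynomial (Fin 2) k))
    (Finset.prod_ne_zero_iff.2 fun p _ => Finset.prod_ne_zero_iff.2 fun q _ => lin2_ne _ (hn p q))
  filter_upwards [key] with s hs
  filter_upwards [hs] with t ht
  have ht' : ∀ p ∈ T, ∀ q ∈ T, n p q 0 + n p q 1 * s + n p q 2 * t ≠ 0 := by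
    intro p hp q hq h0
    rw [map_prod] at ht
    have h1 := Finset.prod_ne_zero_iff.1 ht p hp
    rw [map_prod] at h1
    have h2 := Finset.prod_ne_zero_iff.1 h1 q hq
    apply h2
    simpa using h0
  -- not in span of two points at infinity
  have hbad : ∀ w ∈ CC, ∀ w' ∈ CC, Lf c w = 0 → Lf c w' = 0 → ∀ x y : k, uv c i0 (s : k) (t : k) ≠ fun i => x * w i + y * w' i := by
    intro w hw w' hw' hL hL' x y e
    obtain ⟨p, hp, r, hr, rfl⟩ := hT w hw (by rwa [Lp_eval])
    obtain ⟨q, hq, r', hr', rfl⟩ := hT w' hw' (by rwa [Lp_eval])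
    apply ht' p hp q hq
    have e3 : ∀ j, (![1, (s : k), (t : k)] : Fin 3 → k) j = x * (r * p (i0.succAbove j)) + y * (r' * q (i0.succAbove j)) := by
      intro j
      have := congrFun e (i0.succAbove j)
      rwa [uv, vec_succ] at this
    have a0 := e3 0
    have a1 := e3 1
    have a2 := e3 2
    simp only [Matrix.cons_val] at a0 a1 a2
    have b1 := hnp p q
    have b2 := hnq p q
    rw [Fin.sum_univ_three] at b1 b2
    linear_combination x * r * b1 + y * r' * b2 + n p q 0 * a0 + n p q 1 * a1 + n p q 2 * a2
  intro w hw w' hw' x y e hww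
  have eL : x * Lf c w + y * Lf c w' = 0 := by
    rw [← Lf_lin, ← e, uv, Lf_vec hi]
  have hLw : Lf c w ≠ 0 := by
    intro hL
    rw [hL, mul_zero, zero_add, mul_eq_zero] at eL
    rcases eL with hy | hL'
    · refine hbad w hw w hw hL hL x 0 ?_
      rw [e, hy]; funext i; ring
    · exact hbad w hw w' hw' hL hL' x y e
  have hLw' : Lf c w' ≠ 0 := by
    intro hL
    rw [hL, mul_zero, add_zero, mul_eq_zero] at eL
    rcases eL with hx | hL'
    · refine hbad w' hw' w' hw' hL hL 0 y ?_
      rw [e, hx]; funext i; ring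
    · exact hLw hL'
  obtain ⟨a, ha, ea⟩ := h.toaff hi hw hLw
  obtain ⟨b, hb, eb⟩ := h.toaff hi hw' hLw'
  refine ⟨a, ha, b, hb, hLw, hLw', ea, eb, ?_⟩
  have e3 : ∀ j, (![1, (s : k), (t : k)] : Fin 3 → k) j = x * Lf c w * (a j - b j) := by
    intro j
    have := congrFun e (i0.succAbove j)
    have h1 := congrFun ea (i0.succAbove j)
    have h2 := congrFun eb (i0.succAbove j)
    simp only [vec_succ, uv] at this h1 h2
    rw [this, h1, h2]
    linear_combination b j * eL
  have a0 := e3 0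
  have a1 := e3 1
  have a2 := e3 2
  simp only [Matrix.cons_val] at a0 a1 a2
  refine ⟨?_, ?_, ?_⟩
  · intro h0
    rw [h0] at a0
    simp at a0
  · rw [a1]; linear_combination (a 1 - b 1) * a0
  · rw [a2]; linear_combination (a 2 - b 2) * a0

theorem Slp.uv {a b : Fin 3 → k} {s t : k} (hi : c i0 ≠ 0) (h : Slp a b s t) :
    S19.uv c i0 s t = fun i => (a 0 - b 0)⁻¹ * vec c i0 1 a i + (-(a 0 - b 0)⁻¹) * vec c i0 1 b i := by
  have h0 : a 0 - b 0 ≠ 0 := sub_ne_zero.2 h.1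
  apply Lf_ext hi
  · rw [Lf_lin, Lf_vec hi, Lf_vec hi, S19.uv, Lf_vec hi]; ring
  · intro j
    simp only [S19.uv, vec_succ]
    fin_cases j
    · simp only [Fin.zero_eta, Matrix.cons_val]; field_simp; ring
    · simp only [Fin.mk_one, Matrix.cons_val]
      have := h.2.1
      field_simp
      linear_combination -this
    · have := h.2.2
      simp only [Fin.reduceFinMk, Matrix.cons_val]
      field_simp
      linear_combination -this

theorem eval_aeval' {σ τ : Type} (g : σ → MvPolynomial τ k) (x : τ → k) (P : MvPolynomial σ k) :
    eval x (aeval g P) = eval (fun i => eval x (g i)) P := by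
  have := congrArg (fun g => g P) (comp_aeval g (aeval x : MvPolynomial τ k →ₐ[k] k))
  simpa [aeval_eq_eval] using this

/-- generic nonvanishing on the plane -/
theorem plane_gen (hi : c i0 ≠ 0) {F : MvPolynomial (Fin 4) k} {m : ℕ} (hF : F.IsHomogeneous m) {w : Fin 4 → k}
    (hL : Lf c w = 0) (hw : eval w F ≠ 0) : ∀ᶠ s : ℚ in Filter.cofinite, ∀ᶠ t : ℚ in Filter.cofinite,
      eval (uv c i0 (s : k) (t : k)) F ≠ 0 := by
  let P := aeval (vecp k c i0 0) F
  let N : MvPolynomial (Fin 2) k := aeval (![1, X 0, X 1] : Fin 3 → MvPolynomial (Fin 2) k) P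
  have hN : ∀ s t : k, eval ![s, t] N = eval (uv c i0 s t) F := by
    intro s t
    rw [uv, ← deh_eval]
    have e : (fun i => eval ![s, t] ((![1, X 0, X 1] : Fin 3 → MvPolynomial (Fin 2) k) i)) = ![1, s, t] := by
      funext i; fin_cases i <;> simp
    rw [← e]
    exact eval_aeval' _ _ _
  have hN0 : N ≠ 0 := by
    intro h0
    have hinf : Infinite k := IsAlgClosed.instInfinite
    have h1 : P * X 0 = 0 := by
      apply MvPolynomial.funext
      intro v
      rw [map_mul, map_zero, eval_X]
      by_cases hv : v 0 = 0
      · rw [hv, mul_zero]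
      · have h2 := hN (v 1 / v 0) (v 2 / v 0)
        rw [h0, map_zero] at h2
        have h3 : vec c i0 0 v = fun i => v 0 * uv c i0 (v 1 / v 0) (v 2 / v 0) i := by
          rw [uv, vec_smul hi, mul_zero]
          congr 1
          funext j
          fin_cases j
          · simp
          · simp only [Fin.mk_one, Matrix.cons_val]; field_simp
          · simp only [Fin.reduceFinMk, Matrix.cons_val]; field_simp
        rw [deh_eval, h3, hom_scale_eval hF, ← h2, mul_zero, zero_mul]
    have h2 := (mul_eq_zero.1 h1).resolve_right (X_ne_zero 0)
    apply hw
    rw [eq_vec hi w, hL, ← deh_eval]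
    change eval _ P = 0
    rw [h2, map_zero]
  filter_upwards [gen_ne N hN0] with s hs
  filter_upwards [hs] with t ht
  rwa [← hN]

end
end S19

namespace S19
set_option linter.unusedSectionVars false

theorem vec_map {A B : Type} [Field A] [CharZero A] [Field B] [CharZero B] (φ : A →+* B) (c : Fin 4 → ℚ) (i0 : Fin 4) (r : A)
    (v : Fin 3 → A) (i : Fin 4) : φ (vec c i0 r v i) = vec c i0 (φ r) (fun j => φ (v j)) i := by
  rcases Fin.eq_self_or_eq_succAbove i0 i with rfl | ⟨j, rfl⟩
  · rw [vec_i0, vec_i0]; simp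
  · rw [vec_succ, vec_succ]

/-- cone over a set of points -/
def cone (C : Set P3Bar) : Set (Fin 4 → QBar) := {w | ∃ h : w ≠ 0, Projectivization.mk QBar w h ∈ C}

theorem rep_cone {C : Set P3Bar} {x : P3Bar} (hx : x ∈ C) : x.rep ∈ cone C :=
  ⟨x.rep_nonzero, by rwa [x.mk_rep]⟩

theorem vanish_iff {C : Set P3Bar} {F : MvPolynomial (Fin 4) QBar} {m : ℕ} (hF : F.IsHomogeneous m) :
    (∀ w ∈ cone C, eval w F = 0) ↔ ∀ x ∈ C, eval x.rep F = 0 := by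
  constructor
  · intro h x hx; exact h _ (rep_cone hx)
  · rintro h w ⟨hw, hwC⟩
    exact (ev_mk hF w hw).1 (h _ hwC)

theorem mk_scale {w w' : Fin 4 → QBar} (hw : w ≠ 0) (hw' : w' ≠ 0) {r : QBar} (h : w' = fun i => r * w i) :
    Projectivization.mk QBar w' hw' = Projectivization.mk QBar w hw := by
  rw [Projectivization.mk_eq_mk_iff']
  exact ⟨r, by rw [h]; rfl⟩

theorem rep_mk {w : Fin 4 → QBar} (hw : w ≠ 0) : ∃ r : QBar, r ≠ 0 ∧ (Projectivization.mk QBar w hw).rep = fun i => r * w i := by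
  obtain ⟨a, ha⟩ := Projectivization.exists_smul_eq_mk_rep QBar w hw
  exact ⟨a, a.ne_zero, by rw [← ha]; rfl⟩

theorem line_iff {u w w' : Fin 4 → QBar} (hu : u ≠ 0) (hw : w ≠ 0) (hw' : w' ≠ 0) :
    Projectivization.mk QBar u hu ∈ projLineBar (Projectivization.mk QBar w hw) (Projectivization.mk QBar w' hw') ↔
      ∃ x y : QBar, u = fun i => x * w i + y * w' i := by
  obtain ⟨r, hr, e⟩ := rep_mk hu
  obtain ⟨p, hp, e1⟩ := rep_mk hw
  obtain ⟨q, hq, e2⟩ := rep_mk hw'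
  change _ ∈ Submodule.span _ _ ↔ _
  rw [Submodule.mem_span_pair, e, e1, e2]
  constructor
  · rintro ⟨x, y, h⟩
    refine ⟨r⁻¹ * x * p, r⁻¹ * y * q, ?_⟩
    funext i
    have := congrFun h i
    simp only [Pi.add_apply, Pi.smul_apply, smul_eq_mul] at this
    have h2 : u i = r⁻¹ * (r * u i) := by field_simp
    rw [h2, ← this]; ring
  · rintro ⟨x, y, h⟩
    refine ⟨r * x * p⁻¹, r * y * q⁻¹, ?_⟩
    funext i
    simp only [Pi.add_apply, Pi.smul_apply, smul_eq_mul]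
    rw [congrFun h i]
    field_simp

theorem gal_ne (σ : QBar ≃ₐ[ℚ] QBar) {w : Fin 4 → QBar} (hw : w ≠ 0) : (fun i => σ (w i)) ≠ 0 := by
  intro h
  apply hw
  funext i
  exact σ.injective (by simpa using congrFun h i)

theorem gal_mk (σ : QBar ≃ₐ[ℚ] QBar) {w : Fin 4 → QBar} (hw : w ≠ 0) :
    galMap σ (Projectivization.mk QBar w hw) = Projectivization.mk QBar (fun i => σ (w i)) (gal_ne σ hw) := by
  obtain ⟨r, hr, e⟩ := rep_mk hw
  refine mk_scale (r := σ r) (gal_ne σ hw) _ ?_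
  funext i
  rw [e, map_mul]

theorem coneEP {C : Set P3Bar} (hC : IsCurveP3 C) (hdom : @closure _ zariskiP3 (secantImage C) = Set.univ) : PC (cone C) where
  nz w hw := hw.1
  sc w hw r hr := by
    obtain ⟨h0, h⟩ := hw
    have h1 : (fun i => r * w i) ≠ 0 := by
      intro h2
      apply h0
      funext i
      have := congrFun h2 i
      exact (mul_eq_zero.1 this).resolve_left hr
    exact ⟨h1, by rwa [mk_scale h0 h1 rfl]⟩
  irr F G m n hF hG h := by
    rw [vanish_iff hF, vanish_iff hG]
    by_contra h0
    push Not at h0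
    obtain ⟨⟨x, hx, hxF⟩, ⟨y, hy, hyG⟩⟩ := h0
    obtain ⟨z, hz, hzF, hzG⟩ := hC.2.1.2 _ _ (basic_open hF) (basic_open hG) ⟨x, hx, hxF⟩ ⟨y, hy, hyG⟩
    exact (mul_ne_zero hzF hzG) (h _ (rep_cone hz))
  fin F m hF hF0 := by
    classical
    let _ := zariskiP3
    have := noeth
    have := t1
    have hfin : {x ∈ C | eval x.rep F = 0}.Finite := by
      refine dim1_fin hC.1 hC.2.1 hC.2.2 (hC.1.inter (basic_closed hF)) (fun x hx => hx.1) ?_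
      intro h
      obtain ⟨w, hw, hwF⟩ := hF0
      refine hwF ((vanish_iff hF).2 (fun x hx => ?_) w hw)
      have hx' : x ∈ {x ∈ C | eval x.rep F = 0} := by
        have h' : {x ∈ C | eval x.rep F = 0} = C := h
        rwa [h']
      exact hx'.2
    refine ⟨hfin.toFinset.image fun x => x.rep, ?_⟩
    rintro w ⟨hw, hwC⟩ hwF
    obtain ⟨r, hr, e⟩ := rep_mk hw
    refine ⟨_, Finset.mem_image_of_mem _ (hfin.mem_toFinset.2 ⟨hwC, (ev_mk hF w hw).2 hwF⟩), r⁻¹, inv_ne_zero hr, ?_⟩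
    funext i
    rw [e]
    field_simp
  closed w hw h := by
    refine ⟨hw, ?_⟩
    by_contra h0
    obtain ⟨f, d, hf, hfx, hfC⟩ := closed_sep hC.1 h0
    exact hfx ((ev_mk hf w hw).2 (h f d hf ((vanish_iff hf).2 hfC)))
  npl e he := by
    have h1 : secantImage C ⊆ {x : P3Bar | eval x.rep (∑ i, MvPolynomial.C (e i) * X i : MvPolynomial (Fin 4) QBar) = 0} := by
      rintro x ⟨a, ha, b, hb, -, hx⟩
      have hx' : x.rep ∈ Submodule.span QBar {a.rep, b.rep} := hx
      rw [Submodule.mem_span_pair] at hx'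
      obtain ⟨p, q, hpq⟩ := hx'
      have ea := he _ (rep_cone ha)
      have eb := he _ (rep_cone hb)
      change eval x.rep _ = 0
      rw [← hpq]
      simp only [map_sum, map_mul, eval_C, eval_X, Pi.add_apply, Pi.smul_apply, smul_eq_mul]
      have : ∑ i, e i * (p * a.rep i + q * b.rep i) = p * ∑ i, e i * a.rep i + q * ∑ i, e i * b.rep i := by
        rw [Finset.mul_sum, Finset.mul_sum, ← Finset.sum_add_distrib]
        exact Finset.sum_congr rfl fun i _ => by ring
      rw [this, ea, eb]; ring
    have h2 := @closure_minimal _ zariskiP3 _ _ h1 (basic_closed (lin_hom e))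
    rw [hdom] at h2
    funext i
    have hne : (Pi.single i 1 : Fin 4 → QBar) ≠ 0 := by
      intro h; have := congrFun h i; simp at this
    have h3 := h2 (Set.mem_univ (Projectivization.mk QBar (Pi.single i 1) hne))
    have h4 := (ev_mk (lin_hom e) _ hne).1 h3
    simpa [Pi.single_apply] using h4

theorem algQ : Algebra.IsAlgebraic ℚ QBar := by
  have h := AlgebraicClosure.isAlgebraic ℚ
  have e : AlgebraicClosure.instAlgebra ℚ = (DivisionRing.toRatAlgebra : Algebra ℚ QBar) := Subsingleton.elim _ _
  rw [e] at h
  exact h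

theorem galQ : IsGalois ℚ QBar := by
  have := algQ
  have : IsAlgClosure ℚ QBar := ⟨inferInstance, inferInstance⟩
  have : Normal ℚ QBar := IsAlgClosure.normal ℚ QBar
  exact ⟨⟩

theorem rat_of_fixed (x : QBar) (h : ∀ σ : QBar ≃ₐ[ℚ] QBar, σ x = x) : ∃ q : ℚ, x = (q : QBar) := by
  have := galQ
  obtain ⟨q, hq⟩ := IntermediateField.mem_bot.1 ((InfiniteGalois.mem_bot_iff_fixed x).2 h)
  exact ⟨q, by rw [← hq]; simp⟩

theorem hQbar (c : QBar) : ∃ p : Polynomial ℚ, p ≠ 0 ∧ p.eval₂ (Rat.castHom QBar) c = 0 := by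
  have := algQ
  obtain ⟨p, hp, h⟩ := Algebra.IsAlgebraic.isAlgebraic (R := ℚ) c
  refine ⟨p, hp, ?_⟩
  rw [Polynomial.aeval_def] at h
  rwa [show Rat.castHom QBar = algebraMap ℚ QBar from Subsingleton.elim _ _]

/-- rational values for stable pairs -/
theorem stable_rat {a b : Fin 3 → QBar} {s t : ℚ} (h : Slp a b (s : QBar) (t : QBar))
    (hst : ∀ σ : QBar ≃ₐ[ℚ] QBar, ((fun j => σ (a j)) = a ∧ (fun j => σ (b j)) = b) ∨ ((fun j => σ (a j)) = b ∧ (fun j => σ (b j)) = a)) :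
    ∃ y : Fin 4 → ℚ, ∀ j, eval (th a b (s : QBar) (t : QBar)) (Yp QBar j) = (y j : QBar) := by
  suffices hall : ∀ j, ∃ q : ℚ, eval (th a b (s : QBar) (t : QBar)) (Yp QBar j) = (q : QBar) by
    choose y hy using hall
    exact ⟨y, hy⟩
  refine fun j => rat_of_fixed _ fun σ => ?_
  obtain ⟨h0, h1, h2⟩ := h
  have hs : σ (s : QBar) = s := map_ratCast σ s
  have ht : σ (t : QBar) = t := map_ratCast σ t
  rcases hst σ with ⟨ea, eb⟩ | ⟨ea, eb⟩
  · have ea' : ∀ j, σ (a j) = a j := fun j => congrFun ea j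
    have eb' : ∀ j, σ (b j) = b j := fun j => congrFun eb j
    fin_cases j <;> simp [Yp, th, ea', eb', hs, ht]
  · have ea' : ∀ j, σ (a j) = b j := fun j => congrFun ea j
    have eb' : ∀ j, σ (b j) = a j := fun j => congrFun eb j
    fin_cases j <;> simp [Yp, th, ea', eb', hs, ht]
    · ring
    · ring
    · linear_combination -h1
    · linear_combination -h2

end S19

namespace S19
set_option linter.unusedSectionVars false

/-- projective point of an affine one -/
def pt (c : Fin 4 → ℚ) (i0 : Fin 4) (hi : c i0 ≠ 0) (v : Fin 3 → QBar) : P3Bar := Projectivization.mk QBar (vec c i0 1 v) (vec1_ne hi v)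

section
variable {c : Fin 4 → ℚ} {i0 : Fin 4} (hi : c i0 ≠ 0)

theorem pt_inj {a b : Fin 3 → QBar} (h : pt c i0 hi a = pt c i0 hi b) : a = b := by
  rw [pt, pt, Projectivization.mk_eq_mk_iff'] at h
  obtain ⟨r, h⟩ := h
  have h' : (fun i => r * vec c i0 1 b i) = vec c i0 1 a := h
  have h1 : r = 1 := by
    have := Lf_smul (c := c) r (vec c i0 1 b)
    rw [h', Lf_vec hi, Lf_vec hi] at this
    simpa using this.symm
  funext j
  have := congrFun h' (i0.succAbove j)
  simp only [vec_succ, h1, one_mul] at this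
  exact this.symm

theorem pt_mem {C : Set P3Bar} {a : Fin 3 → QBar} : pt c i0 hi a ∈ C ↔ a ∈ aff c i0 (cone C) :=
  ⟨fun h => ⟨vec1_ne hi a, h⟩, fun h => h.2⟩

theorem gal_pt (σ : QBar ≃ₐ[ℚ] QBar) (a : Fin 3 → QBar) : galMap σ (pt c i0 hi a) = pt c i0 hi (fun j => σ (a j)) := by
  rw [pt, gal_mk, pt]
  congr 1
  funext i
  have := vec_map (σ : QBar →+* QBar) c i0 1 a i
  simpa using this

theorem uv_ne (s t : QBar) : uv c i0 s t ≠ 0 := by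
  intro h
  have := congrFun h (i0.succAbove 0)
  rw [uv, vec_succ] at this
  simp at this

/-- the point at infinity -/
def up (c : Fin 4 → ℚ) (i0 : Fin 4) (s t : ℚ) : P3Bar := Projectivization.mk QBar (uv c i0 (s : QBar) (t : QBar)) (uv_ne _ _)

theorem up_rat (s t : ℚ) : IsRatPoint (up c i0 s t) := by
  have e : (fun i => ((vec c i0 (0 : ℚ) ![1, s, t] i : ℚ) : QBar)) = uv c i0 (s : QBar) (t : QBar) := by
    funext i
    have := vec_map (Rat.castHom QBar) c i0 0 ![1, s, t] i
    rw [uv]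
    simp only [eq_ratCast, Rat.cast_zero] at this
    rw [this]
    congr 1
    funext j
    fin_cases j <;> simp
  refine ⟨vec c i0 (0 : ℚ) ![1, s, t], by rw [e]; exact uv_ne _ _, ?_⟩
  rw [up]
  congr 1
  exact e.symm

theorem slp_fiber {C : Set P3Bar} {a b : Fin 3 → QBar} {s t : ℚ} (ha : a ∈ aff c i0 (cone C)) (hb : b ∈ aff c i0 (cone C))
    (h : Slp a b (s : QBar) (t : QBar)) : (pt c i0 hi a, pt c i0 hi b) ∈ secantFiber C (up c i0 s t) := by
  refine ⟨(pt_mem hi).2 ha, (pt_mem hi).2 hb, ?_, ?_⟩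
  · intro e
    have e' := pt_inj hi e
    exact h.1 (by rw [e'])
  · exact (line_iff _ _ _).2 ⟨_, _, h.uv hi⟩

theorem generic {C : Set P3Bar} (hP : PC (cone C)) : ∀ᶠ s : ℚ in Filter.cofinite, ∀ᶠ t : ℚ in Filter.cofinite,
    ∀ p ∈ secantFiber C (up c i0 s t), ∃ a ∈ aff c i0 (cone C), ∃ b ∈ aff c i0 (cone C), p.1 = pt c i0 hi a ∧ p.2 = pt c i0 hi b ∧
      Slp a b (s : QBar) (t : QBar) := by
  filter_upwards [hP.gen hi] with s hs
  filter_upwards [hs] with t ht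
  rintro ⟨A, B⟩ ⟨hA, hB, hAB, hl⟩
  simp only at hA hB hAB hl ⊢
  rw [← A.mk_rep, ← B.mk_rep, up, line_iff] at hl
  obtain ⟨x, y, e⟩ := hl
  obtain ⟨a, ha, b, hb, hLa, hLb, ea, eb, h⟩ := ht _ (rep_cone hA) _ (rep_cone hB) x y e (by
    intro r hr
    apply hAB
    rw [← A.mk_rep, ← B.mk_rep]
    exact (mk_scale A.rep_nonzero B.rep_nonzero hr).symm)
  refine ⟨a, ha, b, hb, ?_, ?_, h⟩
  · rw [← A.mk_rep]
    exact mk_scale _ _ ea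
  · rw [← B.mk_rep]
    exact mk_scale _ _ eb

end

theorem gal_aff {C : Set P3Bar} (hCgal : ∀ σ : QBar ≃ₐ[ℚ] QBar, galMap σ '' C = C) {c : Fin 4 → ℚ} {i0 : Fin 4} (hi : c i0 ≠ 0)
    (σ : QBar ≃ₐ[ℚ] QBar) {a : Fin 3 → QBar} (ha : a ∈ aff c i0 (cone C)) : (fun j => σ (a j)) ∈ aff c i0 (cone C) := by
  rw [← pt_mem hi, ← gal_pt, ← hCgal σ]
  exact ⟨_, (pt_mem hi).2 ha, rfl⟩

theorem gal_slp {a b : Fin 3 → QBar} {s t : ℚ} (h : Slp a b (s : QBar) (t : QBar)) (σ : QBar ≃ₐ[ℚ] QBar) :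
    Slp (fun j => σ (a j)) (fun j => σ (b j)) (s : QBar) (t : QBar) := by
  obtain ⟨h0, h1, h2⟩ := h
  refine ⟨fun e => h0 (σ.injective e), ?_, ?_⟩
  · have := congrArg σ h1
    simpa using this
  · have := congrArg σ h2
    simpa using this

theorem final (C : Set P3Bar) (hC : IsCurveP3 C)
    (hCgal : ∀ σ : QBar ≃ₐ[ℚ] QBar, galMap σ '' C = C)
    (hgenus : ¬ ∃ (d : ℕ) (G : Fin 4 → MvPolynomial (Fin 2) QBar),
      (∀ i, (G i).IsHomogeneous d) ∧
      {x : P3Bar | ∃ v : Fin 2 → QBar, ∃ hv : (fun i => eval v (G i)) ≠ 0,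
        x = Projectivization.mk QBar (fun i => eval v (G i)) hv} = C)
    (hdom : @closure _ zariskiP3 (secantImage C) = Set.univ)
    (c : Fin 4 → ℚ) (hc : c ≠ 0) (H : Set P3Bar)
    (hH : H = {x : P3Bar | ∑ i, ((c i : ℚ) : QBar) * x.rep i = 0}) :
    H ⊆ @closure _ zariskiP3
      {u ∈ H | (secantFiber C u).Finite ∧ 4 ≤ (secantFiber C u).ncard} ∧
    ∃ u ∈ H, IsRatPoint u ∧ (secantFiber C u).Finite ∧
      ∀ a ∈ C, ∀ b ∈ C, a ≠ b → u ∈ projLineBar a b →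
        ¬ (∀ σ : QBar ≃ₐ[ℚ] QBar, ({galMap σ a, galMap σ b} : Set P3Bar) = {a, b}) := by
  classical
  obtain ⟨i0, hi'⟩ := Function.ne_iff.1 hc
  have hi : c i0 ≠ 0 := hi'
  have hP := coneEP hC hdom
  have hmain := hP.main hi hQbar (by
    rintro ⟨d, G, hG, h1, h2⟩
    refine hgenus ⟨d, G, hG, ?_⟩
    ext x
    constructor
    · rintro ⟨v, hv, rfl⟩
      exact (h1 v hv).2
    · intro hx
      obtain ⟨v, r, hr, e⟩ := h2 _ (rep_cone hx)
      have e' : (fun i => eval v (G i)) = fun i => r * x.rep i := funext e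
      have hv : (fun i => eval v (G i)) ≠ 0 := by
        intro h0
        apply x.rep_nonzero
        funext i
        have h3 := e i
        rw [congrFun h0 i] at h3
        exact (mul_eq_zero.1 h3.symm).resolve_left hr
      refine ⟨v, hv, ?_⟩
      conv_lhs => rw [← x.mk_rep]
      exact (mk_scale _ _ e').symm)
  obtain ⟨K, _, _, E, _, _, ξ, ia, ib, τ, D, Da, Db, hPair⟩ := Pair.exists (hP.affCurve hi)
  have hA1 := hPair.A1
  have hA2 := hPair.A2
  have hgen := generic hi hP
  -- the key existence result
  have key : ∀ Q : ℚ → ℚ → Prop, (∀ᶠ s : ℚ in Filter.cofinite, ∀ᶠ t : ℚ in Filter.cofinite, Q s t) →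
      ∃ s t : ℚ, Q s t ∧ (secantFiber C (up c i0 s t)).Finite ∧ 4 ≤ (secantFiber C (up c i0 s t)).ncard ∧
        ∀ a ∈ C, ∀ b ∈ C, a ≠ b → up c i0 s t ∈ projLineBar a b →
        ¬ (∀ σ : QBar ≃ₐ[ℚ] QBar, ({galMap σ a, galMap σ b} : Set P3Bar) = {a, b}) := by
    intro Q hQ
    by_contra hcon
    push Not at hcon
    apply hmain
    filter_upwards [hQ, hA1, hA2, hgen] with s h1 h2 h3 h4
    filter_upwards [h1, h2, h3, h4] with t hQst hfin hne hg
    have hfinite : (secantFiber C (up c i0 s t)).Finite := by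
      refine (hfin.image fun p => (pt c i0 hi p.1, pt c i0 hi p.2)).subset ?_
      intro p hp
      obtain ⟨a, ha, b, hb, e1, e2, h⟩ := hg p hp
      exact ⟨(a, b), ⟨ha, hb, h⟩, Prod.ext e1.symm e2.symm⟩
    by_contra hno
    -- no stable pair
    have hns : ∀ A ∈ C, ∀ B ∈ C, A ≠ B → up c i0 s t ∈ projLineBar A B →
        ¬ (∀ σ : QBar ≃ₐ[ℚ] QBar, ({galMap σ A, galMap σ B} : Set P3Bar) = {A, B}) := by
      intro A hA B hB hAB hl hst
      obtain ⟨a, ha, b, hb, e1, e2, h⟩ := hg (A, B) ⟨hA, hB, hAB, hl⟩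
      simp only at e1 e2
      apply hno
      refine ⟨a, ha, b, hb, h, stable_rat h fun σ => ?_⟩
      have h5 := hst σ
      rw [e1, e2, gal_pt, gal_pt, Set.pair_eq_pair_iff] at h5
      rcases h5 with ⟨h6, h7⟩ | ⟨h6, h7⟩
      · exact Or.inl ⟨pt_inj hi h6, pt_inj hi h7⟩
      · exact Or.inr ⟨pt_inj hi h6, pt_inj hi h7⟩
    have h4le : 4 ≤ (secantFiber C (up c i0 s t)).ncard := by
      obtain ⟨a, ha, b, hb, h⟩ := hne
      have m1 := slp_fiber hi ha hb h
      have m2 := slp_fiber hi hb ha h.symm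
      have h5 := hns _ m1.1 _ m1.2.1 m1.2.2.1 m1.2.2.2
      push Not at h5
      obtain ⟨σ, hσ⟩ := h5
      rw [gal_pt, gal_pt] at hσ
      have m3 := slp_fiber hi (gal_aff hCgal hi σ ha) (gal_aff hCgal hi σ hb) (gal_slp h σ)
      have m4 := slp_fiber hi (gal_aff hCgal hi σ hb) (gal_aff hCgal hi σ ha) (gal_slp h.symm σ)
      generalize pt c i0 hi a = A at *
      generalize pt c i0 hi b = B at *
      generalize pt c i0 hi (fun j => σ (a j)) = A' at *
      generalize pt c i0 hi (fun j => σ (b j)) = B' at *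
      have nAB : A ≠ B := m1.2.2.1
      have nAB' : A' ≠ B' := m3.2.2.1
      have n1 : ¬ (A' = A ∧ B' = B) := by rintro ⟨rfl, rfl⟩; exact hσ rfl
      have n2 : ¬ (A' = B ∧ B' = A) := by rintro ⟨rfl, rfl⟩; exact hσ (Set.pair_comm _ _)
      have hcard : ({(A, B), (B, A), (A', B'), (B', A')} : Finset (P3Bar × P3Bar)).card = 4 := by
        rw [Finset.card_insert_of_notMem, Finset.card_insert_of_notMem, Finset.card_insert_of_notMem, Finset.card_singleton]
        · simp only [Finset.mem_singleton, Prod.mk.injEq]; tauto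
        · simp only [Finset.mem_insert, Finset.mem_singleton, Prod.mk.injEq]
          rintro (⟨h1, h2⟩ | ⟨h1, h2⟩)
          · exact n2 ⟨h1.symm, h2.symm⟩
          · exact n1 ⟨h2.symm, h1.symm⟩
        · simp only [Finset.mem_insert, Finset.mem_singleton, Prod.mk.injEq]
          rintro (⟨h1, h2⟩ | ⟨h1, h2⟩ | ⟨h1, h2⟩)
          · exact nAB h1
          · exact n1 ⟨h1.symm, h2.symm⟩
          · exact n2 ⟨h2.symm, h1.symm⟩
      rw [← hcard, ← Set.ncard_coe_finset]
      refine Set.ncard_le_ncard ?_ hfinite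
      intro p hp
      simp only [Finset.coe_insert, Finset.coe_singleton, Set.mem_insert_iff, Set.mem_singleton_iff] at hp
      rcases hp with rfl | rfl | rfl | rfl <;> assumption
    obtain ⟨A, hA, B, hB, hAB, hl, hst⟩ := hcon s t hQst hfinite h4le
    exact hns A hA B hB hAB hl hst
  have hupH : ∀ s t : ℚ, up c i0 s t ∈ H := by
    intro s t
    rw [hH]
    have h1 := (ev_mk (Lp_hom (k := QBar) (c := c)) _ (uv_ne (c := c) (i0 := i0) (s : QBar) (t : QBar))).2 (by
      rw [Lp_eval, uv, Lf_vec hi])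
    rw [Lp_eval] at h1
    exact h1
  constructor
  · intro x hx
    let _ := zariskiP3
    rw [mem_closure_iff]
    intro U hU hxU
    obtain ⟨f, d, hf, hfx, hfU⟩ := open_basic hU hxU
    have hL : Lf c x.rep = 0 := by
      rw [hH] at hx
      exact hx
    obtain ⟨s, t, hst, hf1, hf2, -⟩ := key _ (plane_gen hi hf hL hfx)
    refine ⟨up c i0 s t, hfU _ ?_, hupH s t, hf1, hf2⟩
    intro h0
    exact hst ((ev_mk hf _ _).1 h0)
  · obtain ⟨s, t, -, hf1, -, hns⟩ := key (fun _ _ => True) (by simp)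
    exact ⟨up c i0 s t, hupH s t, up_rat s t, hf1, hns⟩

end S19

/-- Let `C ⊆ ℙ³` be a smooth projective curve over `ℚ` (a
Galois-stable curve over `ℚ̄`) of genus `≥ 2` — here we use the consequence of
`genus ≥ 2` that is relevant (and needed) for the conclusion, namely `genus ≥ 1`,
encoded geometrically as: `C` is not the image of a nonconstant morphism from `ℙ¹`
given by homogeneous forms.  Suppose the secant map is dominant (the union of
secant lines is Zariski-dense in `ℙ³`), and let `H` be a plane defined over `ℚ`.
Then the induced rational map `Sec(C) ⇢ H`, factoring through `Sym²(C)`, is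
generically finite of degree `> 1` (generic fibers are finite with at least two
unordered pairs, i.e. at least 4 ordered pairs), and there is a rational point `u`
of `H` with finite fiber that is not the image of any rational point of `Sec(C)`:
no Galois-stable (i.e. rational) secant pair of `C` has its secant line passing
through `u`. -/
theorem stmt_19 (C : Set P3Bar) (hC : IsCurveP3 C)
    (hCgal : ∀ σ : QBar ≃ₐ[ℚ] QBar, galMap σ '' C = C)
    -- genus ≥ 1 (a fortiori true when the genus is ≥ 2): `C` is not rational,
    -- i.e. not parametrized by `ℙ¹`:
    (hgenus : ¬ ∃ (d : ℕ) (G : Fin 4 → MvPolynomial (Fin 2) QBar),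
      (∀ i, (G i).IsHomogeneous d) ∧
      {x : P3Bar | ∃ v : Fin 2 → QBar, ∃ hv : (fun i => eval v (G i)) ≠ 0,
        x = Projectivization.mk QBar (fun i => eval v (G i)) hv} = C)
    -- the secant map is dominant:
    (hdom : @closure _ zariskiP3 (secantImage C) = Set.univ)
    -- a plane `H` defined over `ℚ`:
    (c : Fin 4 → ℚ) (hc : c ≠ 0) (H : Set P3Bar)
    (hH : H = {x : P3Bar | ∑ i, ((c i : ℚ) : QBar) * x.rep i = 0}) :
    -- the map `Sym²(C) ⇢ H` is generically finite of degree > 1: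
    H ⊆ @closure _ zariskiP3
      {u ∈ H | (secantFiber C u).Finite ∧ 4 ≤ (secantFiber C u).ncard} ∧
    -- and by Hilbert irreducibility a good rational point of `H` exists:
    ∃ u ∈ H, IsRatPoint u ∧ (secantFiber C u).Finite ∧
      ∀ a ∈ C, ∀ b ∈ C, a ≠ b → u ∈ projLineBar a b →
        ¬ (∀ σ : QBar ≃ₐ[ℚ] QBar, ({galMap σ a, galMap σ b} : Set P3Bar) = {a, b}) := by
  exact S19.final C hC hCgal hgenus hdom c hc H hH
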